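/- Let Φ : [0,1] → ℝ be nondecreasing. Then the supremum of ∫_𝔻 Φ(u_f(z)²) dm(z) over all f ∈ H²(𝔻) with ‖f‖_{H²} = 1 equals ∫₀¹ Φ(s) s⁻² ds, and the supremum is attained for every f ∈ M. Moreover, if Φ is strictly increasing near 1 (i.e. Φ(s) < lim_{t→1⁻} Φ(t) for all s < 1) and the supremum is finite, then it is attained only for f ∈ M. -/

import Mathlib

open MeasureTheory

/-- The squared Hardy norm `‖f‖_{H²}² = sup_{0<r<1} (2π)⁻¹ ∫_{−π}^{π} |f(re^{iφ})|² dφ`. -/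
noncomputable def hardyNormSq (f : ℂ → ℂ) : ℝ :=
  ⨆ r : Set.Ioo (0:ℝ) 1,
    (2*Real.pi)⁻¹ * ∫ φ in Set.Ioc (-Real.pi) Real.pi,
      ‖f (((r : ℝ) : ℂ) * Complex.exp (Complex.I * (φ:ℂ)))‖^2

/-- `u_f(z) = |f(z)| (1−|z|²)^{1/2}`. -/
noncomputable def uHardy (f : ℂ → ℂ) (z : ℂ) : ℝ := ‖f z‖ * Real.sqrt (1 - ‖z‖^2)

/-- The optimizer set `M`: the functions agreeing on `𝔻` with
`z ↦ e^{iθ} (1−|w|²)^{1/2} (1 − conj(w) z)⁻¹` for some `w ∈ 𝔻`, `θ ∈ ℝ`. -/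
def hardyOpt : Set (ℂ → ℂ) :=
  {f | ∃ w : ℂ, ∃ θ : ℝ, ‖w‖ < 1 ∧ ∀ z ∈ Metric.ball (0:ℂ) 1,
    f z = Complex.exp (Complex.I * (θ:ℂ)) * ((Real.sqrt (1 - ‖w‖^2) : ℝ) : ℂ) *
      (1 - (starRingEnd ℂ) w * z)⁻¹}

section

open Set Filter Topology
open scoped ENNReal ComplexConjugate

/-- The normalized hyperbolic area `π⁻¹ (1 - |z|²)⁻² dA` on the unit disk. -/
noncomputable def hypMeasure : Measure ℂ :=
  (volume.restrict (Metric.ball (0:ℂ) 1)).withDensity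
    (fun z => ENNReal.ofReal (Real.pi⁻¹ * ((1 - ‖z‖^2)^2)⁻¹))

/-- The involutive disk automorphism exchanging `0` and `x`. -/
noncomputable def mob (x z : ℂ) : ℂ := (x - z) / (1 - conj x * z)

lemma norm_sq_lt_one {z : ℂ} (hz : ‖z‖ < 1) : ‖z‖^2 < 1 := by
  have := norm_nonneg z; nlinarith

lemma one_sub_conj_mul_ne_zero {x z : ℂ} (hx : ‖x‖ < 1) (hz : ‖z‖ < 1) :
    1 - conj x * z ≠ 0 := by
  intro h
  have h1 : conj x * z = 1 := (sub_eq_zero.mp h).symm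
  have h2 : ‖x‖ * ‖z‖ = 1 := by
    rw [← Complex.norm_conj x, ← norm_mul, h1, norm_one]
  nlinarith [norm_nonneg x, norm_nonneg z]

lemma sq_norm_eq (z : ℂ) : ‖z‖^2 = z.re^2 + z.im^2 := by
  rw [← Complex.normSq_eq_norm_sq, Complex.normSq_apply]; ring

lemma one_sub_norm_sq_mob {x z : ℂ} (hx : ‖x‖ < 1) (hz : ‖z‖ < 1) :
    1 - ‖mob x z‖^2 = (1 - ‖x‖^2) * (1 - ‖z‖^2) / ‖1 - conj x * z‖^2 := by
  have h := one_sub_conj_mul_ne_zero hx hz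
  have h' : ‖1 - conj x * z‖^2 ≠ 0 := by positivity
  rw [mob, norm_div, div_pow, eq_div_iff h', sub_mul, div_mul_cancel₀ _ h']
  simp only [sq_norm_eq]
  simp
  ring

lemma norm_mob_lt_one {x z : ℂ} (hx : ‖x‖ < 1) (hz : ‖z‖ < 1) : ‖mob x z‖ < 1 := by
  have h := one_sub_conj_mul_ne_zero hx hz
  have h1 := one_sub_norm_sq_mob hx hz
  have h2 : 0 < (1 - ‖x‖^2) * (1 - ‖z‖^2) / ‖1 - conj x * z‖^2 := by
    have := norm_sq_lt_one hx
    have := norm_sq_lt_one hz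
    have : 0 < ‖1 - conj x * z‖ := norm_pos_iff.mpr h
    exact div_pos (mul_pos (by linarith) (by linarith)) (by positivity)
  nlinarith [norm_nonneg (mob x z)]

lemma one_sub_norm_sq_ne_zero {x : ℂ} (hx : ‖x‖ < 1) : (1 - conj x * x) ≠ 0 := one_sub_conj_mul_ne_zero hx hx

lemma mob_mob {x z : ℂ} (hx : ‖x‖ < 1) (hz : ‖z‖ < 1) : mob x (mob x z) = z := by
  have h := one_sub_conj_mul_ne_zero hx hz
  have h2 := one_sub_norm_sq_ne_zero hx
  have h3 := one_sub_conj_mul_ne_zero hx (norm_mob_lt_one hx hz)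
  have hq : mob x z * (1 - conj x * z) = x - z := div_mul_cancel₀ _ h
  rw [mob, div_eq_iff h3]
  linear_combination -hq

@[simp] lemma mob_zero_right (x : ℂ) : mob x 0 = x := by simp [mob]

lemma norm_mob_comm (x y : ℂ) : ‖mob x y‖ = ‖mob y x‖ := by
  unfold mob
  rw [norm_div, norm_div, norm_sub_rev x y, ← Complex.norm_conj (1 - conj x * y)]
  simp [mul_comm]

lemma measurable_mob (x : ℂ) : Measurable (mob x) := by unfold mob; fun_prop

lemma measurable_mob₂ : Measurable (fun p : ℂ × ℂ => mob p.1 p.2) := by unfold mob; fun_prop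

lemma hasDerivAt_mob {x z : ℂ} (hx : ‖x‖ < 1) (hz : ‖z‖ < 1) :
    HasDerivAt (mob x) (-(1 - conj x * x) / (1 - conj x * z)^2) z := by
  have h := one_sub_conj_mul_ne_zero hx hz
  have h1 : HasDerivAt (fun z => x - z) (-1) z := by
    simpa using (hasDerivAt_id z).const_sub x
  have h2 : HasDerivAt (fun z => 1 - conj x * z) (-conj x) z := by
    simpa using ((hasDerivAt_id z).const_mul (conj x)).const_sub 1
  refine (h1.fun_div h2 h).congr_deriv ?_
  ring

lemma measurable_hypDensity :
    Measurable (fun z : ℂ => ENNReal.ofReal (Real.pi⁻¹ * ((1 - ‖z‖^2)^2)⁻¹)) := by fun_prop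

lemma lintegral_hypMeasure (F : ℂ → ℝ≥0∞) (hF : Measurable F) :
    ∫⁻ z, F z ∂hypMeasure = ∫⁻ z in Metric.ball (0:ℂ) 1,
      ENNReal.ofReal (Real.pi⁻¹ * ((1 - ‖z‖^2)^2)⁻¹) * F z := by
  rw [hypMeasure, lintegral_withDensity_eq_lintegral_mul _ measurable_hypDensity hF]
  rfl

lemma image_mob_ball {x : ℂ} (hx : ‖x‖ < 1) :
    Set.image (mob x) (Metric.ball 0 1) = Metric.ball 0 1 := by
  ext z
  simp only [mem_image, mem_ball_zero_iff]
  constructor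
  · rintro ⟨y, hy, rfl⟩; exact norm_mob_lt_one hx hy
  · intro hz; exact ⟨mob x z, norm_mob_lt_one hx hz, mob_mob hx hz⟩

lemma injOn_mob {x : ℂ} (hx : ‖x‖ < 1) : InjOn (mob x) (Metric.ball 0 1) := by
  intro a ha b hb h
  rw [← mob_mob hx (mem_ball_zero_iff.mp ha), h, mob_mob hx (mem_ball_zero_iff.mp hb)]

lemma det_restrictScalars_smulRight (a : ℂ) :
    (((ContinuousLinearMap.toSpanSingleton ℂ a)).restrictScalars ℝ).det = ‖a‖^2 := by
  rw [ContinuousLinearMap.det]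
  have : ((ContinuousLinearMap.restrictScalars ℝ (ContinuousLinearMap.toSpanSingleton ℂ a)) : ℂ →ₗ[ℝ] ℂ) = LinearMap.mulLeft ℝ a := by
    ext; simp [mul_comm]
  rw [this, ← Complex.normSq_eq_norm_sq]
  have h2 := Algebra.norm_complex_apply a
  rw [Algebra.norm_apply] at h2
  exact h2

lemma measurePreserving_mob {x : ℂ} (hx : ‖x‖ < 1) :
    MeasurePreserving (mob x) hypMeasure hypMeasure := by
  refine ⟨measurable_mob x, ?_⟩
  refine Measure.ext_of_lintegral _ fun F hF => ?_
  rw [lintegral_map hF (measurable_mob x), lintegral_hypMeasure (fun z => F (mob x z)) (hF.comp (measurable_mob x)),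
    lintegral_hypMeasure _ hF]
  conv_rhs => rw [← image_mob_ball hx]
  rw [lintegral_image_eq_lintegral_abs_det_fderiv_mul volume measurableSet_ball
    (f' := fun z => (ContinuousLinearMap.toSpanSingleton ℂ
      (-(1 - conj x * x) / (1 - conj x * z)^2)).restrictScalars ℝ) _ (injOn_mob hx)]
  · refine setLIntegral_congr_fun measurableSet_ball fun z hz => ?_
    have hz : ‖z‖ < 1 := mem_ball_zero_iff.mp hz
    rw [← mul_assoc, ← ENNReal.ofReal_mul (abs_nonneg _), one_sub_norm_sq_mob hx hz,
      det_restrictScalars_smulRight]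
    congr 2
    have h := one_sub_conj_mul_ne_zero hx hz
    have h' : ‖1 - conj x * z‖ ≠ 0 := by positivity
    have h3 : ‖1 - conj x * x‖ = 1 - ‖x‖^2 := by
      rw [mul_comm, Complex.mul_conj, Complex.normSq_eq_norm_sq, ← Complex.ofReal_one,
        ← Complex.ofReal_sub, Complex.norm_real, Real.norm_of_nonneg]
      have := norm_sq_lt_one hx; linarith
    have h4 := norm_sq_lt_one hx
    have h5 := norm_sq_lt_one hz
    have h6 : 1 - ‖x‖^2 ≠ 0 := by linarith
    have h7 : 1 - ‖z‖^2 ≠ 0 := by linarith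
    rw [norm_div, norm_neg, norm_pow, h3, abs_of_nonneg (by positivity)]
    field_simp
  · intro z hz
    exact ((hasDerivAt_mob hx (mem_ball_zero_iff.mp hz)).hasFDerivAt.restrictScalars ℝ).hasFDerivWithinAt

lemma measurePreserving_isometry (L : ℂ ≃ₗᵢ[ℝ] ℂ) :
    MeasurePreserving L hypMeasure hypMeasure := by
  refine ⟨L.continuous.measurable, ?_⟩
  refine Measure.ext_of_lintegral _ fun F hF => ?_
  rw [lintegral_map hF L.continuous.measurable,
    lintegral_hypMeasure (fun z => F (L z)) (hF.comp L.continuous.measurable),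
    lintegral_hypMeasure _ hF]
  have h := (L.measurePreserving.restrict_preimage (measurableSet_ball (x := (0:ℂ)) (ε := 1)))
  have hpre : L ⁻¹' (Metric.ball (0:ℂ) 1) = Metric.ball 0 1 := by ext z; simp
  rw [hpre] at h
  simpa using h.lintegral_comp (measurable_hypDensity.mul hF)

/-- Reflection of the disk in the geodesic orthogonal to the unit circle with euclidean center `c`. -/
noncomputable def hypRefl (c z : ℂ) : ℂ := (c / conj c) * conj (mob (conj c)⁻¹ z)

lemma norm_inv_conj_lt_one {c : ℂ} (hc : 1 < ‖c‖) : ‖(conj c)⁻¹‖ < 1 := by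
  rw [norm_inv, Complex.norm_conj]; exact inv_lt_one_of_one_lt₀ hc

lemma ne_zero_of_one_lt_norm {c : ℂ} (hc : 1 < ‖c‖) : c ≠ 0 := by
  rintro rfl; simp at hc; linarith

lemma norm_div_conj {c : ℂ} (hc : c ≠ 0) : ‖c / conj c‖ = 1 := by
  rw [norm_div, Complex.norm_conj, div_self (norm_ne_zero_iff.mpr hc)]

lemma measurePreserving_hypRefl {c : ℂ} (hc : 1 < ‖c‖) :
    MeasurePreserving (hypRefl c) hypMeasure hypMeasure := by
  have h0 := ne_zero_of_one_lt_norm hc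
  have h1 := measurePreserving_mob (norm_inv_conj_lt_one hc)
  have h2 := measurePreserving_isometry Complex.conjLIE
  have h3 := measurePreserving_isometry (rotation ⟨c / conj c, by
    simpa [Submonoid.unitSphere] using norm_div_conj h0⟩)
  exact h3.comp (h2.comp h1)

lemma norm_sq_sub_ne {c z : ℂ} (hc : 1 < ‖c‖) (hz : ‖z‖ < 1) : conj c - conj z ≠ 0 := by
  intro h
  have h1 : ‖c‖ = ‖z‖ := by
    rw [← Complex.norm_conj c, sub_eq_zero.mp h, Complex.norm_conj]
  linarith

lemma hypRefl_eq {c z : ℂ} (hc : 1 < ‖c‖) (hz : ‖z‖ < 1) :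
    hypRefl c z = (1 - c * conj z) / (conj c - conj z) := by
  have h0 := ne_zero_of_one_lt_norm hc
  have h0' : conj c ≠ 0 := by simpa using h0
  have h1 := norm_sq_sub_ne hc hz
  have h2 : 1 - (conj c)⁻¹ * conj z ≠ 0 := by
    intro h; apply h1
    field_simp at h
    simpa using h
  unfold hypRefl mob
  simp only [map_div₀, map_sub, map_inv₀, Complex.conj_conj, map_one, map_mul]
  rw [div_mul_div_comm, div_eq_div_iff (mul_ne_zero h0' h2) h1]
  field_simp

lemma norm_hypRefl {c z : ℂ} (hc : 1 < ‖c‖) (hz : ‖z‖ < 1) : ‖hypRefl c z‖ < 1 := by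
  rw [hypRefl, norm_mul, norm_div_conj (ne_zero_of_one_lt_norm hc), one_mul, Complex.norm_conj]
  exact norm_mob_lt_one (norm_inv_conj_lt_one hc) hz

lemma hypRefl_hypRefl {c z : ℂ} (hc : 1 < ‖c‖) (hz : ‖z‖ < 1) :
    hypRefl c (hypRefl c z) = z := by
  have h1 := norm_sq_sub_ne hc hz
  have h3 := norm_sq_sub_ne hc (norm_hypRefl hc hz)
  have hq : hypRefl c z * (conj c - conj z) = 1 - c * conj z := by
    rw [hypRefl_eq hc hz]; exact div_mul_cancel₀ _ h1
  have hq' := congrArg conj hq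
  simp only [map_mul, map_sub, Complex.conj_conj, map_one] at hq'
  rw [hypRefl_eq hc (norm_hypRefl hc hz), div_eq_iff h3]
  linear_combination -hq'

/-- Positive on the side of the geodesic that contains the origin. -/
noncomputable def side (c z : ℂ) : ℝ := ‖z - c‖^2 - (‖c‖^2 - 1)

lemma hypRefl_sub {c z : ℂ} (hc : 1 < ‖c‖) (hz : ‖z‖ < 1) :
    (hypRefl c z - c) * conj (z - c) = (((‖c‖^2 - 1 : ℝ)) : ℂ) := by
  have h1 := norm_sq_sub_ne hc hz
  have hq : hypRefl c z * (conj c - conj z) = 1 - c * conj z := by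
    rw [hypRefl_eq hc hz]; exact div_mul_cancel₀ _ h1
  have : ((‖c‖^2 : ℝ) : ℂ) = c * conj c := by
    rw [Complex.mul_conj, Complex.normSq_eq_norm_sq]
  push_cast at this ⊢
  rw [this, map_sub]
  linear_combination -hq

lemma norm_sub_pos_of {c z : ℂ} (hc : 1 < ‖c‖) (hz : ‖z‖ < 1) : 0 < ‖z - c‖ := by
  rw [norm_pos_iff, sub_ne_zero]; rintro rfl; linarith

lemma side_hypRefl {c z : ℂ} (hc : 1 < ‖c‖) (hz : ‖z‖ < 1) :
    side c (hypRefl c z) = -((‖c‖^2 - 1) / ‖z - c‖^2) * side c z := by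
  have h1 := congrArg norm (hypRefl_sub hc hz)
  rw [norm_mul, Complex.norm_conj, Complex.norm_real, Real.norm_of_nonneg (by nlinarith)] at h1
  have h2 := norm_sub_pos_of hc hz
  have h3 : ‖hypRefl c z - c‖ = (‖c‖^2 - 1) / ‖z - c‖ := by
    rw [eq_div_iff h2.ne', h1]
  rw [side, h3, side]
  field_simp
  ring

lemma hypRefl_eq_self {c z : ℂ} (hc : 1 < ‖c‖) (hz : ‖z‖ < 1) (h : side c z = 0) :
    hypRefl c z = z := by
  have h1 := hypRefl_sub hc hz
  have h2 := norm_sub_pos_of hc hz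
  have h3 : ((‖c‖^2 - 1 : ℝ) : ℂ) = (z - c) * conj (z - c) := by
    rw [Complex.mul_conj, Complex.normSq_eq_norm_sq]
    unfold side at h; congr 1; linarith
  rw [h3] at h1
  have h4 : conj (z - c) ≠ 0 := by
    rw [← norm_ne_zero_iff, Complex.norm_conj]; exact h2.ne'
  have := mul_right_cancel₀ h4 h1
  simpa using this

lemma one_sub_norm_sq_hypRefl {c z : ℂ} (hc : 1 < ‖c‖) (hz : ‖z‖ < 1) :
    1 - ‖hypRefl c z‖^2 = (1 - ‖z‖^2) * (‖c‖^2 - 1) / ‖z - c‖^2 := by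
  have h1 := norm_sq_sub_ne hc hz
  have h2 := norm_sub_pos_of hc hz
  have h3 : ‖conj c - conj z‖ = ‖z - c‖ := by
    rw [← map_sub, Complex.norm_conj, norm_sub_rev]
  rw [hypRefl_eq hc hz, norm_div, h3, eq_div_iff (by positivity), sub_mul, div_pow,
    div_mul_cancel₀ _ (by positivity)]
  simp only [sq_norm_eq]
  simp
  ring

lemma norm_lt_norm_hypRefl {c z : ℂ} (hc : 1 < ‖c‖) (hz : ‖z‖ < 1) (h : 0 < side c z) :
    ‖z‖ < ‖hypRefl c z‖ := by
  have h1 := one_sub_norm_sq_hypRefl hc hz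
  have h2 := norm_sub_pos_of hc hz
  have h3 : (1 - ‖z‖^2) * (‖c‖^2 - 1) / ‖z - c‖^2 < 1 - ‖z‖^2 := by
    rw [div_lt_iff₀ (by positivity)]
    have := norm_sq_lt_one hz
    unfold side at h
    nlinarith
  exact lt_of_pow_lt_pow_left₀ 2 (norm_nonneg _) (by linarith)

/-- The pseudo-hyperbolic distance through `1 - ρ²`. -/
lemma norm_mob_le_iff {x y y' : ℂ} (hx : ‖x‖ < 1) (hy : ‖y‖ < 1) (hy' : ‖y'‖ < 1) :
    ‖mob x y‖ ≤ ‖mob x y'‖ ↔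
      (1 - ‖y'‖^2) * ‖1 - conj x * y‖^2 ≤ (1 - ‖y‖^2) * ‖1 - conj x * y'‖^2 := by
  have h1 := one_sub_norm_sq_mob hx hy
  have h2 := one_sub_norm_sq_mob hx hy'
  have h3 : 0 < ‖1 - conj x * y‖ := norm_pos_iff.mpr (one_sub_conj_mul_ne_zero hx hy)
  have h4 : 0 < ‖1 - conj x * y'‖ := norm_pos_iff.mpr (one_sub_conj_mul_ne_zero hx hy')
  have h5 : 0 < 1 - ‖x‖^2 := by have := norm_sq_lt_one hx; linarith
  rw [← pow_le_pow_iff_left₀ (norm_nonneg _) (norm_nonneg _) two_ne_zero,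
    ← sub_le_sub_iff_left 1, h1, h2, div_le_div_iff₀ (by positivity) (by positivity),
    mul_assoc, mul_assoc, mul_le_mul_iff_right₀ h5]

lemma mob_hypRefl_key {c x y : ℂ} (hc : 1 < ‖c‖) (hy : ‖y‖ < 1) :
    ‖1 - conj x * hypRefl c y‖^2 * ‖y - c‖^2 =
      ‖1 - conj x * y‖^2 * (‖c‖^2 - 1) + side c x * side c y := by
  have h1 := norm_sq_sub_ne hc hy
  have hq : hypRefl c y * (conj c - conj y) = 1 - c * conj y := by
    rw [hypRefl_eq hc hy]; exact div_mul_cancel₀ _ h1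
  have h3 : ‖conj c - conj y‖ = ‖y - c‖ := by
    rw [← map_sub, Complex.norm_conj, norm_sub_rev]
  have h4 : (1 - conj x * hypRefl c y) * (conj c - conj y) =
      conj c - conj y - conj x + c * conj x * conj y := by
    linear_combination - conj x * hq
  rw [← mul_pow, ← h3, ← norm_mul, h4]
  simp only [side, sq_norm_eq]
  simp
  ring

lemma norm_mob_hypRefl_le_iff {c x y : ℂ} (hc : 1 < ‖c‖) (hx : ‖x‖ < 1) (hy : ‖y‖ < 1) :
    ‖mob x y‖ ≤ ‖mob x (hypRefl c y)‖ ↔ 0 ≤ side c x * side c y := by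
  have h2 := norm_sub_pos_of hc hy
  have h5 : 0 < 1 - ‖y‖^2 := by have := norm_sq_lt_one hy; linarith
  have hk := mob_hypRefl_key (x := x) hc hy
  have h6 : ‖1 - conj x * hypRefl c y‖^2 = (‖1 - conj x * y‖^2 * (‖c‖^2 - 1) + side c x * side c y) / ‖y - c‖^2 := by
    rw [eq_div_iff (by positivity), hk]
  rw [norm_mob_le_iff hx hy (norm_hypRefl hc hy), one_sub_norm_sq_hypRefl hc hy, h6,
    div_mul_eq_mul_div, ← mul_div_assoc, div_le_div_iff_of_pos_right (by positivity),
    mul_assoc, mul_le_mul_iff_right₀ h5, mul_comm (‖c‖^2 - 1)]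
  constructor <;> intro h <;> linarith

lemma norm_mob_hypRefl_ge_iff {c x y : ℂ} (hc : 1 < ‖c‖) (hx : ‖x‖ < 1) (hy : ‖y‖ < 1) :
    ‖mob x (hypRefl c y)‖ ≤ ‖mob x y‖ ↔ side c x * side c y ≤ 0 := by
  have h := norm_mob_hypRefl_le_iff hc hx (norm_hypRefl hc hy)
  rw [hypRefl_hypRefl hc hy, side_hypRefl hc hy] at h
  rw [h]
  have h2 := norm_sub_pos_of hc hy
  have h3 : 0 < (‖c‖^2 - 1) / ‖y - c‖^2 := by
    apply div_pos _ (by positivity); nlinarith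
  constructor
  · intro h; by_contra! h'; nlinarith [mul_pos h3 h']
  · intro h'; nlinarith [mul_nonneg h3.le (neg_nonneg.mpr h')]

lemma norm_mob_hypRefl_hypRefl {c x y : ℂ} (hc : 1 < ‖c‖) (hx : ‖x‖ < 1) (hy : ‖y‖ < 1) :
    ‖mob (hypRefl c x) (hypRefl c y)‖ = ‖mob x y‖ := by
  have hx' := norm_hypRefl hc hx
  have hy' := norm_hypRefl hc hy
  have h1 := one_sub_norm_sq_mob hx hy
  have h2 := one_sub_norm_sq_mob hx' hy'
  have h3 : (1 - conj (hypRefl c x) * hypRefl c y) * ((c - x) * (conj c - conj y)) =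
      (conj (1 - conj x * y)) * ((‖c‖^2 - 1 : ℝ) : ℂ) := by
    have hq : hypRefl c y * (conj c - conj y) = 1 - c * conj y := by
      rw [hypRefl_eq hc hy]; exact div_mul_cancel₀ _ (norm_sq_sub_ne hc hy)
    have hq2 : hypRefl c x * (conj c - conj x) = 1 - c * conj x := by
      rw [hypRefl_eq hc hx]; exact div_mul_cancel₀ _ (norm_sq_sub_ne hc hx)
    have hq' := congrArg conj hq2
    simp only [map_mul, map_sub, Complex.conj_conj, map_one] at hq'
    have : ((‖c‖^2 : ℝ) : ℂ) = c * conj c := by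
      rw [Complex.mul_conj, Complex.normSq_eq_norm_sq]
    push_cast at this ⊢
    rw [this]
    simp only [map_mul, map_sub, Complex.conj_conj, map_one]
    linear_combination -(conj (hypRefl c x)) * (c - x) * hq - (1 - c * conj y) * hq'
  have h4 := congrArg (fun z => ‖z‖^2) h3
  simp only [norm_mul, Complex.norm_conj, Complex.norm_real, mul_pow] at h4
  have hcx := norm_sub_pos_of hc hx
  have hcy := norm_sub_pos_of hc hy
  have e1 : ‖c - x‖ = ‖x - c‖ := norm_sub_rev _ _
  have e2 : ‖conj c - conj y‖ = ‖y - c‖ := by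
    rw [← map_sub, Complex.norm_conj, norm_sub_rev]
  have h5 : (0:ℝ) < ‖c‖^2 - 1 := by nlinarith
  rw [e1, e2, Real.norm_of_nonneg h5.le] at h4
  have h6 : 0 < ‖1 - conj x * y‖ := norm_pos_iff.mpr (one_sub_conj_mul_ne_zero hx hy)
  have h7 : 0 < ‖1 - conj (hypRefl c x) * hypRefl c y‖ :=
    norm_pos_iff.mpr (one_sub_conj_mul_ne_zero hx' hy')
  rw [one_sub_norm_sq_hypRefl hc hx, one_sub_norm_sq_hypRefl hc hy] at h2
  have h8 : 1 - ‖mob (hypRefl c x) (hypRefl c y)‖^2 = 1 - ‖mob x y‖^2 := by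
    rw [h1, h2]
    generalize ‖1 - conj x * y‖ = A at *
    generalize ‖1 - conj (hypRefl c x) * hypRefl c y‖ = B at *
    generalize ‖x - c‖ = a at *
    generalize ‖y - c‖ = b at *
    generalize ‖c‖^2 - 1 = d at *
    field_simp
    linear_combination -((1 - ‖x‖^2) * (1 - ‖y‖^2)) * h4
  exact (pow_left_inj₀ (norm_nonneg _) (norm_nonneg _) two_ne_zero).mp (by linarith)

/-- Two points at different distances from the origin are exchanged by a reflection. -/
lemma exists_hypRefl {x y : ℂ} (hy : ‖y‖ < 1) (hxy : ‖x‖ < ‖y‖) :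
    ∃ c : ℂ, 1 < ‖c‖ ∧ hypRefl c x = y ∧ 0 < side c x := by
  have hx : ‖x‖ < 1 := hxy.trans hy
  have hd : 0 < ‖y‖^2 - ‖x‖^2 := by nlinarith [norm_nonneg x]
  set c : ℂ := (y * ((1 - ‖x‖^2 : ℝ) : ℂ) - x * ((1 - ‖y‖^2 : ℝ) : ℂ)) / ((‖y‖^2 - ‖x‖^2 : ℝ) : ℂ) with hcdef
  have hdc : ((‖y‖^2 - ‖x‖^2 : ℝ) : ℂ) ≠ 0 := by exact_mod_cast hd.ne'
  have hceq : c * ((‖y‖^2 - ‖x‖^2 : ℝ) : ℂ) = y * ((1 - ‖x‖^2 : ℝ) : ℂ) - x * ((1 - ‖y‖^2 : ℝ) : ℂ) :=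
    by rw [hcdef]; exact div_mul_cancel₀ _ hdc
  clear_value c; clear hcdef
  have hX := norm_sq_lt_one hx
  have hY := norm_sq_lt_one hy
  have hne : 0 < ‖x - y‖ := by rw [norm_pos_iff, sub_ne_zero]; rintro rfl; linarith
  have hc1 : (‖c‖^2 - 1) * (‖y‖^2 - ‖x‖^2)^2 = (1 - ‖x‖^2) * (1 - ‖y‖^2) * ‖x - y‖^2 := by
    have h := congrArg (fun z => ‖z‖^2) hceq
    simp only [norm_mul, mul_pow, Complex.norm_real, Real.norm_eq_abs, sq_abs] at h
    have key : ∀ p q : ℝ, ‖y * (p : ℂ) - x * (q : ℂ)‖^2 =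
        (y.re * p - x.re * q)^2 + (y.im * p - x.im * q)^2 := by
      intro p q; rw [sq_norm_eq]; simp
    rw [sub_mul, h, key, sq_norm_eq x, sq_norm_eq y, sq_norm_eq (x - y), Complex.sub_re,
      Complex.sub_im]
    ring
  have hc : 1 < ‖c‖ := by
    have : 0 < (‖c‖^2 - 1) * (‖y‖^2 - ‖x‖^2)^2 := by
      rw [hc1]; exact mul_pos (mul_pos (by linarith) (by linarith)) (by positivity)
    have h2 : 0 < ‖c‖^2 - 1 := by
      by_contra! h; nlinarith [sq_nonneg (‖y‖^2 - ‖x‖^2)]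
    by_contra! h; nlinarith [norm_nonneg c]
  have hr : hypRefl c x = y := by
    rw [hypRefl_eq hc hx, div_eq_iff (norm_sq_sub_ne hc hx)]
    have hx2 : ((‖x‖^2 : ℝ) : ℂ) = x * conj x := by
      rw [Complex.mul_conj, Complex.normSq_eq_norm_sq]
    have hy2 : ((‖y‖^2 : ℝ) : ℂ) = y * conj y := by
      rw [Complex.mul_conj, Complex.normSq_eq_norm_sq]
    have hceq' := congrArg conj hceq
    simp only [map_mul, map_sub, Complex.conj_ofReal] at hceq'
    apply mul_right_cancel₀ hdc
    push_cast at hceq hceq' hx2 hy2 ⊢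
    linear_combination -(conj x) * hceq - y * hceq' - (1 - (‖y‖ : ℂ)^2) * hx2 +
      (1 - (‖x‖ : ℂ)^2) * hy2
  refine ⟨c, hc, hr, ?_⟩
  have h1 := one_sub_norm_sq_hypRefl hc hx
  rw [hr, eq_div_iff (by have := norm_sub_pos_of hc hx; positivity)] at h1
  unfold side
  by_contra! h
  have hP : 0 < ‖c‖^2 - 1 := by nlinarith
  nlinarith [mul_pos hd hP, mul_nonneg (sub_pos.mpr hY).le (neg_nonneg.mpr h)]

lemma lintegral_hyp_polar (F : ℂ → ℝ≥0∞) (hF : Measurable F) :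
    ∫⁻ z, F z ∂hypMeasure = ENNReal.ofReal (2 * Real.pi)⁻¹ *
      ∫⁻ θ in Ioo (-Real.pi) Real.pi, ∫⁻ t in Ioo (0:ℝ) 1,
        ENNReal.ofReal ((1 - t)^2)⁻¹ * F (Real.sqrt t * Complex.exp (Complex.I * θ)) := by
  have hinner : ∀ θ : ℝ, ∫⁻ t in Ioo (0:ℝ) 1,
        ENNReal.ofReal ((1 - t)^2)⁻¹ * F (Real.sqrt t * Complex.exp (Complex.I * θ)) =
      ∫⁻ r in Ioo (0:ℝ) 1, ENNReal.ofReal (2 * r) * (ENNReal.ofReal ((1 - r^2)^2)⁻¹ *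
        F (r * Complex.exp (Complex.I * θ))) := by
    intro θ
    have himg : Set.image (fun r : ℝ => r^2) (Ioo (0:ℝ) 1) = Ioo 0 1 := by
      ext t; constructor
      · rintro ⟨r, ⟨h0, h1⟩, rfl⟩
        exact ⟨by positivity, by nlinarith⟩
      · rintro ⟨h0, h1⟩
        refine ⟨Real.sqrt t, ⟨Real.sqrt_pos.mpr h0, ?_⟩, Real.sq_sqrt h0.le⟩
        rw [Real.sqrt_lt' one_pos]; simpa using h1
    conv_lhs => rw [← himg]
    rw [lintegral_image_eq_lintegral_abs_deriv_mul measurableSet_Ioo (f' := fun r => 2 * r)]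
    · refine setLIntegral_congr_fun measurableSet_Ioo fun r hr => ?_
      have hr0 : 0 < r := hr.1
      rw [Real.sqrt_sq hr0.le, abs_of_pos (by positivity)]
    · intro r _
      simpa using (hasDerivAt_pow 2 r).hasDerivWithinAt
    · intro a ha b hb h
      exact (pow_left_inj₀ ha.1.le hb.1.le two_ne_zero).mp h
  simp_rw [hinner]
  rw [lintegral_hypMeasure F hF, ← lintegral_indicator measurableSet_ball,
    ← Complex.lintegral_comp_polarCoord_symm, polarCoord_target]
  rw [Measure.volume_eq_prod, ← Measure.prod_restrict, lintegral_prod_symm', ← lintegral_const_mul]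
  · refine lintegral_congr fun θ => ?_
    rw [← lintegral_indicator measurableSet_Ioo, ← lintegral_const_mul, ← lintegral_indicator measurableSet_Ioi]
    · refine lintegral_congr fun r => ?_
      have hz : Complex.polarCoord.symm (r, θ) = r * Complex.exp (Complex.I * θ) := by
        rw [Complex.polarCoord_symm_apply, mul_comm Complex.I, Complex.exp_mul_I]; push_cast; rfl
      have hn : ‖(r:ℂ) * Complex.exp (Complex.I * θ)‖ = |r| := by
        rw [norm_mul, mul_comm Complex.I, Complex.norm_exp_ofReal_mul_I]; simp
      by_cases hr : 0 < r
      · rw [indicator_of_mem (show r ∈ Ioi 0 from hr)]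
        simp only
        rw [hz]
        by_cases hr1 : r < 1
        · rw [indicator_of_mem (show r ∈ Ioo 0 1 from ⟨hr, hr1⟩), indicator_of_mem]
          · rw [hn, smul_eq_mul, abs_of_pos hr, ← mul_assoc, ← mul_assoc, ← mul_assoc,
              ← ENNReal.ofReal_mul hr.le, ← ENNReal.ofReal_mul (by positivity),
              ← ENNReal.ofReal_mul (by positivity)]
            congr 2
            field_simp
          · rw [mem_ball_zero_iff, hn, abs_of_pos hr]; exact hr1
        · rw [indicator_of_notMem (fun h : r ∈ Ioo 0 1 => hr1 h.2), indicator_of_notMem]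
          · simp
          · rw [mem_ball_zero_iff, hn, abs_of_pos hr]; exact hr1
      · rw [indicator_of_notMem (show r ∉ Ioi 0 from hr),
          indicator_of_notMem (fun h : r ∈ Ioo 0 1 => hr h.1), mul_zero]
    · refine Measurable.indicator ?_ measurableSet_Ioo
      fun_prop
  · apply Measurable.lintegral_prod_right'
      (f := fun p : ℝ × ℝ => ENNReal.ofReal (2 * p.2) * (ENNReal.ofReal ((1 - p.2^2)^2)⁻¹ *
        F (p.2 * Complex.exp (Complex.I * p.1))))
    fun_prop
  · refine Measurable.mul (by fun_prop) ?_
    have hm : Measurable (fun p : ℝ × ℝ => Complex.polarCoord.symm p) := by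
      have : (fun p : ℝ × ℝ => Complex.polarCoord.symm p) =
          fun p => p.1 * (Real.cos p.2 + Real.sin p.2 * Complex.I) := by
        funext p; exact Complex.polarCoord_symm_apply p
      rw [this]; fun_prop
    exact ((measurable_hypDensity.mul hF).indicator measurableSet_ball).comp hm

lemma lintegral_hyp_radial (φ : ℝ → ℝ≥0∞) (hφ : Measurable φ) :
    ∫⁻ z, φ (‖z‖^2) ∂hypMeasure = ∫⁻ t in Ioo (0:ℝ) 1, ENNReal.ofReal ((1 - t)^2)⁻¹ * φ t := by
  rw [lintegral_hyp_polar _ (by fun_prop)]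
  have : ∀ θ : ℝ, ∫⁻ t in Ioo (0:ℝ) 1,
        ENNReal.ofReal ((1 - t)^2)⁻¹ * φ (‖Real.sqrt t * Complex.exp (Complex.I * θ)‖^2) =
        ∫⁻ t in Ioo (0:ℝ) 1, ENNReal.ofReal ((1 - t)^2)⁻¹ * φ t := by
    intro θ
    refine setLIntegral_congr_fun measurableSet_Ioo fun t ht => ?_
    rw [norm_mul, mul_comm Complex.I, Complex.norm_exp_ofReal_mul_I, Complex.norm_real, mul_one,
      Real.norm_eq_abs, sq_abs, Real.sq_sqrt ht.1.le]
  simp_rw [this]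
  rw [lintegral_const, Measure.restrict_apply_univ, Real.volume_Ioo, mul_comm, mul_assoc,
    ← ENNReal.ofReal_mul (by linarith [Real.pi_pos])]
  have : (Real.pi - -Real.pi) * (2 * Real.pi)⁻¹ = 1 := by
    have := Real.pi_ne_zero; field_simp; ring
  rw [this]; simp

lemma lintegral_inv_one_sub_sq {a : ℝ} (h0 : 0 ≤ a) (h1 : a < 1) :
    ∫⁻ t in Ioo (0:ℝ) a, ENNReal.ofReal ((1 - t)^2)⁻¹ = ENNReal.ofReal (a / (1 - a)) := by
  have hd : ∀ t ∈ uIcc 0 a, HasDerivAt (fun t : ℝ => (1 - t)⁻¹) ((1 - t)^2)⁻¹ t := by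
    intro t ht
    rw [uIcc_of_le h0] at ht
    have : (1 - t) ≠ 0 := by linarith [ht.2]
    have h := ((hasDerivAt_id t).const_sub 1).inv this
    refine h.congr_deriv ?_
    simp
  have hi : IntervalIntegrable (fun t : ℝ => ((1 - t)^2)⁻¹) volume 0 a := by
    apply ContinuousOn.intervalIntegrable
    apply ContinuousOn.inv₀ (by fun_prop)
    intro t ht
    rw [uIcc_of_le h0] at ht
    have : (1 - t) ≠ 0 := by linarith [ht.2]
    positivity
  have h := intervalIntegral.integral_eq_sub_of_hasDerivAt hd hi
  rw [intervalIntegral.integral_of_le h0, integral_Ioc_eq_integral_Ioo] at h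
  rw [← ofReal_integral_eq_lintegral_ofReal, h]
  · congr 1; have : 1 - a ≠ 0 := by linarith
    field_simp; ring
  · exact ((intervalIntegrable_iff_integrableOn_Ioc_of_le h0).mp hi).mono_set Ioo_subset_Ioc_self
  · exact ae_of_all _ fun t => by positivity

lemma hyp_ball {r : ℝ} (h0 : 0 ≤ r) (h1 : r < 1) :
    hypMeasure (Metric.ball 0 r) = ENNReal.ofReal (r^2 / (1 - r^2)) := by
  have h := lintegral_hyp_radial ((Iio (r^2)).indicator 1) (measurable_one.indicator measurableSet_Iio)
  have h2 : (fun z : ℂ => (Iio (r^2)).indicator (1 : ℝ → ℝ≥0∞) (‖z‖^2)) = (Metric.ball 0 r).indicator 1 := by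
    funext z
    by_cases hz : ‖z‖ < r
    · rw [indicator_of_mem (show z ∈ Metric.ball 0 r from mem_ball_zero_iff.mpr hz),
        indicator_of_mem (show ‖z‖^2 ∈ Iio (r^2) from
          pow_lt_pow_left₀ hz (norm_nonneg z) two_ne_zero)]
      rfl
    · rw [indicator_of_notMem (fun h : z ∈ Metric.ball 0 r => hz (mem_ball_zero_iff.mp h)),
        indicator_of_notMem (fun h : ‖z‖^2 ∈ Iio (r^2) => hz
          (lt_of_pow_lt_pow_left₀ 2 h0 h))]
  rw [h2, lintegral_indicator_one measurableSet_ball] at h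
  have hr : r^2 < 1 := by nlinarith
  rw [h, ← lintegral_inv_one_sub_sq (by positivity) hr, ← lintegral_indicator measurableSet_Ioo, ← lintegral_indicator measurableSet_Ioo]
  refine lintegral_congr fun t => ?_
  simp only [indicator_apply, mem_Iio, mem_Ioo]
  by_cases h3 : 0 < t <;> by_cases h4 : t < r^2 <;> simp [h3, h4]
  intro; linarith

lemma hyp_compl_disk : hypMeasure (Metric.ball 0 1)ᶜ = 0 := by
  rw [hypMeasure, withDensity_apply _ measurableSet_ball.compl, Measure.restrict_restrict measurableSet_ball.compl]
  simp

lemma ae_hyp_lt_one : ∀ᵐ z ∂hypMeasure, ‖z‖ < 1 := by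
  rw [ae_iff]
  convert hyp_compl_disk using 2
  ext z; simp

lemma hypMeasure_absolutelyContinuous : hypMeasure ≪ (volume : Measure ℂ) :=
  (withDensity_absolutelyContinuous _ _).trans Measure.absolutelyContinuous_restrict

lemma hyp_closedBall {r : ℝ} (h0 : 0 ≤ r) (h1 : r < 1) :
    hypMeasure (Metric.closedBall 0 r) = ENNReal.ofReal (r^2 / (1 - r^2)) := by
  rw [← hyp_ball h0 h1]
  refine le_antisymm ?_ (measure_mono Metric.ball_subset_closedBall)
  rw [← Metric.ball_union_sphere]
  refine (measure_union_le _ _).trans ?_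
  rw [hypMeasure_absolutelyContinuous (Measure.addHaar_sphere volume (0:ℂ) r), add_zero]

instance : SFinite hypMeasure := by unfold hypMeasure; infer_instance

lemma measurePreserving_rot (θ : ℝ) :
    MeasurePreserving (fun z => circleMap 0 1 θ * z) hypMeasure hypMeasure := by
  have h := measurePreserving_isometry (rotation (Circle.exp θ))
  have : (fun z => circleMap 0 1 θ * z) = (rotation (Circle.exp θ)) := by
    funext z; simp [circleMap, rotation_apply]
  rwa [this]

lemma hyp_ball_lt_top {r : ℝ} (h0 : 0 ≤ r) (h1 : r < 1) :
    hypMeasure (Metric.ball 0 r) < ∞ := by rw [hyp_ball h0 h1]; exact ENNReal.ofReal_lt_top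

lemma setIntegral_ball_eq_circleAverage {δ : ℝ} (h0 : 0 ≤ δ) (h1 : δ < 1) {u : ℂ → ℝ}
    (hu : Measurable u) {C : ℝ} (hC : ∀ z, |u z| ≤ C) :
    ∫ ζ in Metric.ball 0 δ, u ζ ∂hypMeasure =
      ∫ ζ in Metric.ball 0 δ, Real.circleAverage (fun w => u (w * ζ)) 0 1 ∂hypMeasure := by
  have : IsFiniteMeasure (hypMeasure.restrict (Metric.ball 0 δ)) :=
    ⟨by rw [Measure.restrict_apply_univ]; exact hyp_ball_lt_top h0 h1⟩
  have hpi : (0:ℝ) ≤ 2 * Real.pi := by positivity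
  simp only [Real.circleAverage_def, intervalIntegral.integral_of_le hpi, smul_eq_mul]
  rw [integral_const_mul, integral_integral_swap]
  · have : ∀ θ : ℝ, ∫ ζ in Metric.ball 0 δ, u (circleMap 0 1 θ * ζ) ∂hypMeasure =
        ∫ ζ in Metric.ball 0 δ, u ζ ∂hypMeasure := by
      intro θ
      have h := (measurePreserving_rot θ).restrict_preimage (measurableSet_ball (x := (0:ℂ)) (ε := δ))
      have hpre : (fun z => circleMap 0 1 θ * z) ⁻¹' (Metric.ball (0:ℂ) δ) = Metric.ball 0 δ := by
        ext z; simp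
      rw [hpre] at h
      rw [← h.map_eq, integral_map h.measurable.aemeasurable hu.aestronglyMeasurable, h.map_eq]
    simp only [this]
    rw [integral_const, smul_eq_mul, measureReal_def, Measure.restrict_apply_univ, Real.volume_Ioc,
      ENNReal.toReal_ofReal (by linarith)]
    have := Real.pi_ne_zero
    field_simp
    ring
  · refine Integrable.of_bound (C := C) ?_ (ae_of_all _ fun p => hC _)
    refine (hu.comp ?_).aestronglyMeasurable
    have : Continuous fun p : ℂ × ℝ => circleMap 0 1 p.2 * p.1 := by
      unfold circleMap; fun_prop
    exact this.measurable

lemma mean_log_norm {δ : ℝ} (h0 : 0 ≤ δ) (h1 : δ < 1) {F : ℂ → ℂ}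
    (hF : DifferentiableOn ℂ F (Metric.ball 0 1))
    (hne : ∀ z ∈ Metric.closedBall (0:ℂ) δ, F z ≠ 0) :
    ∫ ζ in Metric.ball 0 δ, Real.log ‖F ζ‖ ∂hypMeasure =
      hypMeasure.real (Metric.ball 0 δ) * Real.log ‖F 0‖ := by
  have hsub : Metric.closedBall (0:ℂ) δ ⊆ Metric.ball 0 1 := Metric.closedBall_subset_ball h1
  have hcont : ContinuousOn (fun z => Real.log ‖F z‖) (Metric.closedBall 0 δ) :=
    ContinuousOn.log (hF.continuousOn.mono hsub).norm fun z hz => norm_ne_zero_iff.mpr (hne z hz)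
  obtain ⟨C, hC⟩ := (isCompact_closedBall (0:ℂ) δ).exists_bound_of_continuousOn hcont
  set u : ℂ → ℝ := (Metric.closedBall (0:ℂ) δ).indicator (fun z => Real.log ‖F z‖) with hu
  have hum : Measurable u := by
    classical
    rw [hu, ← piecewise_eq_indicator]
    exact ContinuousOn.measurable_piecewise hcont continuousOn_const measurableSet_closedBall
  have hub : ∀ z, |u z| ≤ max C 0 := by
    intro z
    by_cases hz : z ∈ Metric.closedBall (0:ℂ) δ
    · rw [hu, indicator_of_mem hz]; exact (hC z hz).trans (le_max_left _ _)
    · rw [hu, indicator_of_notMem hz]; simp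
  have h := setIntegral_ball_eq_circleAverage h0 h1 hum hub
  have e1 : ∫ ζ in Metric.ball 0 δ, Real.log ‖F ζ‖ ∂hypMeasure = ∫ ζ in Metric.ball 0 δ, u ζ ∂hypMeasure :=
    setIntegral_congr_fun measurableSet_ball fun z hz => by
      rw [hu, indicator_of_mem (Metric.ball_subset_closedBall hz)]
  rw [e1, h]
  have e2 : ∀ ζ ∈ Metric.ball (0:ℂ) δ, Real.circleAverage (fun w => u (w * ζ)) 0 1 = Real.log ‖F 0‖ := by
    intro ζ hζ
    have hζ' : ‖ζ‖ < δ := mem_ball_zero_iff.mp hζ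
    have hmem : ∀ w ∈ Metric.closedBall (0:ℂ) 1, w * ζ ∈ Metric.closedBall (0:ℂ) δ := by
      intro w hw
      rw [mem_closedBall_zero_iff] at hw ⊢
      rw [norm_mul]; nlinarith [norm_nonneg ζ, norm_nonneg w]
    have e3 : Real.circleAverage (fun w => u (w * ζ)) 0 1 =
        Real.circleAverage (fun w => Real.log ‖F (w * ζ)‖) 0 1 := by
      apply Real.circleAverage_congr_sphere
      intro w hw
      have : w * ζ ∈ Metric.closedBall (0:ℂ) δ := hmem w (Metric.sphere_subset_closedBall (by simpa using hw))
      simp only [hu, indicator_of_mem this]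
    rw [e3]
    have := AnalyticOnNhd.circleAverage_log_norm_of_ne_zero (R := 1) (c := 0) (g := fun w => F (w * ζ)) ?_ ?_
    · simpa using this
    · intro w hw
      rw [abs_one] at hw
      have hA : AnalyticAt ℂ F (w * ζ) :=
        hF.analyticAt (Metric.isOpen_ball.mem_nhds (hsub (hmem w hw)))
      exact AnalyticAt.fun_comp (f := fun w => w * ζ) hA (by fun_prop)
    · intro w hw
      rw [abs_one] at hw
      exact hne _ (hmem w hw)
  rw [setIntegral_congr_fun measurableSet_ball e2, setIntegral_const, smul_eq_mul]

/-- The average `∫_{ρ(x,y)<δ} w(y) dm(y)` over a pseudo-hyperbolic disk. -/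
noncomputable def hypAvg (δ : ℝ) (w : ℂ → ℝ) (x : ℂ) : ℝ :=
  ∫ ζ in Metric.ball 0 δ, w (mob x ζ) ∂hypMeasure

lemma differentiableOn_comp_mob {f : ℂ → ℂ} (hf : DifferentiableOn ℂ f (Metric.ball 0 1)) {x : ℂ}
    (hx : ‖x‖ < 1) : DifferentiableOn ℂ (fun ζ => f (mob x ζ)) (Metric.ball 0 1) := by
  refine hf.comp (t := Metric.ball 0 1) ?_ ?_
  · intro z hz
    exact (hasDerivAt_mob hx (mem_ball_zero_iff.mp hz)).differentiableAt.differentiableWithinAt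
  · intro z hz
    exact mem_ball_zero_iff.mpr (norm_mob_lt_one hx (mem_ball_zero_iff.mp hz))

lemma hypAvg_log_norm {δ : ℝ} (h0 : 0 ≤ δ) (h1 : δ < 1) {f : ℂ → ℂ}
    (hf : DifferentiableOn ℂ f (Metric.ball 0 1)) {x : ℂ} (hx : ‖x‖ < 1)
    (hne : ∀ z ∈ Metric.closedBall (0:ℂ) δ, f (mob x z) ≠ 0) :
    hypAvg δ (fun z => Real.log ‖f z‖) x =
      hypMeasure.real (Metric.ball 0 δ) * Real.log ‖f x‖ := by
  have := mean_log_norm h0 h1 (differentiableOn_comp_mob hf hx) hne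
  simpa [hypAvg] using this

lemma continuousOn_mob {x : ℂ} (hx : ‖x‖ < 1) : ContinuousOn (mob x) (Metric.ball 0 1) := fun _ hz =>
  (hasDerivAt_mob hx (mem_ball_zero_iff.mp hz)).continuousAt.continuousWithinAt

lemma integrableOn_log_norm_mob {δ : ℝ} (h0 : 0 ≤ δ) (h1 : δ < 1) {f : ℂ → ℂ}
    (hf : DifferentiableOn ℂ f (Metric.ball 0 1)) {x : ℂ} (hx : ‖x‖ < 1)
    (hne : ∀ z ∈ Metric.closedBall (0:ℂ) δ, f (mob x z) ≠ 0) :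
    IntegrableOn (fun ζ => Real.log ‖f (mob x ζ)‖) (Metric.ball 0 δ) hypMeasure := by
  have hsub : Metric.closedBall (0:ℂ) δ ⊆ Metric.ball 0 1 := Metric.closedBall_subset_ball h1
  have hcont : ContinuousOn (fun z => Real.log ‖f (mob x z)‖) (Metric.closedBall 0 δ) :=
    ContinuousOn.log ((differentiableOn_comp_mob hf hx).continuousOn.mono hsub).norm
      fun z hz => norm_ne_zero_iff.mpr (hne z hz)
  obtain ⟨C, hC⟩ := (isCompact_closedBall (0:ℂ) δ).exists_bound_of_continuousOn hcont
  refine IntegrableOn.of_bound (hyp_ball_lt_top h0 h1)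
    ((hcont.mono Metric.ball_subset_closedBall).aestronglyMeasurable measurableSet_ball) C ?_
  exact (ae_restrict_iff' measurableSet_ball).mpr (ae_of_all _ fun z hz =>
    hC z (Metric.ball_subset_closedBall hz))

/-- The drop of `log (1 - |z|²)` under averaging over disks of radius `δ`. -/
noncomputable def hypDrop (δ : ℝ) : ℝ :=
  ∫ ζ in Metric.ball 0 δ, -Real.log (1 - ‖ζ‖^2) ∂hypMeasure

lemma integrableOn_log_one_sub {δ : ℝ} (h0 : 0 ≤ δ) (h1 : δ < 1) {x : ℂ} (hx : ‖x‖ < 1) :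
    IntegrableOn (fun ζ => Real.log (1 - ‖mob x ζ‖^2)) (Metric.ball 0 δ) hypMeasure := by
  have hsub : Metric.closedBall (0:ℂ) δ ⊆ Metric.ball 0 1 := Metric.closedBall_subset_ball h1
  have hcont : ContinuousOn (fun ζ => Real.log (1 - ‖mob x ζ‖^2)) (Metric.closedBall 0 δ) := by
    refine ContinuousOn.log (continuousOn_const.sub (((continuousOn_mob hx).mono hsub).norm.pow 2)) ?_
    intro z hz
    have := norm_sq_lt_one (norm_mob_lt_one hx (mem_ball_zero_iff.mp (hsub hz)))
    linarith
  obtain ⟨C, hC⟩ := (isCompact_closedBall (0:ℂ) δ).exists_bound_of_continuousOn hcont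
  refine IntegrableOn.of_bound (hyp_ball_lt_top h0 h1)
    ((hcont.mono Metric.ball_subset_closedBall).aestronglyMeasurable measurableSet_ball) C ?_
  exact (ae_restrict_iff' measurableSet_ball).mpr (ae_of_all _ fun z hz =>
    hC z (Metric.ball_subset_closedBall hz))

lemma norm_mob_zero (z : ℂ) : ‖mob 0 z‖ = ‖z‖ := by simp [mob]

lemma hypAvg_log_one_sub {δ : ℝ} (h0 : 0 ≤ δ) (h1 : δ < 1) {x : ℂ} (hx : ‖x‖ < 1) :
    hypAvg δ (fun z => Real.log (1 - ‖z‖^2)) x =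
      hypMeasure.real (Metric.ball 0 δ) * Real.log (1 - ‖x‖^2) - hypDrop δ := by
  have hsub : Metric.closedBall (0:ℂ) δ ⊆ Metric.ball 0 1 := Metric.closedBall_subset_ball h1
  have hm := mean_log_norm h0 h1 (F := fun ζ => 1 - conj x * ζ) (by fun_prop)
    (fun z hz => one_sub_conj_mul_ne_zero hx (mem_ball_zero_iff.mp (hsub hz)))
  simp only [mul_zero, sub_zero, norm_one, Real.log_one] at hm
  have e : ∀ ζ ∈ Metric.ball (0:ℂ) δ, Real.log (1 - ‖mob x ζ‖^2) =
      Real.log (1 - ‖x‖^2) - (-Real.log (1 - ‖ζ‖^2)) - 2 * Real.log ‖1 - conj x * ζ‖ := by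
    intro ζ hζ
    have hz : ‖ζ‖ < 1 := mem_ball_zero_iff.mp (hsub (Metric.ball_subset_closedBall hζ))
    have a1 := norm_sq_lt_one hx
    have a2 := norm_sq_lt_one hz
    have a3 : ‖1 - conj x * ζ‖ ≠ 0 := norm_ne_zero_iff.mpr (one_sub_conj_mul_ne_zero hx hz)
    rw [one_sub_norm_sq_mob hx hz, Real.log_div (by apply mul_ne_zero <;> linarith) (by positivity),
      Real.log_mul (by linarith) (by linarith), Real.log_pow]
    push_cast; ring
  have i1 : IntegrableOn (fun ζ : ℂ => -Real.log (1 - ‖ζ‖^2)) (Metric.ball 0 δ) hypMeasure := by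
    have := integrableOn_log_one_sub h0 h1 (x := 0) (by simp)
    simp only [norm_mob_zero] at this
    exact this.neg
  have i2 : IntegrableOn (fun ζ : ℂ => 2 * Real.log ‖1 - conj x * ζ‖) (Metric.ball 0 δ) hypMeasure := by
    have := (integrableOn_log_norm_mob h0 h1 (f := fun ζ => 1 + conj x * ζ) (x := 0) (by fun_prop) (by simp) ?_).const_mul 2
    · simpa [mob, sub_eq_add_neg, IntegrableOn] using this
    · intro z hz
      have := one_sub_conj_mul_ne_zero hx (mem_ball_zero_iff.mp (hsub hz))
      simpa [mob, sub_eq_add_neg] using this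
  have i0 : IntegrableOn (fun ζ : ℂ => Real.log (1 - ‖x‖^2)) (Metric.ball 0 δ) hypMeasure :=
    integrableOn_const (hyp_ball_lt_top h0 h1).ne
  rw [hypAvg, setIntegral_congr_fun measurableSet_ball e, integral_sub (by exact i0.sub i1) i2, integral_sub i0 i1,
    integral_const_mul, hm, setIntegral_const, smul_eq_mul, hypDrop]
  ring

lemma hypDrop_pos {δ : ℝ} (h0 : 0 < δ) (h1 : δ < 1) : 0 < hypDrop δ := by
  have i1 : IntegrableOn (fun ζ : ℂ => -Real.log (1 - ‖ζ‖^2)) (Metric.ball 0 δ) hypMeasure := by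
    have := integrableOn_log_one_sub h0.le h1 (x := 0) (by simp)
    simp only [norm_mob_zero] at this
    exact this.neg
  have hnn : ∀ z ∈ Metric.ball (0:ℂ) δ, 0 ≤ -Real.log (1 - ‖z‖^2) := by
    intro z hz
    have hz1 : ‖z‖ < 1 := (mem_ball_zero_iff.mp hz).trans h1
    have := norm_sq_lt_one hz1
    have := Real.log_nonpos (x := 1 - ‖z‖^2) (by linarith) (by nlinarith [norm_nonneg z])
    linarith
  rw [hypDrop, setIntegral_pos_iff_support_of_nonneg_ae
    ((ae_restrict_iff' measurableSet_ball).mpr (ae_of_all _ hnn)) i1]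
  have : Metric.ball (0:ℂ) δ \ {0} ⊆ Function.support (fun ζ : ℂ => -Real.log (1 - ‖ζ‖^2)) ∩ Metric.ball 0 δ := by
    intro z hz
    refine ⟨?_, hz.1⟩
    have hz1 : ‖z‖ < 1 := (mem_ball_zero_iff.mp hz.1).trans h1
    have h3 := norm_sq_lt_one hz1
    have h4 : 0 < ‖z‖ := norm_pos_iff.mpr hz.2
    have := Real.log_neg (x := 1 - ‖z‖^2) (by linarith) (by nlinarith)
    simp only [Function.mem_support]; linarith
  refine lt_of_lt_of_le ?_ (measure_mono this)
  rw [measure_sdiff_null (hypMeasure_absolutelyContinuous (by simp)), hyp_ball h0.le h1, ENNReal.ofReal_pos]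
  have := norm_sq_lt_one (z := (δ:ℂ)) (by simpa [abs_of_pos h0] using h1)
  apply div_pos (by positivity); nlinarith

/-- Pairs of points at pseudo-hyperbolic distance less than `δ`. -/
def nearPairs (δ : ℝ) : Set (ℂ × ℂ) := {p | ‖mob p.1 p.2‖ < δ}

lemma measurableSet_nearPairs (δ : ℝ) : MeasurableSet (nearPairs δ) :=
  measurableSet_lt measurable_mob₂.norm measurable_const

/-- The product of the hyperbolic measures restricted to `nearPairs δ`. -/
noncomputable def nearMeasure (δ : ℝ) : Measure (ℂ × ℂ) :=
  (hypMeasure.prod hypMeasure).restrict (nearPairs δ)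

lemma measurePreserving_swap_near (δ : ℝ) :
    MeasurePreserving Prod.swap (nearMeasure δ) (nearMeasure δ) := by
  have h : MeasurePreserving Prod.swap (hypMeasure.prod hypMeasure) (hypMeasure.prod hypMeasure) :=
    Measure.measurePreserving_swap
  have := h.restrict_preimage (measurableSet_nearPairs δ)
  have e : Prod.swap ⁻¹' nearPairs δ = nearPairs δ := by
    ext p; simp [nearPairs, norm_mob_comm p.2 p.1]
  rwa [e] at this

lemma lintegral_near_inner {x : ℂ} (hx : ‖x‖ < 1) (δ : ℝ) (k : ℂ → ℝ≥0∞) (hk : Measurable k) :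
    ∫⁻ y in {y | ‖mob x y‖ < δ}, k y ∂hypMeasure = ∫⁻ ζ in Metric.ball 0 δ, k (mob x ζ) ∂hypMeasure := by
  have hS : MeasurableSet {y | ‖mob x y‖ < δ} := measurableSet_lt (measurable_mob x).norm measurable_const
  rw [← lintegral_indicator hS, ← lintegral_indicator measurableSet_ball,
    ← (measurePreserving_mob hx).lintegral_comp (hk.indicator hS)]
  refine lintegral_congr_ae ?_
  filter_upwards [ae_hyp_lt_one] with ζ hζ
  simp only [indicator, mem_ofPred_eq, mob_mob hx hζ, mem_ball_zero_iff]

lemma integral_near_inner {x : ℂ} (hx : ‖x‖ < 1) (δ : ℝ) (k : ℂ → ℝ) (hk : Measurable k) :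
    ∫ y in {y | ‖mob x y‖ < δ}, k y ∂hypMeasure = ∫ ζ in Metric.ball 0 δ, k (mob x ζ) ∂hypMeasure := by
  have hS : MeasurableSet {y | ‖mob x y‖ < δ} := measurableSet_lt (measurable_mob x).norm measurable_const
  rw [← integral_indicator hS, ← integral_indicator measurableSet_ball]
  conv_lhs => rw [← (measurePreserving_mob hx).map_eq]
  rw [integral_map (measurable_mob x).aemeasurable (hk.indicator hS).aestronglyMeasurable]
  refine integral_congr_ae ?_
  filter_upwards [ae_hyp_lt_one] with ζ hζ
  simp only [indicator, mem_ofPred_eq, mob_mob hx hζ, mem_ball_zero_iff]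

lemma lintegral_near {δ : ℝ} (k : ℂ × ℂ → ℝ≥0∞) (hk : Measurable k) :
    ∫⁻ p, k p ∂(nearMeasure δ) =
      ∫⁻ x, ∫⁻ ζ in Metric.ball 0 δ, k (x, mob x ζ) ∂hypMeasure ∂hypMeasure := by
  rw [nearMeasure, ← lintegral_indicator (measurableSet_nearPairs δ),
    lintegral_prod _ (hk.indicator (measurableSet_nearPairs δ)).aemeasurable]
  refine lintegral_congr_ae ?_
  filter_upwards [ae_hyp_lt_one] with x hx
  rw [← lintegral_near_inner hx δ (fun y => k (x, y)) (by fun_prop), ← lintegral_indicator]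
  · rfl
  · exact measurableSet_lt (measurable_mob x).norm measurable_const

lemma integral_near {δ : ℝ} (k : ℂ × ℂ → ℝ) (hk : Measurable k)
    (hi : Integrable k (nearMeasure δ)) :
    ∫ p, k p ∂(nearMeasure δ) =
      ∫ x, ∫ ζ in Metric.ball 0 δ, k (x, mob x ζ) ∂hypMeasure ∂hypMeasure := by
  rw [nearMeasure, ← integral_indicator (measurableSet_nearPairs δ), integral_prod]
  · refine integral_congr_ae ?_
    filter_upwards [ae_hyp_lt_one] with x hx
    rw [← integral_near_inner hx δ (fun y => k (x, y)) (by fun_prop), ← integral_indicator]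
    · rfl
    · exact measurableSet_lt (measurable_mob x).norm measurable_const
  · exact (integrable_indicator_iff (measurableSet_nearPairs δ)).mpr hi

lemma integrable_near {δ R : ℝ} (h0 : 0 ≤ δ) (h1 : δ < 1) (hR0 : 0 ≤ R) (hR : R < 1) {k : ℂ × ℂ → ℝ}
    (hk : Measurable k) {C : ℝ} (hC : ∀ p, |k p| ≤ C) (hs : ∀ p, k p ≠ 0 → ‖p.1‖ ≤ R) :
    Integrable k (nearMeasure δ) := by
  refine ⟨hk.aestronglyMeasurable, ?_⟩
  have hb : ∀ p, ‖k p‖ₑ ≤ (Metric.closedBall (0:ℂ) R).indicator (fun _ => ENNReal.ofReal C) p.1 := by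
    intro p
    by_cases h : k p = 0
    · simp [h]
    · rw [indicator_of_mem (mem_closedBall_zero_iff.mpr (hs p h)), ← ofReal_norm]
      exact ENNReal.ofReal_le_ofReal (hC p)
  refine (lintegral_mono hb).trans_lt ?_
  rw [lintegral_near _ (show Measurable fun p : ℂ × ℂ =>
    (Metric.closedBall (0:ℂ) R).indicator (fun _ => ENNReal.ofReal C) p.1 from (measurable_const.indicator measurableSet_closedBall).comp measurable_fst)]
  simp only [lintegral_const, Measure.restrict_apply_univ]
  rw [lintegral_mul_const _ (measurable_const.indicator measurableSet_closedBall),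
    lintegral_indicator_const measurableSet_closedBall, hyp_closedBall hR0 hR, hyp_ball h0 h1]
  exact ENNReal.mul_lt_top (ENNReal.mul_lt_top ENNReal.ofReal_lt_top ENNReal.ofReal_lt_top) ENNReal.ofReal_lt_top

lemma integrable_near_swap {δ : ℝ} {k : ℂ × ℂ → ℝ}
    (hk : Integrable k (nearMeasure δ)) : Integrable (fun p => k p.swap) (nearMeasure δ) :=
  (measurePreserving_swap_near δ).integrable_comp_of_integrable hk

lemma integral_near_swap {δ : ℝ} (k : ℂ × ℂ → ℝ) :
    ∫ p, k p.swap ∂(nearMeasure δ) = ∫ p, k p ∂(nearMeasure δ) :=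
  (measurePreserving_swap_near δ).integral_comp MeasurableEquiv.prodComm.measurableEmbedding k

/-- Bounded measurable functions that vanish outside a compact disk. -/
structure CompBdd (R C : ℝ) (w : ℂ → ℝ) : Prop where
  meas : Measurable w
  bdd : ∀ z, |w z| ≤ C
  supp : ∀ z, w z ≠ 0 → ‖z‖ ≤ R

section Bilinear

variable {δ R C C' : ℝ} {w h : ℂ → ℝ}

lemma CompBdd.integrable_mul_fst (h0 : 0 ≤ δ) (h1 : δ < 1) (hR0 : 0 ≤ R) (hR : R < 1)
    (hw : CompBdd R C w) {k : ℂ × ℂ → ℝ} (hk : Measurable k) (hkb : ∀ p, |k p| ≤ C') :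
    Integrable (fun p => w p.1 * k p) (nearMeasure δ) := by
  refine integrable_near h0 h1 hR0 hR ((hw.meas.comp measurable_fst).mul hk) (C := C * C') ?_ ?_
  · intro p
    rw [abs_mul]
    exact mul_le_mul (hw.bdd _) (hkb p) (abs_nonneg _) ((abs_nonneg _).trans (hw.bdd p.1))
  · intro p hp
    exact hw.supp _ (left_ne_zero_of_mul hp)

lemma CompBdd.integrable_mul_snd (h0 : 0 ≤ δ) (h1 : δ < 1) (hR0 : 0 ≤ R) (hR : R < 1)
    (hw : CompBdd R C w) {k : ℂ × ℂ → ℝ} (hk : Measurable k) (hkb : ∀ p, |k p| ≤ C') :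
    Integrable (fun p => w p.2 * k p) (nearMeasure δ) :=
  integrable_near_swap (hw.integrable_mul_fst h0 h1 hR0 hR (k := fun p => k p.swap)
    (hk.comp measurable_swap) (fun p => hkb p.swap))

lemma CompBdd.integrable_mul (hR0 : 0 ≤ R) (hR : R < 1)
    (hw : CompBdd R C w) {k : ℂ → ℝ} (hk : Measurable k) (hkb : ∀ p, |k p| ≤ C') :
    Integrable (fun p => w p * k p) hypMeasure := by
  have hi : IntegrableOn (fun p => w p * k p) (Metric.closedBall 0 R) hypMeasure := by
    refine IntegrableOn.of_bound (by rw [hyp_closedBall hR0 hR]; exact ENNReal.ofReal_lt_top)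
      (hw.meas.mul hk).aestronglyMeasurable (C * C') (ae_of_all _ fun p => ?_)
    rw [Real.norm_eq_abs, abs_mul]
    exact mul_le_mul (hw.bdd _) (hkb p) (abs_nonneg _) ((abs_nonneg _).trans (hw.bdd p))
  refine (integrableOn_iff_integrable_of_support_subset ?_).mp hi
  intro p hp
  exact mem_closedBall_zero_iff.mpr (hw.supp _ (left_ne_zero_of_mul hp))

lemma near_bilin (h0 : 0 ≤ δ) (h1 : δ < 1) (hR0 : 0 ≤ R) (hR : R < 1)
    (hw : CompBdd R C w) (hh : Measurable h) (hhb : ∀ z, |h z| ≤ C') :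
    ∫ p, (w p.1 - w p.2) * (h p.1 - h p.2) ∂(nearMeasure δ) =
      2 * (∫ p, w p.1 * h p.1 ∂(nearMeasure δ) - ∫ p, w p.1 * h p.2 ∂(nearMeasure δ)) ∧
    ∫ p, w p.2 * h p.1 ∂(nearMeasure δ) = ∫ p, w p.1 * h p.2 ∂(nearMeasure δ) := by
  have i1 : Integrable (fun p => w p.1 * h p.1) (nearMeasure δ) :=
    hw.integrable_mul_fst h0 h1 hR0 hR (hh.comp measurable_fst) (fun p => hhb p.1)
  have i2 : Integrable (fun p => w p.1 * h p.2) (nearMeasure δ) :=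
    hw.integrable_mul_fst h0 h1 hR0 hR (hh.comp measurable_snd) (fun p => hhb p.2)
  have i3 : Integrable (fun p => w p.2 * h p.1) (nearMeasure δ) := integrable_near_swap i2
  have i4 : Integrable (fun p => w p.2 * h p.2) (nearMeasure δ) := integrable_near_swap i1
  have e3 : ∫ p, w p.2 * h p.1 ∂(nearMeasure δ) = ∫ p, w p.1 * h p.2 ∂(nearMeasure δ) :=
    integral_near_swap (fun p => w p.1 * h p.2)
  have e4 : ∫ p, w p.2 * h p.2 ∂(nearMeasure δ) = ∫ p, w p.1 * h p.1 ∂(nearMeasure δ) :=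
    integral_near_swap (fun p => w p.1 * h p.1)
  refine ⟨?_, e3⟩
  have : ∀ p : ℂ × ℂ, (w p.1 - w p.2) * (h p.1 - h p.2) =
      (w p.1 * h p.1 - w p.1 * h p.2) - (w p.2 * h p.1 - w p.2 * h p.2) := fun p => by ring
  simp_rw [this]
  rw [integral_sub (by exact i1.sub i2) (by exact i3.sub i4), integral_sub i1 i2, integral_sub i3 i4, e3, e4]
  ring

lemma integral_fst_mul (h0 : 0 ≤ δ) (h1 : δ < 1) (hR0 : 0 ≤ R) (hR : R < 1)
    (hw : CompBdd R C w) (hh : Measurable h) (hhb : ∀ z, |h z| ≤ C') :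
    ∫ p, w p.1 * h p.2 ∂(nearMeasure δ) = ∫ x, w x * hypAvg δ h x ∂hypMeasure := by
  rw [integral_near _ (by have := hw.meas; fun_prop)
    (by exact hw.integrable_mul_fst h0 h1 hR0 hR (hh.comp measurable_snd) (fun p => hhb p.2))]
  simp_rw [integral_const_mul]
  rfl

lemma integral_snd_mul (h0 : 0 ≤ δ) (h1 : δ < 1) (hR0 : 0 ≤ R) (hR : R < 1)
    (hw : CompBdd R C w) (hh : Measurable h) (hhb : ∀ z, |h z| ≤ C') :
    ∫ p, w p.2 * h p.1 ∂(nearMeasure δ) = ∫ x, h x * hypAvg δ w x ∂hypMeasure := by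
  rw [integral_near _ (by have := hw.meas; fun_prop)
    (by exact hw.integrable_mul_snd h0 h1 hR0 hR (hh.comp measurable_fst) (fun p => hhb p.1))]
  simp_rw [integral_mul_const, mul_comm]
  rfl

lemma integral_fst_mul_fst (h0 : 0 ≤ δ) (h1 : δ < 1) (hR0 : 0 ≤ R) (hR : R < 1)
    (hw : CompBdd R C w) (hh : Measurable h) (hhb : ∀ z, |h z| ≤ C') :
    ∫ p, w p.1 * h p.1 ∂(nearMeasure δ) =
      hypMeasure.real (Metric.ball 0 δ) * ∫ x, w x * h x ∂hypMeasure := by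
  rw [integral_near _ (by have := hw.meas; fun_prop)
    (by exact hw.integrable_mul_fst h0 h1 hR0 hR (hh.comp measurable_fst) (fun p => hhb p.1))]
  simp_rw [setIntegral_const, smul_eq_mul]
  rw [integral_const_mul]

lemma measurable_hypAvg (hh : Measurable h) : Measurable (hypAvg δ h) := by
  have : Measurable (fun p : ℂ × ℂ => h (mob p.1 p.2)) := hh.comp measurable_mob₂
  exact (this.stronglyMeasurable.integral_prod_right (ν := hypMeasure.restrict (Metric.ball 0 δ))).measurable

lemma abs_hypAvg_le (h0 : 0 ≤ δ) (h1 : δ < 1) (hhb : ∀ z, |h z| ≤ C') (x : ℂ) :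
    |hypAvg δ h x| ≤ C' * hypMeasure.real (Metric.ball 0 δ) :=
  norm_setIntegral_le_of_norm_le_const (f := fun ζ => h (mob x ζ)) (hyp_ball_lt_top h0 h1)
    (fun _ _ => hhb _)

lemma near_bilin_left (h0 : 0 ≤ δ) (h1 : δ < 1) (hR0 : 0 ≤ R) (hR : R < 1)
    (hw : CompBdd R C w) (hh : Measurable h) (hhb : ∀ z, |h z| ≤ C') :
    ∫ p, (w p.1 - w p.2) * (h p.1 - h p.2) ∂(nearMeasure δ) =
      2 * ∫ x, w x * (hypMeasure.real (Metric.ball 0 δ) * h x - hypAvg δ h x) ∂hypMeasure := by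
  rw [(near_bilin h0 h1 hR0 hR hw hh hhb).1, integral_fst_mul_fst h0 h1 hR0 hR hw hh hhb,
    integral_fst_mul h0 h1 hR0 hR hw hh hhb, ← integral_const_mul, ← integral_sub]
  · congr 2; funext x; ring
  · exact (hw.integrable_mul hR0 hR hh hhb).const_mul _
  · exact hw.integrable_mul hR0 hR (measurable_hypAvg hh) (abs_hypAvg_le h0 h1 hhb)

lemma integrable_mul_hypAvg (h0 : 0 ≤ δ) (h1 : δ < 1) (hR0 : 0 ≤ R) (hR : R < 1)
    (hw : CompBdd R C w) (hh : Measurable h) (hhb : ∀ z, |h z| ≤ C') :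
    Integrable (fun x => h x * hypAvg δ w x) hypMeasure := by
  have hi := hw.integrable_mul_snd h0 h1 hR0 hR (hh.comp measurable_fst) (fun p => hhb p.1)
  rw [nearMeasure, ← IntegrableOn, ← integrable_indicator_iff (measurableSet_nearPairs δ)] at hi
  refine hi.integral_prod_left.congr ?_
  filter_upwards [ae_hyp_lt_one] with x hx
  have e := integral_near_inner hx δ (fun y => w y * h x) (by have := hw.meas; fun_prop)
  rw [← integral_indicator (measurableSet_lt (measurable_mob x).norm measurable_const),
    integral_mul_const, mul_comm] at e
  exact e

lemma near_bilin_right (h0 : 0 ≤ δ) (h1 : δ < 1) (hR0 : 0 ≤ R) (hR : R < 1)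
    (hw : CompBdd R C w) (hh : Measurable h) (hhb : ∀ z, |h z| ≤ C') :
    ∫ p, (w p.1 - w p.2) * (h p.1 - h p.2) ∂(nearMeasure δ) =
      2 * ∫ x, h x * (hypMeasure.real (Metric.ball 0 δ) * w x - hypAvg δ w x) ∂hypMeasure := by
  rw [(near_bilin h0 h1 hR0 hR hw hh hhb).1, integral_fst_mul_fst h0 h1 hR0 hR hw hh hhb,
    ← (near_bilin h0 h1 hR0 hR hw hh hhb).2,
    integral_snd_mul h0 h1 hR0 hR hw hh hhb, ← integral_const_mul, ← integral_sub]
  · congr 2; funext x; ring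
  · exact (hw.integrable_mul hR0 hR hh hhb).const_mul _
  · exact integrable_mul_hypAvg h0 h1 hR0 hR hw hh hhb

end Bilinear

/-- Two-point rearrangement (polarization) with respect to the geodesic given by `c`. -/
noncomputable def polarize (c : ℂ) (w : ℂ → ℝ) (z : ℂ) : ℝ :=
  if ‖z‖ < 1 then
    if 0 ≤ side c z then max (w z) (w (hypRefl c z)) else min (w z) (w (hypRefl c z))
  else 0

/-- Nonlocal Dirichlet energy at scale `δ`. -/
noncomputable def nearEnergy (δ : ℝ) (w : ℂ → ℝ) : ℝ≥0∞ :=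
  ∫⁻ p, ENNReal.ofReal ((w p.1 - w p.2)^2) ∂(nearMeasure δ)

section Polarize

variable {c : ℂ} {w : ℂ → ℝ}

lemma measurable_hypRefl : Measurable (hypRefl c) := by
  have := measurable_mob (conj c)⁻¹
  unfold hypRefl
  exact (Complex.continuous_conj.measurable.comp this).const_mul _

lemma measurable_side : Measurable (side c) := by unfold side; fun_prop

lemma measurable_polarize (hw : Measurable w) : Measurable (polarize c w) := by
  have h1 := hw.comp (measurable_hypRefl (c := c))
  refine Measurable.ite (measurableSet_lt measurable_norm measurable_const) ?_ measurable_const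
  exact Measurable.ite (measurableSet_le measurable_const measurable_side) (hw.max h1) (hw.min h1)

lemma side_hypRefl_neg (hc : 1 < ‖c‖) {z : ℂ} (hz : ‖z‖ < 1) (h : 0 < side c z) :
    side c (hypRefl c z) < 0 := by
  have h3 : 0 < (‖c‖^2 - 1) / ‖z - c‖^2 :=
    div_pos (by nlinarith) (by have := norm_sub_pos_of hc hz; positivity)
  rw [side_hypRefl hc hz]; nlinarith

lemma side_hypRefl_pos (hc : 1 < ‖c‖) {z : ℂ} (hz : ‖z‖ < 1) (h : side c z < 0) :
    0 < side c (hypRefl c z) := by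
  have h3 : 0 < (‖c‖^2 - 1) / ‖z - c‖^2 :=
    div_pos (by nlinarith) (by have := norm_sub_pos_of hc hz; positivity)
  rw [side_hypRefl hc hz]; nlinarith

lemma polarize_of_nonneg {z : ℂ} (hz : ‖z‖ < 1) (h : 0 ≤ side c z) :
    polarize c w z = max (w z) (w (hypRefl c z)) := by
  rw [polarize, if_pos hz, if_pos h]

lemma polarize_of_neg {z : ℂ} (hz : ‖z‖ < 1) (h : side c z < 0) :
    polarize c w z = min (w z) (w (hypRefl c z)) := by
  rw [polarize, if_pos hz, if_neg h.not_ge]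

lemma polarize_hypRefl_of_nonneg (hc : 1 < ‖c‖) {z : ℂ} (hz : ‖z‖ < 1) (h : 0 ≤ side c z) :
    polarize c w (hypRefl c z) = min (w z) (w (hypRefl c z)) := by
  rcases h.eq_or_lt with h | h
  · have e := hypRefl_eq_self hc hz h.symm
    rw [e, polarize_of_nonneg hz h.le, e]; simp
  · rw [polarize_of_neg (norm_hypRefl hc hz) (side_hypRefl_neg hc hz h), hypRefl_hypRefl hc hz, min_comm]

lemma polarize_hypRefl_of_neg (hc : 1 < ‖c‖) {z : ℂ} (hz : ‖z‖ < 1) (h : side c z < 0) :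
    polarize c w (hypRefl c z) = max (w z) (w (hypRefl c z)) := by
  rw [polarize_of_nonneg (norm_hypRefl hc hz) (side_hypRefl_pos hc hz h).le, hypRefl_hypRefl hc hz, max_comm]

lemma polarize_pair (hc : 1 < ‖c‖) {β : Type*} [AddCommMonoid β] (φ : ℝ → β) {z : ℂ} (hz : ‖z‖ < 1) :
    φ (polarize c w z) + φ (polarize c w (hypRefl c z)) = φ (w z) + φ (w (hypRefl c z)) := by
  rcases le_or_gt 0 (side c z) with h | h
  · rw [polarize_of_nonneg hz h, polarize_hypRefl_of_nonneg hc hz h]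
    rcases le_total (w z) (w (hypRefl c z)) with h | h <;> simp [h, add_comm]
  · rw [polarize_of_neg hz h, polarize_hypRefl_of_neg hc hz h]
    rcases le_total (w z) (w (hypRefl c z)) with h | h <;> simp [h, add_comm]

lemma lintegral_polarize (hc : 1 < ‖c‖) (hw : Measurable w) {φ : ℝ → ℝ≥0∞} (hφ : Measurable φ) :
    ∫⁻ z, φ (polarize c w z) ∂hypMeasure = ∫⁻ z, φ (w z) ∂hypMeasure := by
  have hp := measurable_polarize (c := c) hw
  have key : ∀ v : ℂ → ℝ, Measurable v → ∫⁻ z, (φ (v z) + φ (v (hypRefl c z))) ∂hypMeasure =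
      2 * ∫⁻ z, φ (v z) ∂hypMeasure := by
    intro v hv
    have e := (measurePreserving_hypRefl hc).lintegral_comp (hφ.comp hv)
    simp only [Function.comp_def] at e
    rw [lintegral_add_left (by exact hφ.comp hv), e, two_mul]
  have := key _ hp
  rw [lintegral_congr_ae (g := fun z => φ (w z) + φ (w (hypRefl c z))), key w hw] at this
  · exact ((ENNReal.mul_right_inj (by simp) (by simp)).mp this).symm
  · filter_upwards [ae_hyp_lt_one] with z hz using polarize_pair hc φ hz

lemma hyp_polarize_lt (hc : 1 < ‖c‖) (hw : Measurable w) (s : ℝ) :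
    hypMeasure {z | s < polarize c w z} = hypMeasure {z | s < w z} := by
  have h := lintegral_polarize hc hw (φ := (Ioi s).indicator 1) (measurable_one.indicator measurableSet_Ioi)
  have e : ∀ v : ℂ → ℝ, Measurable v → ∫⁻ z, (Ioi s).indicator (1 : ℝ → ℝ≥0∞) (v z) ∂hypMeasure =
      hypMeasure {z | s < v z} := by
    intro v hv
    rw [← lintegral_indicator_one (measurableSet_lt measurable_const hv)]
    rfl
  rwa [e _ (measurable_polarize hw), e _ hw] at h

lemma norm_mob_hypRefl_left (hc : 1 < ‖c‖) {x y : ℂ} (hx : ‖x‖ < 1) (hy : ‖y‖ < 1) :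
    ‖mob (hypRefl c x) y‖ = ‖mob x (hypRefl c y)‖ := by
  have := norm_mob_hypRefl_hypRefl hc hx (norm_hypRefl hc hy)
  rwa [hypRefl_hypRefl hc hy] at this

lemma polarize_modulus (hc : 1 < ‖c‖) {t η : ℝ}
    (h : ∀ x y : ℂ, ‖x‖ < 1 → ‖y‖ < 1 → ‖mob x y‖ ≤ t → |w x - w y| ≤ η) :
    ∀ x y : ℂ, ‖x‖ < 1 → ‖y‖ < 1 → ‖mob x y‖ ≤ t → |polarize c w x - polarize c w y| ≤ η := by
  intro x y hx hy hxy
  have hx' := norm_hypRefl hc hx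
  have hy' := norm_hypRefl hc hy
  have h1 := h x y hx hy hxy
  have h2 := h _ _ hx' hy' ((norm_mob_hypRefl_hypRefl hc hx hy).le.trans hxy)
  have far : side c x * side c y ≤ 0 → |w x - w (hypRefl c y)| ≤ η ∧ |w (hypRefl c x) - w y| ≤ η := by
    intro hs
    have := (norm_mob_hypRefl_ge_iff hc hx hy).mpr hs
    refine ⟨h _ _ hx hy' (this.trans hxy), h _ _ hx' hy ?_⟩
    rw [norm_mob_hypRefl_left hc hx hy]; exact this.trans hxy
  rcases le_or_gt 0 (side c x) with sx | sx <;> rcases le_or_gt 0 (side c y) with sy | sy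
  · rw [polarize_of_nonneg hx sx, polarize_of_nonneg hy sy]
    exact (abs_max_sub_max_le_max _ _ _ _).trans (max_le h1 h2)
  · obtain ⟨h3, h4⟩ := far (mul_nonpos_of_nonneg_of_nonpos sx sy.le)
    rw [polarize_of_nonneg hx sx, polarize_of_neg hy sy]
    rcases max_choice (w x) (w (hypRefl c x)) with e | e <;>
      rcases min_choice (w y) (w (hypRefl c y)) with e' | e' <;> rw [e, e'] <;> assumption
  · obtain ⟨h3, h4⟩ := far (mul_nonpos_of_nonpos_of_nonneg sx.le sy)
    rw [polarize_of_neg hx sx, polarize_of_nonneg hy sy]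
    rcases min_choice (w x) (w (hypRefl c x)) with e | e <;>
      rcases max_choice (w y) (w (hypRefl c y)) with e' | e' <;> rw [e, e'] <;> assumption
  · rw [polarize_of_neg hx sx, polarize_of_neg hy sy]
    exact (abs_min_sub_min_le_max _ _ _ _).trans (max_le h1 h2)

lemma norm_le_norm_hypRefl (hc : 1 < ‖c‖) {z : ℂ} (hz : ‖z‖ < 1) (h : 0 ≤ side c z) :
    ‖z‖ ≤ ‖hypRefl c z‖ := by
  rcases h.eq_or_lt with h | h
  · rw [hypRefl_eq_self hc hz h.symm]
  · exact (norm_lt_norm_hypRefl hc hz h).le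

lemma polarize_supp (hc : 1 < ‖c‖) {R : ℝ} (h0 : ∀ z, 0 ≤ w z)
    (hs : ∀ z, w z ≠ 0 → ‖z‖ ≤ R) : ∀ z, polarize c w z ≠ 0 → ‖z‖ ≤ R := by
  intro z hz
  by_contra! hR
  have h1 : ∀ y, R < ‖y‖ → w y = 0 := fun y hy => by
    by_contra h; exact absurd (hs y h) hy.not_ge
  apply hz
  by_cases hz1 : ‖z‖ < 1
  · rcases le_or_gt 0 (side c z) with h | h
    · rw [polarize_of_nonneg hz1 h, h1 z hR, h1 _ (hR.trans_le (norm_le_norm_hypRefl hc hz1 h)), max_self]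
    · rw [polarize_of_neg hz1 h, h1 z hR, min_eq_left (h0 _)]
  · rw [polarize, if_neg hz1]

lemma polarize_mem_Icc {ε : ℝ} (hε : 0 ≤ ε) (h : ∀ z, w z ∈ Icc 0 ε) (z : ℂ) : polarize c w z ∈ Icc 0 ε := by
  unfold polarize
  split_ifs
  · exact ⟨le_max_of_le_left (h z).1, max_le (h z).2 (h _).2⟩
  · exact ⟨le_min (h z).1 (h _).1, min_le_of_left_le (h z).2⟩
  · exact ⟨le_rfl, hε⟩

/-- Integrand of the energy. -/
noncomputable def nearKer (δ : ℝ) (w : ℂ → ℝ) (x y : ℂ) : ℝ≥0∞ :=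
  if ‖mob x y‖ < δ then ENNReal.ofReal ((w x - w y)^2) else 0

lemma measurable_nearKer (δ : ℝ) (hw : Measurable w) :
    Measurable (fun p : ℂ × ℂ => nearKer δ w p.1 p.2) :=
  Measurable.ite (measurableSet_nearPairs δ) (by fun_prop) measurable_const

lemma nearEnergy_eq (δ : ℝ) : nearEnergy δ w =
    ∫⁻ p, nearKer δ w p.1 p.2 ∂(hypMeasure.prod hypMeasure) := by
  rw [nearEnergy, nearMeasure, ← lintegral_indicator (measurableSet_nearPairs δ)]
  rfl

/-- Sum of the energy integrand over an orbit of the reflection. -/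
noncomputable def nearOrbit (δ : ℝ) (c : ℂ) (w : ℂ → ℝ) (x y : ℂ) : ℝ≥0∞ :=
  (nearKer δ w x y + nearKer δ w (hypRefl c x) (hypRefl c y)) +
    (nearKer δ w x (hypRefl c y) + nearKer δ w (hypRefl c x) y)

lemma lintegral_nearOrbit (hc : 1 < ‖c‖) (δ : ℝ) (hw : Measurable w) :
    ∫⁻ p, nearOrbit δ c w p.1 p.2 ∂(hypMeasure.prod hypMeasure) = 4 * nearEnergy δ w := by
  have hσ := measurePreserving_hypRefl hc
  have hid := MeasurePreserving.id hypMeasure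
  have hk := measurable_nearKer δ hw
  have m1 := (hσ.prod hσ)
  have m2 := (hid.prod hσ)
  have m3 := (hσ.prod hid)
  have e1 := m1.lintegral_comp hk
  have e2 := m2.lintegral_comp hk
  have e3 := m3.lintegral_comp hk
  have k1 := hk.comp m1.measurable
  have k2 := hk.comp m2.measurable
  have k3 := hk.comp m3.measurable
  simp only [Prod.map, id, Function.comp_def] at e1 e2 e3 k1 k2 k3
  unfold nearOrbit
  rw [lintegral_add_left (by exact hk.add k1), lintegral_add_left hk, lintegral_add_left k2, e1, e2, e3, nearEnergy_eq]
  ring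

lemma nearOrbit_left (hc : 1 < ‖c‖) (δ : ℝ) {x y : ℂ} (hx : ‖x‖ < 1) :
    nearOrbit δ c w (hypRefl c x) y = nearOrbit δ c w x y := by
  unfold nearOrbit; rw [hypRefl_hypRefl hc hx]; ring

lemma nearOrbit_right (hc : 1 < ‖c‖) (δ : ℝ) {x y : ℂ} (hy : ‖y‖ < 1) :
    nearOrbit δ c w x (hypRefl c y) = nearOrbit δ c w x y := by
  unfold nearOrbit; rw [hypRefl_hypRefl hc hy]; ring

lemma sq_sub_max_min_le (a a' b b' : ℝ) :
    (max a a' - max b b')^2 + (min a a' - min b b')^2 ≤ (a - b)^2 + (a' - b')^2 := by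
  rcases le_total a a' with h | h <;> rcases le_total b b' with h' | h' <;> simp only [h, h', max_eq_left,
    max_eq_right, min_eq_left, min_eq_right] <;> nlinarith [mul_nonneg (sub_nonneg.mpr h) (sub_nonneg.mpr h')]

lemma nearOrbit_polarize_le_aux (hc : 1 < ‖c‖) (δ : ℝ) {x y : ℂ} (hx : ‖x‖ < 1) (hy : ‖y‖ < 1)
    (sx : 0 ≤ side c x) (sy : 0 ≤ side c y) :
    nearOrbit δ c (polarize c w) x y ≤ nearOrbit δ c w x y := by
  have d1 := norm_mob_hypRefl_hypRefl hc hx hy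
  have d2 := norm_mob_hypRefl_left hc hx hy
  have d3 := (norm_mob_hypRefl_le_iff hc hx hy).mpr (mul_nonneg sx sy)
  unfold nearOrbit nearKer
  rw [d1, d2, polarize_of_nonneg hx sx, polarize_of_nonneg hy sy, polarize_hypRefl_of_nonneg hc hx sx,
    polarize_hypRefl_of_nonneg hc hy sy]
  have key := sq_sub_max_min_le (w x) (w (hypRefl c x)) (w y) (w (hypRefl c y))
  by_cases h2 : ‖mob x (hypRefl c y)‖ < δ
  · have h1 := d3.trans_lt h2
    simp only [h1, h2, if_true]
    rw [← ENNReal.ofReal_add (sq_nonneg _) (sq_nonneg _), ← ENNReal.ofReal_add (sq_nonneg _) (sq_nonneg _),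
      ← ENNReal.ofReal_add (sq_nonneg _) (sq_nonneg _), ← ENNReal.ofReal_add (sq_nonneg _) (sq_nonneg _),
      ← ENNReal.ofReal_add (by positivity) (by positivity), ← ENNReal.ofReal_add (by positivity) (by positivity)]
    apply ENNReal.ofReal_le_ofReal
    apply le_of_eq
    rcases le_total (w x) (w (hypRefl c x)) with h | h <;>
      rcases le_total (w y) (w (hypRefl c y)) with h' | h' <;>
      simp only [h, h', max_eq_left, max_eq_right, min_eq_left, min_eq_right] <;> ring
  · simp only [h2, if_false, add_zero]
    split_ifs
    · rw [← ENNReal.ofReal_add (sq_nonneg _) (sq_nonneg _), ← ENNReal.ofReal_add (sq_nonneg _) (sq_nonneg _)]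
      exact ENNReal.ofReal_le_ofReal key
    · simp

lemma nearOrbit_polarize_le (hc : 1 < ‖c‖) (δ : ℝ) {x y : ℂ} (hx : ‖x‖ < 1) (hy : ‖y‖ < 1) :
    nearOrbit δ c (polarize c w) x y ≤ nearOrbit δ c w x y := by
  have hx' := norm_hypRefl hc hx
  have hy' := norm_hypRefl hc hy
  rcases le_or_gt 0 (side c x) with sx | sx <;> rcases le_or_gt 0 (side c y) with sy | sy
  · exact nearOrbit_polarize_le_aux hc δ hx hy sx sy
  · rw [← nearOrbit_right hc δ hy, ← nearOrbit_right (w := w) hc δ hy]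
    exact nearOrbit_polarize_le_aux hc δ hx hy' sx (side_hypRefl_pos hc hy sy).le
  · rw [← nearOrbit_left hc δ hx, ← nearOrbit_left (w := w) hc δ hx]
    exact nearOrbit_polarize_le_aux hc δ hx' hy (side_hypRefl_pos hc hx sx).le sy
  · rw [← nearOrbit_right hc δ hy, ← nearOrbit_right (w := w) hc δ hy, ← nearOrbit_left hc δ hx,
      ← nearOrbit_left (w := w) hc δ hx]
    exact nearOrbit_polarize_le_aux hc δ hx' hy' (side_hypRefl_pos hc hx sx).le (side_hypRefl_pos hc hy sy).le

lemma nearEnergy_polarize_le (hc : 1 < ‖c‖) (δ : ℝ) (hw : Measurable w) :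
    nearEnergy δ (polarize c w) ≤ nearEnergy δ w := by
  have h1 := lintegral_nearOrbit hc δ hw
  have h2 := lintegral_nearOrbit hc δ (measurable_polarize (c := c) hw)
  have h3 : (4:ℝ≥0∞) * nearEnergy δ (polarize c w) ≤ 4 * nearEnergy δ w := by
    rw [← h1, ← h2]
    refine lintegral_mono_ae ?_
    have a1 : ∀ᵐ p ∂(hypMeasure.prod hypMeasure), ‖p.1‖ < 1 :=
      Measure.quasiMeasurePreserving_fst.ae ae_hyp_lt_one
    have a2 : ∀ᵐ p ∂(hypMeasure.prod hypMeasure), ‖p.2‖ < 1 :=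
      Measure.quasiMeasurePreserving_snd.ae ae_hyp_lt_one
    filter_upwards [a1, a2] with p h1 h2 using nearOrbit_polarize_le hc δ h1 h2
  exact (ENNReal.mul_le_mul_iff_right (by simp) (by simp)).mp h3

end Polarize

lemma restrict_ball_absolutelyContinuous_hyp :
    (volume : Measure ℂ).restrict (Metric.ball (0:ℂ) 1) ≪ hypMeasure := by
  refine withDensity_absolutelyContinuous' measurable_hypDensity.aemeasurable ?_
  filter_upwards [ae_restrict_mem Metric.isOpen_ball.measurableSet] with z hz
  have hz : ‖z‖ < 1 := by simpa using hz
  have := norm_sq_lt_one hz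
  simp only [ne_eq, ENNReal.ofReal_eq_zero, not_le]
  have : 0 < (1 - ‖z‖^2)^2 := by have : 0 < 1 - ‖z‖^2 := by linarith
                                 positivity
  have := Real.pi_pos
  positivity

lemma hyp_pos_of_mem_nhds {s : Set ℂ} {x : ℂ} (hx : ‖x‖ < 1) (hs : s ∈ 𝓝 x) : 0 < hypMeasure s := by
  rw [pos_iff_ne_zero]
  intro h
  have h1 := restrict_ball_absolutelyContinuous_hyp h
  have h2 : s ∩ Metric.ball (0:ℂ) 1 ∈ 𝓝 x :=
    inter_mem hs (Metric.isOpen_ball.mem_nhds (by simpa using hx))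
  have h3 := Measure.measure_pos_of_mem_nhds volume h2
  rw [Measure.restrict_apply' measurableSet_ball] at h1
  exact h3.ne' h1

/-- The weight `(1-|z|²)²`, integrable for the hyperbolic measure and radially decreasing. -/
noncomputable def hypWeight (z : ℂ) : ℝ := (1 - ‖z‖^2)^2

lemma integrable_hypWeight : Integrable hypWeight hypMeasure := by
  have hm : Measurable hypWeight := by unfold hypWeight; fun_prop
  refine ⟨hm.aestronglyMeasurable, ?_⟩
  rw [hasFiniteIntegral_iff_ofReal (ae_of_all _ fun z => by unfold hypWeight; positivity)]
  unfold hypWeight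
  have := lintegral_hyp_radial (fun t => ENNReal.ofReal ((1 - t)^2)) (by fun_prop)
  rw [this]
  calc _ = ∫⁻ t in Ioo (0:ℝ) 1, 1 := by
        refine setLIntegral_congr_fun measurableSet_Ioo ?_
        intro t ht
        simp only
        have : 0 < 1 - t := by linarith [ht.2]
        rw [← ENNReal.ofReal_mul (by positivity), inv_mul_cancel₀ (by positivity), ENNReal.ofReal_one]
    _ < ∞ := by simp

/-- Functions sharing the bounds of the profile `T` on range, support, modulus of continuity,
distribution and nonlocal energy. -/
structure Competitor (T : ℂ → ℝ) (ε R δ : ℝ) (ma mb : ℝ≥0∞) (w : ℂ → ℝ) : Prop where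
  meas : Measurable w
  mem : ∀ z, w z ∈ Icc 0 ε
  supp : ∀ z, w z ≠ 0 → ‖z‖ ≤ R
  modulus : ∀ t η, (∀ x y : ℂ, ‖x‖ < 1 → ‖y‖ < 1 → ‖mob x y‖ ≤ t → |T x - T y| ≤ η) →
    ∀ x y : ℂ, ‖x‖ < 1 → ‖y‖ < 1 → ‖mob x y‖ ≤ t → |w x - w y| ≤ η
  lower : ∀ s < ε, mb ≤ hypMeasure {z | s < w z}
  upper : ∀ s > 0, hypMeasure {z | s < w z} ≤ ma
  energy : nearEnergy δ w ≤ nearEnergy δ T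

section Competitor

variable {T w : ℂ → ℝ} {ε R δ : ℝ} {ma mb : ℝ≥0∞}

lemma Competitor.polarize (hε : 0 ≤ ε) (h : Competitor T ε R δ ma mb w) {c : ℂ} (hc : 1 < ‖c‖) :
    Competitor T ε R δ ma mb (polarize c w) where
  meas := measurable_polarize h.meas
  mem := polarize_mem_Icc hε h.mem
  supp := polarize_supp hc (fun z => (h.mem z).1) h.supp
  modulus t η ht := polarize_modulus hc (h.modulus t η ht)
  lower s hs := by rw [hyp_polarize_lt hc h.meas]; exact h.lower s hs
  upper s hs := by rw [hyp_polarize_lt hc h.meas]; exact h.upper s hs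
  energy := (nearEnergy_polarize_le hc δ h.meas).trans h.energy

lemma Competitor.of_tendsto {wn : ℕ → ℂ → ℝ} (h : ∀ n, Competitor T ε R δ ma mb (wn n)) {d : ℕ → ℝ}
    (hd : Tendsto d atTop (𝓝 0)) (hw : ∀ n z, |wn n z - w z| ≤ d n) :
    Competitor T ε R δ ma mb w := by
  have lim : ∀ z, Tendsto (fun n => wn n z) atTop (𝓝 (w z)) := fun z => by
    rw [tendsto_iff_dist_tendsto_zero]
    exact squeeze_zero (fun n => dist_nonneg) (fun n => by rw [Real.dist_eq]; exact hw n z) hd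
  have meas : Measurable w :=
    measurable_of_tendsto_metrizable (fun n => (h n).meas) (tendsto_pi_nhds.mpr lim)
  refine ⟨meas, ?_, ?_, ?_, ?_, ?_, ?_⟩
  · exact fun z => isClosed_Icc.mem_of_tendsto (lim z) (Eventually.of_forall fun n => (h n).mem z)
  · intro z hz
    by_contra! hR
    apply hz
    refine tendsto_nhds_unique (lim z) ?_
    have : ∀ n, wn n z = 0 := fun n => by
      by_contra h0; exact absurd ((h n).supp z h0) hR.not_ge
    simp [this]
  · intro t η ht x y hx hy hxy
    exact le_of_tendsto ((lim x).sub (lim y)).abs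
      (Eventually.of_forall fun n => (h n).modulus t η ht x y hx hy hxy)
  · intro s hs
    obtain ⟨n, hn⟩ := (hd.eventually (gt_mem_nhds (show 0 < (ε - s)/2 by linarith))).exists
    refine ((h n).lower ((s + ε)/2) (by linarith)).trans (measure_mono fun z hz => ?_)
    have := abs_le.mp (hw n z)
    simp only [mem_ofPred_eq] at hz ⊢
    linarith
  · intro s hs
    obtain ⟨n, hn⟩ := (hd.eventually (gt_mem_nhds (show 0 < s/2 by linarith))).exists
    refine (measure_mono fun z hz => ?_).trans ((h n).upper (s/2) (by linarith))
    have := abs_le.mp (hw n z)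
    simp only [mem_ofPred_eq] at hz ⊢
    linarith
  · unfold nearEnergy
    have e : ∀ p : ℂ × ℂ, ENNReal.ofReal ((w p.1 - w p.2)^2) =
        liminf (fun n => ENNReal.ofReal ((wn n p.1 - wn n p.2)^2)) atTop := fun p =>
      ((ENNReal.continuous_ofReal.tendsto _).comp (((lim p.1).sub (lim p.2)).pow 2)).liminf_eq.symm
    simp_rw [e]
    refine (lintegral_liminf_le fun n => ?_).trans ?_
    · have := (h n).meas
      fun_prop
    · refine liminf_le_of_le (a := nearEnergy δ T) (by isBoundedDefault) ?_
      intro b hb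
      obtain ⟨n, hn⟩ := hb.exists
      exact hn.trans (h n).energy

lemma norm_mob_le_of_closedBall (hR : R < 1) {x y : ℂ} (hx : ‖x‖ ≤ R) (hy : ‖y‖ ≤ R) :
    ‖mob x y‖ ≤ ‖x - y‖ / (1 - R) := by
  unfold mob
  rw [norm_div]
  have h0 := norm_nonneg x
  have h1 : ‖conj x * y‖ ≤ R := by
    rw [norm_mul, Complex.norm_conj]; nlinarith [norm_nonneg y]
  have h2 : 1 - R ≤ ‖1 - conj x * y‖ := by
    have := norm_sub_norm_le (1:ℂ) (conj x * y)
    rw [norm_one] at this; linarith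
  exact div_le_div_of_nonneg_left (norm_nonneg _) (by linarith) h2

lemma Competitor.continuousOn (hT : ∀ η > 0, ∃ t > 0, ∀ x y : ℂ, ‖x‖ < 1 → ‖y‖ < 1 → ‖mob x y‖ ≤ t →
      |T x - T y| ≤ η) (h : Competitor T ε R δ ma mb w) : ContinuousOn w (Metric.ball 0 1) := by
  intro x hx
  have hx : ‖x‖ < 1 := by simpa using hx
  rw [Metric.continuousWithinAt_iff]
  intro η hη
  obtain ⟨t, ht, H⟩ := hT (η/2) (by linarith)
  have hc : ContinuousOn (mob x) (Metric.ball 0 1) := continuousOn_mob hx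
  have := hc x (by simpa using hx)
  rw [Metric.continuousWithinAt_iff] at this
  obtain ⟨r, hr, H2⟩ := this t ht
  refine ⟨r, hr, fun {y} hy hyx => ?_⟩
  have hy' : ‖y‖ < 1 := by simpa using hy
  have h3 := H2 hy hyx
  have : mob x x = 0 := by simp [mob]
  rw [this, dist_zero_right] at h3
  rw [dist_comm, Real.dist_eq]
  have := h.modulus t (η/2) H x y hx hy' h3.le
  linarith

/-- Extension by zero of a function on the closed disk of radius `R`. -/
noncomputable def extZero (R : ℝ) (F : Metric.closedBall (0:ℂ) R → ℝ) (z : ℂ) : ℝ :=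
  open Classical in if h : z ∈ Metric.closedBall (0:ℂ) R then F ⟨z, h⟩ else 0

lemma extZero_coe (F : Metric.closedBall (0:ℂ) R → ℝ) (z : Metric.closedBall (0:ℂ) R) :
    extZero R F z = F z := by
  rw [extZero, dif_pos z.2]

lemma abs_extZero_sub_le (F G : BoundedContinuousFunction (Metric.closedBall (0:ℂ) R) ℝ) (z : ℂ) :
    |extZero R F z - extZero R G z| ≤ dist F G := by
  unfold extZero
  split_ifs with h
  · rw [← Real.dist_eq]; exact BoundedContinuousFunction.dist_coe_le_dist _
  · simp

lemma isCompact_competitor (hR : R < 1) (hT : ∀ η > 0, ∃ t > 0, ∀ x y : ℂ, ‖x‖ < 1 → ‖y‖ < 1 →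
      ‖mob x y‖ ≤ t → |T x - T y| ≤ η) :
    IsCompact {F : BoundedContinuousFunction (Metric.closedBall (0:ℂ) R) ℝ |
      Competitor T ε R δ ma mb (extZero R F)} := by
  refine BoundedContinuousFunction.arzela_ascoli₂ (Icc 0 ε) isCompact_Icc _ ?_ ?_ ?_
  · refine IsSeqClosed.isClosed fun Fn F hFn hF => ?_
    exact Competitor.of_tendsto (fun n => hFn n) (tendsto_iff_dist_tendsto_zero.mp hF)
      (fun n z => abs_extZero_sub_le _ _ z)
  · intro F x hF
    rw [← extZero_coe (fun z => F z)]
    exact hF.mem x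
  · intro x
    rw [Metric.equicontinuousAt_iff]
    intro η hη
    obtain ⟨t, ht, H⟩ := hT (η/2) (by linarith)
    refine ⟨t * (1 - R), mul_pos ht (by linarith), fun y hy F => ?_⟩
    have hx : ‖(x:ℂ)‖ ≤ R := mem_closedBall_zero_iff.mp x.2
    have hy' : ‖(y:ℂ)‖ ≤ R := mem_closedBall_zero_iff.mp y.2
    have h1 := norm_mob_le_of_closedBall hR hx hy'
    have h2 := F.2.modulus t (η/2) H x y (hx.trans_lt hR) (hy'.trans_lt hR) (h1.trans (by
      rw [div_le_iff₀ (by linarith), ← dist_eq_norm, dist_comm]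
      exact hy.le))
    rw [extZero_coe, extZero_coe, ← Real.dist_eq] at h2
    exact h2.trans_lt (by linarith)

lemma Competitor.compBdd (h : Competitor T ε R δ ma mb w) : CompBdd R ε w :=
  ⟨h.meas, fun z => by rw [abs_of_nonneg (h.mem z).1]; exact (h.mem z).2, h.supp⟩

lemma integrable_mul_hypWeight (hw : Measurable w) {C : ℝ} (hb : ∀ z, |w z| ≤ C) :
    Integrable (fun z => w z * hypWeight z) hypMeasure :=
  integrable_hypWeight.bdd_mul hw.aestronglyMeasurable (ae_of_all _ fun z => by
    rw [Real.norm_eq_abs]; exact hb z)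

lemma exists_maximal_competitor (hR : R < 1) (hT : ∀ η > 0, ∃ t > 0, ∀ x y : ℂ, ‖x‖ < 1 → ‖y‖ < 1 →
      ‖mob x y‖ ≤ t → |T x - T y| ≤ η) (h : Competitor T ε R δ ma mb T) :
    ∃ W, Competitor T ε R δ ma mb W ∧ ∀ w, Competitor T ε R δ ma mb w →
      ∫ z, w z * hypWeight z ∂hypMeasure ≤ ∫ z, W z * hypWeight z ∂hypMeasure := by
  have surj : ∀ w, Competitor T ε R δ ma mb w →
      ∃ F : BoundedContinuousFunction (Metric.closedBall (0:ℂ) R) ℝ, extZero R F = w := by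
    intro w hw
    have hc : ContinuousOn w (Metric.closedBall 0 R) :=
      (hw.continuousOn hT).mono (Metric.closedBall_subset_ball hR)
    refine ⟨BoundedContinuousFunction.mkOfCompact ⟨fun z => w z, continuousOn_iff_continuous_domRestrict.mp hc⟩, ?_⟩
    funext z
    unfold extZero
    split_ifs with hz
    · rfl
    · by_contra h0
      exact hz (by simpa using hw.supp z (Ne.symm h0))
  obtain ⟨F0, hF0⟩ := surj T h
  have hcpt := isCompact_competitor (ε := ε) (δ := δ) (ma := ma) (mb := mb) hR hT
  have hcont : ContinuousOn (fun F : BoundedContinuousFunction (Metric.closedBall (0:ℂ) R) ℝ =>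
      ∫ z, extZero R F z * hypWeight z ∂hypMeasure) {F | Competitor T ε R δ ma mb (extZero R F)} := by
    set K := ∫ z, hypWeight z ∂hypMeasure
    refine (LipschitzOnWith.of_dist_le_mul (K := K.toNNReal) fun F hF G hG => ?_).continuousOn
    have iF := integrable_mul_hypWeight hF.meas hF.compBdd.bdd
    have iG := integrable_mul_hypWeight hG.meas hG.compBdd.bdd
    have hw0 : ∀ z, 0 ≤ hypWeight z := fun z => by unfold hypWeight; positivity
    have hK : 0 ≤ K := integral_nonneg hw0
    rw [Real.dist_eq, ← integral_sub (by exact iF) (by exact iG), Real.coe_toNNReal _ hK, mul_comm,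
      ← integral_const_mul, ← Real.norm_eq_abs]
    refine norm_integral_le_of_norm_le (integrable_hypWeight.const_mul _) (ae_of_all _ fun z => ?_)
    rw [← sub_mul, norm_mul, Real.norm_eq_abs, Real.norm_eq_abs, abs_of_nonneg (hw0 z)]
    exact mul_le_mul_of_nonneg_right (abs_extZero_sub_le _ _ z) (hw0 z)
  obtain ⟨F, hF, hmax⟩ := hcpt.exists_isMaxOn ⟨F0, by simpa [hF0] using h⟩ hcont
  refine ⟨extZero R F, hF, fun w hw => ?_⟩
  obtain ⟨G, rfl⟩ := surj w hw
  exact hmax hw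

set_option maxHeartbeats 400000 in
theorem exists_symmetric_competitor (hε : 0 ≤ ε) (hR : R < 1)
    (hT : ∀ η > 0, ∃ t > 0, ∀ x y : ℂ, ‖x‖ < 1 → ‖y‖ < 1 → ‖mob x y‖ ≤ t → |T x - T y| ≤ η)
    (h : Competitor T ε R δ ma mb T) :
    ∃ W, Competitor T ε R δ ma mb W ∧ ∀ x y : ℂ, ‖y‖ < 1 → ‖x‖ < ‖y‖ → W y ≤ W x := by
  obtain ⟨W, hW, hmax⟩ := exists_maximal_competitor hR hT h
  refine ⟨W, hW, fun x y hy hxy => ?_⟩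
  by_contra! hlt
  obtain ⟨c, hc, hcx, hsx⟩ := exists_hypRefl hy hxy
  have hx : ‖x‖ < 1 := hxy.trans hy
  have hp := hW.polarize hε hc
  have h1 := hmax _ hp
  have i1 := integrable_mul_hypWeight hp.meas hp.compBdd.bdd
  have i2 := integrable_mul_hypWeight hW.meas hW.compBdd.bdd
  have hσ := measurePreserving_hypRefl hc
  obtain ⟨p, hpdef⟩ : ∃ p, p = _root_.polarize c W := ⟨_, rfl⟩
  rw [← hpdef] at hp h1 i1
  obtain ⟨g, hg⟩ : ∃ g : ℂ → ℝ, g = fun z => (p z - W z) * hypWeight z := ⟨_, rfl⟩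
  have ig : Integrable g hypMeasure := by
    refine (i1.sub i2).congr (ae_of_all _ fun z => ?_)
    simp only [hg, Pi.sub_apply]; ring
  have hgσ : ∫ z, g (hypRefl c z) ∂hypMeasure = ∫ z, g z ∂hypMeasure := by
    have := integral_map (f := g) (μ := hypMeasure) (φ := hypRefl c) hσ.measurable.aemeasurable
      (by rw [hσ.map_eq]; exact ig.aestronglyMeasurable)
    rw [← this, hσ.map_eq]
  have igσ : Integrable (fun z => g (hypRefl c z)) hypMeasure := hσ.integrable_comp_of_integrable ig
  have e1 : ∫ z, g z ∂hypMeasure ≤ 0 := by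
    have : ∫ z, g z ∂hypMeasure = ∫ z, p z * hypWeight z ∂hypMeasure - ∫ z, W z * hypWeight z ∂hypMeasure := by
      rw [← integral_sub (by exact i1) (by exact i2)]
      congr 1; funext z; simp only [hg]; ring
    linarith
  have anti : ∀ z, ‖z‖ < 1 → p (hypRefl c z) - W (hypRefl c z) = -(p z - W z) := by
    intro z hz
    have := polarize_pair (w := W) hc (id : ℝ → ℝ) hz
    simp only [id] at this
    rw [hpdef]; linarith
  have wlt : ∀ z, ‖z‖ < 1 → 0 < side c z → hypWeight (hypRefl c z) < hypWeight z := by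
    intro z hz hs
    have h1 := norm_lt_norm_hypRefl hc hz hs
    have h2 := norm_sq_lt_one (norm_hypRefl hc hz)
    have h3 : ‖z‖^2 < ‖hypRefl c z‖^2 := by gcongr
    unfold hypWeight
    exact pow_lt_pow_left₀ (by linarith) (by linarith) two_ne_zero
  have esum : ∀ z, ‖z‖ < 1 → g z + g (hypRefl c z) =
      (p z - W z) * (hypWeight z - hypWeight (hypRefl c z)) := by
    intro z hz
    simp only [hg]
    rw [anti z hz]; ring
  have nonneg : ∀ z, ‖z‖ < 1 → 0 ≤ g z + g (hypRefl c z) := by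
    intro z hz
    rw [esum z hz]
    rcases lt_trichotomy (side c z) 0 with hs | hs | hs
    · have h1 := side_hypRefl_pos hc hz hs
      have h2 := wlt _ (norm_hypRefl hc hz) h1
      rw [hypRefl_hypRefl hc hz] at h2
      have h3 : p z ≤ W z := by rw [hpdef, polarize_of_neg hz hs]; exact min_le_left _ _
      nlinarith
    · rw [hypRefl_eq_self hc hz hs]; simp
    · have h2 := wlt z hz hs
      have h3 : W z ≤ p z := by rw [hpdef, polarize_of_nonneg hz hs.le]; exact le_max_left _ _
      nlinarith
  have pos : 0 < ∫ z, (g z + g (hypRefl c z)) ∂hypMeasure := by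
    rw [integral_pos_iff_support_of_nonneg_ae (by
      filter_upwards [ae_hyp_lt_one] with z hz using nonneg z hz) (by exact ig.add igσ)]
    refine hyp_pos_of_mem_nhds hx ?_
    have b1 : ∀ᶠ z in 𝓝 x, ‖z‖ < 1 := continuous_norm.continuousAt.eventually_lt continuousAt_const hx
    have cW := hW.continuousOn hT
    have b2 : ∀ᶠ z in 𝓝 x, 0 < side c z := by
      have : ContinuousAt (side c) x := by unfold side; fun_prop
      exact this.eventually (lt_mem_nhds hsx)
    have b3 : ∀ᶠ z in 𝓝 x, W z < W (hypRefl c z) := by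
      have c1 : ContinuousAt W x := cW.continuousAt (Metric.isOpen_ball.mem_nhds (by simpa using hx))
      have c2 : ContinuousAt W (hypRefl c x) := by
        rw [hcx]; exact cW.continuousAt (Metric.isOpen_ball.mem_nhds (by simpa using hy))
      have c3 : ContinuousAt (hypRefl c) x := by
        have h1 := (hasDerivAt_mob (norm_inv_conj_lt_one hc) hx).continuousAt
        unfold hypRefl
        exact continuousAt_const.mul (Complex.continuous_conj.continuousAt.comp h1)
      exact c1.eventually_lt (c2.comp c3) (by simpa [hcx] using hlt)
    filter_upwards [b1, b2, b3] with z z1 z2 z3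
    rw [Function.mem_support, esum z z1]
    have h2 := wlt z z1 z2
    have h3 : W z < p z := by rw [hpdef, polarize_of_nonneg z1 z2.le]; exact lt_max_of_lt_right z3
    exact (mul_pos (by linarith) (by linarith)).ne'
  rw [integral_add ig igσ, hgσ] at pos
  linarith

end Competitor

/-- The truncated fundamental solution `log max(|z|², r²)`, clamped outside the disk. -/
noncomputable def logTrunc (r : ℝ) (z : ℂ) : ℝ := Real.log (max (min (‖z‖^2) 1) (r^2))

/-- The defect in the mean value property at scale `δ` of `logTrunc r`. -/
noncomputable def logDefect (δ r : ℝ) (x : ℂ) : ℝ :=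
  hypAvg δ (logTrunc r) x - hypMeasure.real (Metric.ball 0 δ) * logTrunc r x

section Capacity

variable {δ r : ℝ}

lemma measurable_logTrunc : Measurable (logTrunc r) := by
  unfold logTrunc; fun_prop

lemma logTrunc_mem (hr : 0 < r) (hr1 : r < 1) (z : ℂ) : logTrunc r z ∈ Icc (Real.log (r^2)) 0 := by
  have h1 : r^2 ≤ max (min (‖z‖^2) 1) (r^2) := le_max_right _ _
  have h2 : max (min (‖z‖^2) 1) (r^2) ≤ 1 := max_le (min_le_right _ _) (by nlinarith)
  have h3 : 0 < r^2 := by positivity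
  exact ⟨Real.log_le_log h3 h1, Real.log_nonpos (h3.le.trans h1) h2⟩

lemma abs_logTrunc_le (hr : 0 < r) (hr1 : r < 1) (z : ℂ) : |logTrunc r z| ≤ -Real.log (r^2) := by
  have := logTrunc_mem hr hr1 z
  rw [abs_of_nonpos this.2]; linarith [this.1]

lemma logTrunc_of_le {z : ℂ} (h : ‖z‖ ≤ r) : logTrunc r z = Real.log (r^2) := by
  have : ‖z‖^2 ≤ r^2 := by gcongr
  rw [logTrunc, max_eq_right ((min_le_left _ _).trans this)]

lemma logTrunc_of_ge (hr : 0 ≤ r) {z : ℂ} (h : r ≤ ‖z‖) (hz : ‖z‖ < 1) :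
    logTrunc r z = 2 * Real.log ‖z‖ := by
  have h1 : r^2 ≤ ‖z‖^2 := by gcongr
  rw [logTrunc, min_eq_left (norm_sq_lt_one hz).le, max_eq_left h1, Real.log_pow]; norm_num

lemma two_log_le_logTrunc {z : ℂ} (h0 : z ≠ 0) (hz : ‖z‖ < 1) : 2 * Real.log ‖z‖ ≤ logTrunc r z := by
  have h1 : 0 < ‖z‖ := norm_pos_iff.mpr h0
  have : 2 * Real.log ‖z‖ = Real.log (‖z‖^2) := by rw [Real.log_pow]; norm_num
  rw [logTrunc, min_eq_left (norm_sq_lt_one hz).le, this]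
  exact Real.log_le_log (by positivity) (le_max_left _ _)

lemma integrableOn_comp_mob (h0 : 0 ≤ δ) (h1 : δ < 1) {h : ℂ → ℝ} (hm : Measurable h) {C : ℝ}
    (hb : ∀ z, |h z| ≤ C) (x : ℂ) :
    IntegrableOn (fun ζ => h (mob x ζ)) (Metric.ball 0 δ) hypMeasure :=
  IntegrableOn.of_bound (hyp_ball_lt_top h0 h1) (hm.comp (measurable_mob x)).aestronglyMeasurable C
    (ae_of_all _ fun _ => hb _)

lemma hypAvg_congr {w v : ℂ → ℝ} {x : ℂ} (h : ∀ ζ : ℂ, ‖ζ‖ < δ → w (mob x ζ) = v (mob x ζ)) :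
    hypAvg δ w x = hypAvg δ v x :=
  setIntegral_congr_fun measurableSet_ball fun ζ hζ => h ζ (by simpa using hζ)

lemma hypAvg_const (a : ℝ) (x : ℂ) : hypAvg δ (fun _ => a) x = hypMeasure.real (Metric.ball 0 δ) * a := by
  simp [hypAvg]

lemma mob_ne_zero {x ζ : ℂ} (hx : ‖x‖ < 1) (h1 : δ < 1) (hδ : δ < ‖x‖) (hζ : ‖ζ‖ ≤ δ) : mob x ζ ≠ 0 := by
  intro h
  have := mob_mob hx (hζ.trans_lt h1)
  rw [h, mob_zero_right] at this
  rw [this] at hδ; linarith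

lemma hypAvg_two_log (h0 : 0 ≤ δ) (h1 : δ < 1) {x : ℂ} (hx : ‖x‖ < 1) (hδ : δ < ‖x‖) :
    hypAvg δ (fun z => 2 * Real.log ‖z‖) x = hypMeasure.real (Metric.ball 0 δ) * (2 * Real.log ‖x‖) := by
  have := hypAvg_log_norm h0 h1 (f := id) differentiableOn_id hx
    (fun z hz => mob_ne_zero hx h1 hδ (by simpa using hz))
  simp only [id] at this
  unfold hypAvg at this ⊢
  rw [integral_const_mul, this]; ring

lemma logDefect_nonneg (h0 : 0 ≤ δ) (hδr : δ < r) (hr1 : r < 1) {x : ℂ} (hx : ‖x‖ < 1) :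
    0 ≤ logDefect δ r x := by
  have hr := h0.trans_lt hδr
  have h1 := hδr.trans hr1
  have hi := integrableOn_comp_mob h0 h1 measurable_logTrunc (abs_logTrunc_le hr hr1) x
  unfold logDefect
  rw [sub_nonneg]
  rcases le_or_gt ‖x‖ r with hxr | hxr
  · rw [logTrunc_of_le hxr, ← hypAvg_const _ x]
    refine setIntegral_mono_on (integrableOn_const (hyp_ball_lt_top h0 h1).ne) hi measurableSet_ball fun ζ _ => ?_
    exact (logTrunc_mem hr hr1 _).1
  · rw [logTrunc_of_ge hr.le hxr.le hx, ← hypAvg_two_log h0 h1 hx (hδr.trans hxr)]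
    have i2 := integrableOn_log_norm_mob h0 h1 (f := id) differentiableOn_id hx
      (fun z hz => mob_ne_zero hx h1 (hδr.trans hxr) (by simpa using hz))
    refine setIntegral_mono_on (by exact Integrable.const_mul i2 2) hi measurableSet_ball fun ζ hζ => ?_
    have hζ : ‖ζ‖ < δ := by simpa using hζ
    exact two_log_le_logTrunc (mob_ne_zero hx h1 (hδr.trans hxr) hζ.le)
      (norm_mob_lt_one hx (hζ.trans h1))

lemma exists_of_logDefect_ne_zero (h0 : 0 < δ) (hδr : δ < r) (hr1 : r < 1) {x : ℂ} (hx : ‖x‖ < 1)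
    (h : logDefect δ r x ≠ 0) :
    (∃ y : ℂ, ‖y‖ < 1 ∧ ‖mob x y‖ < δ ∧ r < ‖y‖) ∧ ∃ y : ℂ, ‖y‖ < 1 ∧ ‖mob x y‖ < δ ∧ ‖y‖ < r := by
  have hr := h0.trans hδr
  have h1 := hδr.trans hr1
  have near : ∀ ζ : ℂ, ‖ζ‖ < δ → ‖mob x ζ‖ < 1 ∧ ‖mob x (mob x ζ)‖ < δ := fun ζ hζ =>
    ⟨norm_mob_lt_one hx (hζ.trans h1), by rwa [mob_mob hx (hζ.trans h1)]⟩
  constructor <;> by_contra! H <;> apply h <;> unfold logDefect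
  · have H' : ∀ ζ : ℂ, ‖ζ‖ < δ → logTrunc r (mob x ζ) = Real.log (r^2) := fun ζ hζ =>
      logTrunc_of_le (H _ (near ζ hζ).1 (near ζ hζ).2)
    have e := H' 0 (by simpa using h0)
    rw [mob_zero_right] at e
    rw [hypAvg_congr (v := fun _ => Real.log (r^2)) H', hypAvg_const, e, sub_self]
  · have H1 : ∀ ζ : ℂ, ‖ζ‖ < δ → r ≤ ‖mob x ζ‖ := fun ζ hζ => H _ (near ζ hζ).1 (near ζ hζ).2
    have H' : ∀ ζ : ℂ, ‖ζ‖ < δ → logTrunc r (mob x ζ) = 2 * Real.log ‖mob x ζ‖ := fun ζ hζ =>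
      logTrunc_of_ge hr.le (H1 ζ hζ) (near ζ hζ).1
    have e := H' 0 (by simpa using h0)
    have e2 := H1 0 (by simpa using h0)
    rw [mob_zero_right] at e e2
    rw [hypAvg_congr (v := fun z => 2 * Real.log ‖z‖) H', hypAvg_two_log h0.le h1 hx (hδr.trans_le e2), e, sub_self]

lemma norm_sub_le_two_mul_mob {x y : ℂ} (hx : ‖x‖ < 1) (hy : ‖y‖ < 1) : ‖x - y‖ ≤ 2 * ‖mob x y‖ := by
  have h := one_sub_conj_mul_ne_zero hx hy
  have h2 : ‖1 - conj x * y‖ ≤ 2 := by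
    refine (norm_sub_le _ _).trans ?_
    rw [norm_one, norm_mul, Complex.norm_conj]; nlinarith [norm_nonneg x, norm_nonneg y]
  have h3 : 0 < ‖1 - conj x * y‖ := norm_pos_iff.mpr h
  unfold mob
  rw [norm_div, ← mul_div_assoc, le_div_iff₀ h3]
  nlinarith [norm_nonneg (x - y)]

lemma norm_bounds_of_logDefect_ne_zero (h0 : 0 < δ) (hδr : δ < r) (hr1 : r < 1) {x : ℂ} (hx : ‖x‖ < 1)
    (h : logDefect δ r x ≠ 0) : r - 2 * δ ≤ ‖x‖ ∧ ‖x‖ ≤ r + 2 * δ := by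
  obtain ⟨⟨y, y1, y2, y3⟩, ⟨z, z1, z2, z3⟩⟩ := exists_of_logDefect_ne_zero h0 hδr hr1 hx h
  have a1 := norm_sub_le_two_mul_mob hx y1
  have a2 := norm_sub_le_two_mul_mob hx z1
  have a3 := norm_sub_norm_le y x
  have a4 := norm_sub_norm_le x z
  rw [norm_sub_rev] at a3
  constructor <;> linarith

lemma measurable_logDefect : Measurable (logDefect δ r) :=
  (measurable_hypAvg measurable_logTrunc).sub (measurable_logTrunc.const_mul _)

lemma abs_logDefect_le (h0 : 0 ≤ δ) (h1 : δ < 1) (hr : 0 < r) (hr1 : r < 1) (x : ℂ) :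
    |logDefect δ r x| ≤ 2 * (-Real.log (r^2) * hypMeasure.real (Metric.ball 0 δ)) := by
  have a := abs_hypAvg_le h0 h1 (abs_logTrunc_le hr hr1) x
  have b := abs_logTrunc_le hr hr1 x
  have k : 0 ≤ hypMeasure.real (Metric.ball 0 δ) := measureReal_nonneg
  have : |hypMeasure.real (Metric.ball 0 δ) * logTrunc r x| ≤ -Real.log (r^2) * hypMeasure.real (Metric.ball 0 δ) := by
    rw [abs_mul, abs_of_nonneg k, mul_comm]; gcongr
  unfold logDefect
  refine (abs_sub _ _).trans ?_
  linarith

lemma integrable_of_bdd_supp {R C : ℝ} (hR0 : 0 ≤ R) (hR : R < 1) {k : ℂ → ℝ} (hk : Measurable k)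
    (hb : ∀ z, |k z| ≤ C) (hs : ∀ z, ‖z‖ < 1 → k z ≠ 0 → ‖z‖ ≤ R) : Integrable k hypMeasure := by
  have h1 : IntegrableOn k (Metric.closedBall 0 R) hypMeasure :=
    IntegrableOn.of_bound (by rw [hyp_closedBall hR0 hR]; exact ENNReal.ofReal_lt_top)
      hk.aestronglyMeasurable C (ae_of_all _ fun z => hb z)
  rw [← integrable_indicator_iff measurableSet_closedBall] at h1
  refine h1.congr ?_
  filter_upwards [ae_hyp_lt_one] with z hz
  by_cases h : k z = 0
  · simp [indicator, h]
  · rw [indicator_of_mem (by simpa using hs z hz h)]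

lemma integrable_mul_logDefect (h0 : 0 < δ) (hδr : δ < r) (hr1 : r + 2 * δ < 1) {k : ℂ → ℝ} (hk : Measurable k)
    {C : ℝ} (hb : ∀ z, |k z| ≤ C) : Integrable (fun z => k z * logDefect δ r z) hypMeasure := by
  refine integrable_of_bdd_supp (by linarith) hr1 (hk.mul measurable_logDefect)
    (C := C * (2 * (-Real.log (r^2) * hypMeasure.real (Metric.ball 0 δ)))) ?_ ?_
  · intro z
    rw [abs_mul]
    exact mul_le_mul (hb z) (abs_logDefect_le h0.le (by linarith) (by linarith) (by linarith) z) (abs_nonneg _)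
      ((abs_nonneg _).trans (hb z))
  · intro z hz h
    exact (norm_bounds_of_logDefect_ne_zero h0 hδr (by linarith) hz (right_ne_zero_of_mul h)).2

end Capacity

/-- The capacitary potential of the hyperbolic annulus `r₁ < |z| < r₂`. -/
noncomputable def annulusPot (r₁ r₂ : ℝ) (z : ℂ) : ℝ := logTrunc r₂ z - logTrunc r₁ z

section Capacity

variable {δ r₁ r₂ : ℝ}

lemma measurable_annulusPot : Measurable (annulusPot r₁ r₂) :=
  measurable_logTrunc.sub measurable_logTrunc

lemma annulusPot_nonneg (h1 : 0 < r₁) (h : r₁ ≤ r₂) (z : ℂ) : 0 ≤ annulusPot r₁ r₂ z := by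
  unfold annulusPot logTrunc
  have : r₁^2 ≤ r₂^2 := by gcongr
  rw [sub_nonneg]
  exact Real.log_le_log (lt_of_lt_of_le (by positivity) (le_max_right _ _)) (max_le_max le_rfl this)

lemma annulusPot_le (h1 : 0 < r₁) (h : r₁ ≤ r₂) (z : ℂ) :
    annulusPot r₁ r₂ z ≤ Real.log (r₂^2) - Real.log (r₁^2) := by
  have h2 := h1.trans_le h
  have a1 : 0 < max (min (‖z‖^2) 1) (r₁^2) := lt_of_lt_of_le (by positivity) (le_max_right _ _)
  have a2 : 0 < max (min (‖z‖^2) 1) (r₂^2) := lt_of_lt_of_le (by positivity) (le_max_right _ _)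
  have a3 : r₁^2 ≤ r₂^2 := by gcongr
  unfold annulusPot logTrunc
  rw [← Real.log_div a2.ne' a1.ne', ← Real.log_div (by positivity) (by positivity)]
  refine Real.log_le_log (by positivity) ?_
  rw [div_le_div_iff₀ a1 (by positivity)]
  rcases le_total (min (‖z‖^2) 1) (r₂^2) with h | h
  · rw [max_eq_right h]
    exact mul_le_mul_of_nonneg_left (le_max_right _ _) (by positivity)
  · rw [max_eq_left h, max_eq_left (a3.trans h), mul_comm]
    exact mul_le_mul_of_nonneg_right a3 (le_trans (by positivity) h)

lemma annulusPot_supp (h : r₁ ≤ r₂) (h1 : 0 < r₁) (hr : r₂ < 1) (z : ℂ) (hz : annulusPot r₁ r₂ z ≠ 0) : ‖z‖ ≤ r₂ := by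
  by_contra! hz2
  apply hz
  have a3 : r₁^2 ≤ r₂^2 := by gcongr
  have a4 : r₂^2 ≤ ‖z‖^2 := by have := h1.trans_le h; gcongr
  have a5 : r₂^2 ≤ min (‖z‖^2) 1 := le_min a4 (by nlinarith)
  unfold annulusPot logTrunc
  rw [max_eq_left a5, max_eq_left (a3.trans a5), sub_self]

lemma compBdd_annulusPot (h1 : 0 < r₁) (h : r₁ ≤ r₂) (hr : r₂ < 1) :
    CompBdd r₂ (Real.log (r₂^2) - Real.log (r₁^2)) (annulusPot r₁ r₂) :=
  ⟨measurable_annulusPot, fun z => by rw [abs_of_nonneg (annulusPot_nonneg h1 h z)]; exact annulusPot_le h1 h z,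
    annulusPot_supp h h1 hr⟩

lemma annulusPot_laplace (h0 : 0 ≤ δ) (hδ : δ < 1) (h1 : 0 < r₁) (h : r₁ ≤ r₂) (hr : r₂ < 1) (x : ℂ) :
    hypMeasure.real (Metric.ball 0 δ) * annulusPot r₁ r₂ x - hypAvg δ (annulusPot r₁ r₂) x =
      logDefect δ r₁ x - logDefect δ r₂ x := by
  have i1 := integrableOn_comp_mob h0 hδ measurable_logTrunc (abs_logTrunc_le h1 (h.trans_lt hr)) x
  have i2 := integrableOn_comp_mob h0 hδ measurable_logTrunc (abs_logTrunc_le (h1.trans_le h) hr) x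
  have : hypAvg δ (annulusPot r₁ r₂) x = hypAvg δ (logTrunc r₂) x - hypAvg δ (logTrunc r₁) x := by
    unfold hypAvg annulusPot
    rw [← integral_sub (by exact i2) (by exact i1)]
  rw [this]
  unfold logDefect annulusPot; ring

/-- The truncation of `log (1-|z|²)` at radius `r`. -/
noncomputable def logOneSub (r : ℝ) (z : ℂ) : ℝ := Real.log (1 - min (‖z‖^2) (r^2))

lemma measurable_logOneSub {r : ℝ} : Measurable (logOneSub r) := by unfold logOneSub; fun_prop

lemma abs_logOneSub_le {r : ℝ} (h0 : 0 ≤ r) (hr : r < 1) (z : ℂ) : |logOneSub r z| ≤ -Real.log (1 - r^2) := by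
  have h1 : min (‖z‖^2) (r^2) ≤ r^2 := min_le_right _ _
  have h2 : 0 ≤ min (‖z‖^2) (r^2) := by positivity
  have h3 : r^2 < 1 := by nlinarith
  unfold logOneSub
  rw [abs_of_nonpos (Real.log_nonpos (by linarith) (by linarith))]
  exact neg_le_neg (Real.log_le_log (by linarith) (by linarith))

lemma logOneSub_of_le {r : ℝ} {z : ℂ} (h : ‖z‖ ≤ r) : logOneSub r z = Real.log (1 - ‖z‖^2) := by
  have : ‖z‖^2 ≤ r^2 := by gcongr
  rw [logOneSub, min_eq_left this]

lemma logOneSub_laplace {r : ℝ} (h0 : 0 < δ) (hr : r < 1) {x : ℂ} (hx : ‖x‖ + 2 * δ ≤ r) :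
    hypMeasure.real (Metric.ball 0 δ) * logOneSub r x - hypAvg δ (logOneSub r) x = hypDrop δ := by
  have hδ : δ < 1 := by linarith [norm_nonneg x]
  have hx1 : ‖x‖ < 1 := by linarith
  have := hypAvg_log_one_sub h0.le hδ hx1
  rw [hypAvg_congr (v := fun z => Real.log (1 - ‖z‖^2)), this, logOneSub_of_le (by linarith)]
  · ring
  · intro ζ hζ
    refine logOneSub_of_le ?_
    have h1 := norm_mob_lt_one hx1 (hζ.trans hδ)
    have h2 := norm_sub_le_two_mul_mob hx1 h1
    rw [mob_mob hx1 (hζ.trans hδ), norm_sub_rev] at h2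
    have := norm_sub_norm_le (mob x ζ) x
    linarith

lemma integral_logDefect_eq (h0 : 0 < δ) (h1 : δ < r₁) (h : r₁ ≤ r₂) (hr : r₂ + 2 * δ < 1) :
    ∫ x, logDefect δ r₁ x ∂hypMeasure = ∫ x, logDefect δ r₂ x ∂hypMeasure := by
  have hδ : δ < 1 := by linarith
  have a := near_bilin_right h0.le hδ (by linarith) (by linarith)
    (compBdd_annulusPot (h0.trans h1) h (by linarith)) (h := fun _ => 1) measurable_const (C' := 1) (by simp)
  have i1 := integrable_mul_logDefect h0 h1 (by linarith) (k := fun _ => 1) measurable_const (C := 1) (by simp)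
  have i2 := integrable_mul_logDefect h0 (h1.trans_le h) hr (k := fun _ => 1) measurable_const (C := 1) (by simp)
  simp only [sub_self, mul_zero, integral_zero, one_mul,
    annulusPot_laplace h0.le hδ (h0.trans h1) h (by linarith : r₂ < 1)] at a i1 i2
  rw [integral_sub i1 i2] at a
  linarith

lemma drop_mul_integral_annulusPot_le (h0 : 0 < δ) (h1 : 2 * δ < r₁) (h : r₁ ≤ r₂) (hr : r₂ + 2 * δ < 1) :
    hypDrop δ * ∫ x, annulusPot r₁ r₂ x ∂hypMeasure ≤
      (∫ x, logDefect δ r₁ x ∂hypMeasure) *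
        (Real.log (1 - (r₁ - 2 * δ)^2) - Real.log (1 - (r₂ + 2 * δ)^2)) := by
  have hδ : δ < 1 := by linarith
  have hp := compBdd_annulusPot (by linarith : 0 < r₁) h (by linarith : r₂ < 1)
  set g := logOneSub (r₂ + 2 * δ) with hg
  have hgm : Measurable g := measurable_logOneSub
  have hgb := abs_logOneSub_le (r := r₂ + 2 * δ) (by linarith) hr
  have a := near_bilin_right h0.le hδ (by linarith) (by linarith) hp hgm hgb
  have b := near_bilin_left h0.le hδ (by linarith) (by linarith) hp hgm hgb
  rw [a] at b
  have e1 : ∫ x, annulusPot r₁ r₂ x * (hypMeasure.real (Metric.ball 0 δ) * g x - hypAvg δ g x) ∂hypMeasure =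
      hypDrop δ * ∫ x, annulusPot r₁ r₂ x ∂hypMeasure := by
    rw [← integral_const_mul]
    congr 1; funext x
    by_cases hx : annulusPot r₁ r₂ x = 0
    · simp [hx]
    · have := hp.supp x hx
      rw [hg, logOneSub_laplace h0 hr (by linarith), mul_comm]
  have i1 := integrable_mul_logDefect h0 (r := r₁) (by linarith) (by linarith) hgm hgb
  have i2 := integrable_mul_logDefect h0 (r := r₂) (by linarith) (by linarith) hgm hgb
  have j1 := integrable_mul_logDefect h0 (r := r₁) (by linarith) (by linarith)
    (k := fun _ => Real.log (1 - (r₁ - 2 * δ)^2)) measurable_const (fun _ => le_rfl)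
  have j2 := integrable_mul_logDefect h0 (r := r₂) (by linarith) (by linarith)
    (k := fun _ => Real.log (1 - (r₂ + 2 * δ)^2)) measurable_const (fun _ => le_rfl)
  have e2 : ∫ x, g x * (hypMeasure.real (Metric.ball 0 δ) * annulusPot r₁ r₂ x -
      hypAvg δ (annulusPot r₁ r₂) x) ∂hypMeasure =
      ∫ x, g x * logDefect δ r₁ x ∂hypMeasure - ∫ x, g x * logDefect δ r₂ x ∂hypMeasure := by
    rw [← integral_sub i1 i2]
    congr 1; funext x
    rw [annulusPot_laplace h0.le hδ (by linarith) h (by linarith)]; ring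
  have u1 : ∫ x, g x * logDefect δ r₁ x ∂hypMeasure ≤
      Real.log (1 - (r₁ - 2 * δ)^2) * ∫ x, logDefect δ r₁ x ∂hypMeasure := by
    rw [← integral_const_mul]
    refine integral_mono_ae i1 j1 ?_
    filter_upwards [ae_hyp_lt_one] with x hx
    by_cases hd : logDefect δ r₁ x = 0
    · simp [hd]
    · obtain ⟨b1, b2⟩ := norm_bounds_of_logDefect_ne_zero h0 (by linarith) (by linarith) hx hd
      refine mul_le_mul_of_nonneg_right ?_ (logDefect_nonneg h0.le (by linarith) (by linarith) hx)
      rw [hg, logOneSub_of_le (by linarith)]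
      have : (r₁ - 2 * δ)^2 ≤ ‖x‖^2 := by have : 0 ≤ r₁ - 2 * δ := by linarith
                                          gcongr
      exact Real.log_le_log (by linarith [norm_sq_lt_one hx]) (by linarith)
  have u2 : Real.log (1 - (r₂ + 2 * δ)^2) * ∫ x, logDefect δ r₂ x ∂hypMeasure ≤
      ∫ x, g x * logDefect δ r₂ x ∂hypMeasure := by
    rw [← integral_const_mul]
    refine integral_mono_ae j2 i2 ?_
    filter_upwards [ae_hyp_lt_one] with x hx
    refine mul_le_mul_of_nonneg_right ?_ (logDefect_nonneg h0.le (by linarith) (by linarith) hx)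
    have := hgb x
    have := (abs_le.mp (hgb x)).1
    linarith
  rw [e1, e2] at b
  rw [← integral_logDefect_eq h0 (by linarith) h hr] at u2
  linarith

lemma annulusProfile_integral {a b : ℝ} (ha : 0 < a) (hab : a ≤ b) (hb : b < 1) :
    IntervalIntegrable (fun t => ((1 - t)^2)⁻¹ * (Real.log b - Real.log (max t a))) volume 0 b ∧
    ∫ t in (0:ℝ)..b, ((1 - t)^2)⁻¹ * (Real.log b - Real.log (max t a)) =
      Real.log (1 - a) - Real.log (1 - b) := by
  have hcont : ContinuousOn (fun t => ((1 - t)^2)⁻¹ * (Real.log b - Real.log (max t a))) (Icc 0 b) := by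
    refine ContinuousOn.mul (ContinuousOn.inv₀ (by fun_prop) ?_) (ContinuousOn.sub continuousOn_const
      (ContinuousOn.log (by fun_prop) ?_))
    · intro t ht
      have : 0 < 1 - t := by linarith [ht.2]
      positivity
    · intro t _
      exact (lt_of_lt_of_le ha (le_max_right _ _)).ne'
  have i1 : IntervalIntegrable (fun t => ((1 - t)^2)⁻¹ * (Real.log b - Real.log (max t a))) volume 0 a :=
    (hcont.mono (Icc_subset_Icc le_rfl hab)).intervalIntegrable_of_Icc ha.le
  have i2 : IntervalIntegrable (fun t => ((1 - t)^2)⁻¹ * (Real.log b - Real.log (max t a))) volume a b :=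
    (hcont.mono (Icc_subset_Icc ha.le le_rfl)).intervalIntegrable_of_Icc hab
  refine ⟨i1.trans i2, ?_⟩
  rw [← intervalIntegral.integral_add_adjacent_intervals i1 i2]
  have e1 := intervalIntegral.integral_eq_sub_of_hasDerivAt (a := 0) (b := a)
    (f := fun t => (1 - t)⁻¹ * (Real.log b - Real.log a))
    (f' := fun t => ((1 - t)^2)⁻¹ * (Real.log b - Real.log (max t a))) (by
      intro t ht
      rw [uIcc_of_le ha.le] at ht
      have h1 : 1 - t ≠ 0 := by linarith [ht.2]
      have := (((hasDerivAt_id t).const_sub 1).inv h1).mul_const (Real.log b - Real.log a)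
      rw [max_eq_right ht.2]
      refine HasDerivAt.congr_deriv (by exact this) ?_
      simp) i1
  have e2 := intervalIntegral.integral_eq_sub_of_hasDerivAt (a := a) (b := b)
    (f := fun t => (1 - t)⁻¹ * (Real.log b - Real.log t) + Real.log t - Real.log (1 - t))
    (f' := fun t => ((1 - t)^2)⁻¹ * (Real.log b - Real.log (max t a))) (by
      intro t ht
      rw [uIcc_of_le hab] at ht
      have h1 : 1 - t ≠ 0 := by linarith [ht.2]
      have h2 : t ≠ 0 := by linarith [ht.1]
      have d1 := ((hasDerivAt_id t).const_sub 1)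
      have d2 := (Real.hasDerivAt_log h2)
      have := (((d1.inv h1).mul (d2.const_sub (Real.log b))).add d2).sub (d1.log h1)
      rw [max_eq_left ht.1]
      refine HasDerivAt.congr_deriv (by exact this) ?_
      simp only [id, Pi.inv_apply]
      field_simp
      ring) i2
  rw [e1, e2]
  have h1 : 1 - a ≠ 0 := by linarith
  field_simp
  ring

lemma le_integral_annulusPot (h1 : 0 < r₁) (h : r₁ ≤ r₂) (hr : r₂ < 1) :
    Real.log (1 - r₁^2) - Real.log (1 - r₂^2) ≤ ∫ x, annulusPot r₁ r₂ x ∂hypMeasure := by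
  have h2 := h1.trans_le h
  have ha : 0 < r₁^2 := by positivity
  have hb : r₂^2 < 1 := by nlinarith
  have hab : r₁^2 ≤ r₂^2 := by gcongr
  have hp := compBdd_annulusPot h1 h hr
  have hpi : Integrable (annulusPot r₁ r₂) hypMeasure := by
    simpa using hp.integrable_mul h2.le hr (k := fun _ => 1) measurable_const (C' := 1) (by simp)
  have hnn := annulusPot_nonneg h1 h
  obtain ⟨i, e⟩ := annulusProfile_integral ha hab hb
  refine (ENNReal.ofReal_le_ofReal_iff (integral_nonneg hnn)).mp ?_
  rw [ofReal_integral_eq_lintegral_ofReal hpi (ae_of_all _ hnn)]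
  have hrad := lintegral_hyp_radial (fun t => ENNReal.ofReal
    (Real.log (max (min t 1) (r₂^2)) - Real.log (max (min t 1) (r₁^2)))) (by fun_prop)
  have : ∫⁻ x, ENNReal.ofReal (annulusPot r₁ r₂ x) ∂hypMeasure = ∫⁻ z : ℂ, ENNReal.ofReal
    (Real.log (max (min (‖z‖^2) 1) (r₂^2)) - Real.log (max (min (‖z‖^2) 1) (r₁^2))) ∂hypMeasure := rfl
  rw [this, hrad, ← e, intervalIntegral.integral_of_le (by positivity),
    ofReal_integral_eq_lintegral_ofReal ((intervalIntegrable_iff_integrableOn_Ioc_of_le (by positivity)).mp i)]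
  · refine (setLIntegral_congr_fun measurableSet_Ioc fun t ht => ?_).trans_le
      (lintegral_mono_set (s := Ioc 0 (r₂^2)) fun t ht => ⟨ht.1, ht.2.trans_lt hb⟩)
    rw [min_eq_left (ht.2.trans hb.le), max_eq_right ht.2, ENNReal.ofReal_mul (by positivity)]
  · filter_upwards [ae_restrict_mem measurableSet_Ioc] with t ht
    have : Real.log (max t (r₁^2)) ≤ Real.log (r₂^2) :=
      Real.log_le_log (lt_of_lt_of_le ha (le_max_right _ _)) (max_le ht.2 hab)
    simp only [Pi.zero_apply]
    have : 0 ≤ Real.log (r₂^2) - Real.log (max t (r₁^2)) := by linarith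
    positivity

lemma integrable_near_mul_sub {R C C' : ℝ} {w h : ℂ → ℝ} (h0 : 0 ≤ δ) (h1 : δ < 1) (hR0 : 0 ≤ R) (hR : R < 1)
    (hw : CompBdd R C w) (hh : Measurable h) (hhb : ∀ z, |h z| ≤ C') :
    Integrable (fun p : ℂ × ℂ => (w p.1 - w p.2) * (h p.1 - h p.2)) (nearMeasure δ) := by
  have hm : Measurable (fun p : ℂ × ℂ => h p.1 - h p.2) := by fun_prop
  have hb : ∀ p : ℂ × ℂ, |h p.1 - h p.2| ≤ C' + C' := fun p =>
    (abs_sub _ _).trans (add_le_add (hhb _) (hhb _))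
  refine ((hw.integrable_mul_fst h0 h1 hR0 hR hm hb).sub (hw.integrable_mul_snd h0 h1 hR0 hR hm hb)).congr
    (ae_of_all _ fun p => ?_)
  simp only [Pi.sub_apply]; ring

lemma ofReal_integral_sq_eq_nearEnergy {R C : ℝ} {w : ℂ → ℝ} (h0 : 0 ≤ δ) (h1 : δ < 1) (hR0 : 0 ≤ R) (hR : R < 1)
    (hw : CompBdd R C w) : Integrable (fun p : ℂ × ℂ => (w p.1 - w p.2)^2) (nearMeasure δ) ∧
    ENNReal.ofReal (∫ p, (w p.1 - w p.2)^2 ∂(nearMeasure δ)) = nearEnergy δ w := by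
  have i := integrable_near_mul_sub h0 h1 hR0 hR hw hw.meas hw.bdd
  have i : Integrable (fun p : ℂ × ℂ => (w p.1 - w p.2)^2) (nearMeasure δ) := by simpa [sq] using i
  exact ⟨i, ofReal_integral_eq_lintegral_ofReal i (ae_of_all _ fun p => sq_nonneg _)⟩

theorem capacity_estimate {R ε η μ : ℝ} {W : ℂ → ℝ} (h0 : 0 < δ) (h1 : 2 * δ < r₁) (h : r₁ < r₂)
    (hr : r₂ + 2 * δ < 1) (hR0 : 0 ≤ R) (hR : R < 1) (hε : 0 < ε) (hη : 4 * η ≤ ε)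
    (hW : CompBdd R ε W)
    (hin : ∀ x : ℂ, ‖x‖ < r₁ → W x = ε) (hout : ∀ x : ℂ, r₂ < ‖x‖ → ‖x‖ < 1 → W x = 0)
    (hmod : ∀ x y : ℂ, ‖x‖ < 1 → ‖y‖ < 1 → ‖mob x y‖ < δ → |W x - W y| ≤ η)
    (hE : ∫ p, (W p.1 - W p.2)^2 ∂(nearMeasure δ) ≤ 2 * (hypDrop δ * ε * μ)) :
    (ε - 4 * η) * (Real.log (1 - r₁^2) - Real.log (1 - r₂^2)) ≤
      μ * (Real.log (r₂^2) - Real.log (r₁^2)) *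
        (Real.log (1 - (r₁ - 2 * δ)^2) - Real.log (1 - (r₂ + 2 * δ)^2)) := by
  have hδ : δ < 1 := by linarith
  have hp := compBdd_annulusPot (by linarith : 0 < r₁) h.le (by linarith : r₂ < 1)
  have hr2 : 0 ≤ r₂ := by linarith
  have hr21 : r₂ < 1 := by linarith
  set P := annulusPot r₁ r₂ with hP
  set L := Real.log (r₂^2) - Real.log (r₁^2) with hLdef
  have hL : 0 < L := by
    have : r₁^2 < r₂^2 := by have : 0 < r₁ := by linarith
                             gcongr
    exact sub_pos.mpr (Real.log_lt_log (by have : 0 < r₁ := by linarith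
                                           positivity) this)
  set Q := ∫ x, logDefect δ r₁ x ∂hypMeasure with hQ
  have hQ2 : ∫ x, logDefect δ r₂ x ∂hypMeasure = Q := (integral_logDefect_eq h0 (by linarith) h.le hr).symm
  have nn1 : ∀ x : ℂ, ‖x‖ < 1 → 0 ≤ logDefect δ r₁ x := fun x hx => logDefect_nonneg h0.le (by linarith) (by linarith) hx
  have nn2 : ∀ x : ℂ, ‖x‖ < 1 → 0 ≤ logDefect δ r₂ x := fun x hx => logDefect_nonneg h0.le (by linarith) (by linarith) hx
  have hQ0 : 0 ≤ Q := integral_nonneg_of_ae (by filter_upwards [ae_hyp_lt_one] with x hx using nn1 x hx)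
  have int1 : ∀ {k : ℂ → ℝ} {C : ℝ}, Measurable k → (∀ z, |k z| ≤ C) →
      Integrable (fun z => k z * logDefect δ r₁ z) hypMeasure := fun hk hb =>
    integrable_mul_logDefect h0 (by linarith) (by linarith) hk hb
  have int2 : ∀ {k : ℂ → ℝ} {C : ℝ}, Measurable k → (∀ z, |k z| ≤ C) →
      Integrable (fun z => k z * logDefect δ r₂ z) hypMeasure := fun hk hb =>
    integrable_mul_logDefect h0 (by linarith) (by linarith) hk hb
  have split : ∀ {k : ℂ → ℝ} {C : ℝ}, Measurable k → (∀ z, |k z| ≤ C) →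
      ∫ x, k x * (hypMeasure.real (Metric.ball 0 δ) * P x - hypAvg δ P x) ∂hypMeasure =
      ∫ x, k x * logDefect δ r₁ x ∂hypMeasure - ∫ x, k x * logDefect δ r₂ x ∂hypMeasure := by
    intro k C hk hb
    rw [← integral_sub (int1 hk hb) (int2 hk hb)]
    congr 1; funext x
    rw [hP, annulusPot_laplace h0.le hδ (by linarith) h.le hr21]; ring
  have bWP := near_bilin_left h0.le hδ hR0 hR hW hp.meas hp.bdd
  have bPP := near_bilin_left h0.le hδ hr2 hr21 hp hp.meas hp.bdd
  rw [split hW.meas hW.bdd] at bWP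
  rw [split hp.meas hp.bdd] at bPP
  have lb1 : (ε - η) * Q ≤ ∫ x, W x * logDefect δ r₁ x ∂hypMeasure := by
    rw [← integral_const_mul]
    refine integral_mono_ae (int1 (k := fun _ => ε - η) measurable_const (fun _ => le_rfl)) (int1 hW.meas hW.bdd) ?_
    filter_upwards [ae_hyp_lt_one] with x hx
    by_cases hd : logDefect δ r₁ x = 0
    · simp [hd]
    · obtain ⟨-, y, y1, y2, y3⟩ := exists_of_logDefect_ne_zero h0 (by linarith) (by linarith) hx hd
      have := (abs_le.mp (hmod x y hx y1 y2)).1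
      rw [hin y y3] at this
      exact mul_le_mul_of_nonneg_right (by linarith) (nn1 x hx)
  have ub2 : ∫ x, W x * logDefect δ r₂ x ∂hypMeasure ≤ η * Q := by
    rw [← hQ2, ← integral_const_mul]
    refine integral_mono_ae (int2 hW.meas hW.bdd) (int2 (k := fun _ => η) measurable_const (fun _ => le_rfl)) ?_
    filter_upwards [ae_hyp_lt_one] with x hx
    by_cases hd : logDefect δ r₂ x = 0
    · simp [hd]
    · obtain ⟨⟨y, y1, y2, y3⟩, -⟩ := exists_of_logDefect_ne_zero h0 (by linarith) (by linarith) hx hd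
      have := (abs_le.mp (hmod x y hx y1 y2)).2
      rw [hout y y3 y1] at this
      exact mul_le_mul_of_nonneg_right (by linarith) (nn2 x hx)
  have ubP : ∫ x, P x * logDefect δ r₁ x ∂hypMeasure ≤ L * Q := by
    rw [← integral_const_mul]
    refine integral_mono_ae (int1 hp.meas hp.bdd) (int1 (k := fun _ => L) measurable_const (fun _ => le_rfl)) ?_
    filter_upwards [ae_hyp_lt_one] with x hx
    exact mul_le_mul_of_nonneg_right (annulusPot_le (by linarith) h.le x) (nn1 x hx)
  have lbP : 0 ≤ ∫ x, P x * logDefect δ r₂ x ∂hypMeasure :=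
    integral_nonneg_of_ae (by
      filter_upwards [ae_hyp_lt_one] with x hx
      exact mul_nonneg (annulusPot_nonneg (by linarith) h.le x) (nn2 x hx))
  have iWW := (ofReal_integral_sq_eq_nearEnergy h0.le hδ hR0 hR hW).1
  have iPP := (ofReal_integral_sq_eq_nearEnergy h0.le hδ hr2 hr21 hp).1
  have iWP := integrable_near_mul_sub h0.le hδ hR0 hR hW hp.meas hp.bdd
  have quad : 0 ≤ ∫ p, (W p.1 - W p.2)^2 ∂(nearMeasure δ) -
      2 * (ε / L) * ∫ p, (W p.1 - W p.2) * (P p.1 - P p.2) ∂(nearMeasure δ) +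
      (ε / L)^2 * ∫ p, (P p.1 - P p.2) * (P p.1 - P p.2) ∂(nearMeasure δ) := by
    have iPP' : Integrable (fun p : ℂ × ℂ => (P p.1 - P p.2) * (P p.1 - P p.2)) (nearMeasure δ) := by
      simpa [sq] using iPP
    have j1 := iWP.const_mul (2 * (ε / L))
    have j2 := iPP'.const_mul ((ε / L)^2)
    rw [← integral_const_mul, ← integral_const_mul, ← integral_sub (by exact iWW) (by exact j1),
      ← integral_add (by exact iWW.sub j1) (by exact j2)]
    refine integral_nonneg fun p => ?_
    simp only [Pi.zero_apply]
    nlinarith [sq_nonneg ((W p.1 - W p.2) - (ε / L) * (P p.1 - P p.2))]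
  have hc := hypDrop_pos h0 hδ
  have hΛ := le_integral_annulusPot (by linarith : 0 < r₁) h.le hr21
  have hcap := drop_mul_integral_annulusPot_le h0 h1 h.le hr
  rw [← hQ] at hcap
  rw [bWP, bPP] at quad
  have hG : 0 ≤ Real.log (1 - (r₁ - 2 * δ)^2) - Real.log (1 - (r₂ + 2 * δ)^2) := by
    have h3 : (r₁ - 2 * δ)^2 ≤ (r₂ + 2 * δ)^2 := by
      have : 0 ≤ r₁ - 2 * δ := by linarith
      have : r₁ - 2 * δ ≤ r₂ + 2 * δ := by linarith
      gcongr
    have h4 : (r₂ + 2 * δ)^2 < 1 := by nlinarith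
    exact sub_nonneg.mpr (Real.log_le_log (by linarith) (by linarith))
  set G := Real.log (1 - (r₁ - 2 * δ)^2) - Real.log (1 - (r₂ + 2 * δ)^2)
  set Λ := Real.log (1 - r₁^2) - Real.log (1 - r₂^2)
  set c := hypDrop δ
  set I := ∫ x, annulusPot r₁ r₂ x ∂hypMeasure
  generalize (∫ x, W x * logDefect δ r₁ x ∂hypMeasure) = A1 at *
  generalize (∫ x, W x * logDefect δ r₂ x ∂hypMeasure) = A2 at *
  generalize (∫ x, P x * logDefect δ r₁ x ∂hypMeasure) = B1 at *
  generalize (∫ x, P x * logDefect δ r₂ x ∂hypMeasure) = B2 at *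
  generalize (∫ p, (W p.1 - W p.2)^2 ∂(nearMeasure δ)) = E at *
  clear_value c Q L G Λ I
  have k1 : (ε - 4 * η) * Q ≤ c * μ * L := by
    have l0 : 0 < ε / L := by positivity
    have a1 : (ε / L) * ((ε - 2 * η) * Q) ≤ (ε / L) * (A1 - A2) := mul_le_mul_of_nonneg_left (by linarith) l0.le
    have a2 : (ε / L)^2 * (B1 - B2) ≤ (ε / L)^2 * (L * Q) := mul_le_mul_of_nonneg_left (by linarith) (by positivity)
    have a3 : (ε / L)^2 * (L * Q) = (ε / L) * (ε * Q) := by field_simp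
    have a4 : (ε / L) * ((ε - 4 * η) * Q) ≤ (ε / L) * (c * μ * L) := by
      have : (ε / L) * (c * μ * L) = c * ε * μ := by field_simp
      nlinarith
    exact le_of_mul_le_mul_left a4 l0
  have k2 : c * ((ε - 4 * η) * Λ) ≤ c * (μ * L * G) := by
    have b1 : c * Λ ≤ Q * G := (mul_le_mul_of_nonneg_left hΛ hc.le).trans hcap
    have b2 := mul_le_mul_of_nonneg_left b1 (by linarith : 0 ≤ ε - 4 * η)
    have b3 := mul_le_mul_of_nonneg_right k1 hG
    nlinarith
  exact le_of_mul_le_mul_left k2 hc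

end Capacity

section LevelGap

lemma sq_div_one_sub_sq_lt {a b : ℝ} (ha : 0 ≤ a) (hab : a < b) (hb : b < 1) :
    a^2 / (1 - a^2) < b^2 / (1 - b^2) := by
  have h1 : a^2 < b^2 := by gcongr
  have h2 : b^2 < 1 := by nlinarith
  rw [div_lt_div_iff₀ (by linarith) (by linarith)]
  nlinarith

lemma eq_max_of_symmetric {W : ℂ → ℝ} {ε r mb : ℝ} (hsym : ∀ x y : ℂ, ‖y‖ < 1 → ‖x‖ < ‖y‖ → W y ≤ W x)
    (hmem : ∀ z, W z ∈ Icc 0 ε) (hlow : ∀ s < ε, ENNReal.ofReal mb ≤ hypMeasure {z | s < W z})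
    (hr0 : 0 < r) (hr : r < 1) (h : r^2 / (1 - r^2) ≤ mb) {x : ℂ} (hx : ‖x‖ < r) : W x = ε := by
  refine le_antisymm (hmem x).2 ?_
  by_contra! hlt
  have h1 := hlow _ hlt
  have hsub : {z | W x < W z} ⊆ Metric.closedBall 0 ‖x‖ ∪ (Metric.ball 0 1)ᶜ := by
    intro y hy
    by_contra hc
    simp only [mem_union, mem_closedBall_zero_iff, mem_compl_iff, mem_ball_zero_iff, not_or, not_not, not_le] at hc
    exact absurd (hsym x y hc.2 hc.1) (not_le.mpr hy)
  have h2 := (h1.trans (measure_mono hsub)).trans (measure_union_le _ _)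
  rw [hyp_compl_disk, add_zero, hyp_closedBall (norm_nonneg _) (hx.trans hr)] at h2
  have h3 := sq_div_one_sub_sq_lt (norm_nonneg x) hx hr
  have h4 : 0 < r^2 / (1 - r^2) := by
    have : r^2 < 1 := by nlinarith
    exact div_pos (by positivity) (by linarith)
  exact absurd (h2.trans_lt ((ENNReal.ofReal_lt_ofReal_iff (h4.trans_le h)).mpr (h3.trans_le h))) (lt_irrefl _)

lemma eq_zero_of_symmetric {W : ℂ → ℝ} {ε r ma : ℝ} (hsym : ∀ x y : ℂ, ‖y‖ < 1 → ‖x‖ < ‖y‖ → W y ≤ W x)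
    (hmem : ∀ z, W z ∈ Icc 0 ε) (hup : ∀ s > 0, hypMeasure {z | s < W z} ≤ ENNReal.ofReal ma)
    (hr0 : 0 < r) (h : ma ≤ r^2 / (1 - r^2)) {x : ℂ} (hx : r < ‖x‖) (hx1 : ‖x‖ < 1) : W x = 0 := by
  refine le_antisymm ?_ (hmem x).1
  by_contra! hlt
  have h1 := hup _ (half_pos hlt)
  have hsub : Metric.ball 0 ‖x‖ ⊆ {z | W x / 2 < W z} := by
    intro y hy
    have := hsym y x hx1 (mem_ball_zero_iff.mp hy)
    simp only [Set.mem_ofPred_eq]; linarith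
  have h2 := (measure_mono hsub).trans h1
  rw [hyp_ball (norm_nonneg _) hx1] at h2
  have h3 := sq_div_one_sub_sq_lt hr0.le hx hx1
  have h4 : 0 < r^2 / (1 - r^2) := by
    have : r^2 < 1 := by nlinarith
    exact div_pos (by positivity) (by linarith)
  exact absurd (h2.trans_lt ((ENNReal.ofReal_lt_ofReal_iff (h4.trans h3)).mpr (h.trans_lt h3))) (lt_irrefl _)

theorem level_gap_le {T : ℂ → ℝ} {ε R ma mb r₁ r₂ : ℝ} (hε : 0 < ε) (hR0 : 0 ≤ R) (hR : R < 1)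
    (hmeas : Measurable T) (hmem : ∀ z, T z ∈ Icc 0 ε) (hsupp : ∀ z, T z ≠ 0 → ‖z‖ ≤ R)
    (hT : ∀ η > 0, ∃ t > 0, ∀ x y : ℂ, ‖x‖ < 1 → ‖y‖ < 1 → ‖mob x y‖ ≤ t → |T x - T y| ≤ η)
    (hlow : ∀ s < ε, ENNReal.ofReal mb ≤ hypMeasure {z | s < T z})
    (hup : ∀ s > 0, hypMeasure {z | s < T z} ≤ ENNReal.ofReal ma)
    (hE : ∀ᶠ δ in 𝓝[>] 0, nearEnergy δ T ≤ ENNReal.ofReal (2 * (hypDrop δ * ε * ma)))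
    (hr₁ : 0 < r₁) (h12 : r₁ < r₂) (hr₂ : r₂ < 1) (h1 : r₁^2 / (1 - r₁^2) ≤ mb)
    (h2 : ma ≤ r₂^2 / (1 - r₂^2)) : ε ≤ ma * (Real.log (r₂^2) - Real.log (r₁^2)) := by
  have hma : 0 ≤ ma := by
    by_contra! hc
    have h4 : 0 < r₁^2 / (1 - r₁^2) := by
      have : r₁^2 < 1 := by nlinarith
      exact div_pos (by positivity) (by linarith)
    have := (hlow (ε/2) (by linarith)).trans (hup _ (half_pos hε))
    rw [ENNReal.ofReal_of_nonpos hc.le, nonpos_iff_eq_zero, ENNReal.ofReal_eq_zero] at this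
    linarith
  have hΛ : 0 < Real.log (1 - r₁^2) - Real.log (1 - r₂^2) := by
    have h3 : r₁^2 < r₂^2 := by gcongr
    have h4 : r₂^2 < 1 := by nlinarith
    have := Real.log_lt_log (by linarith : 0 < 1 - r₂^2) (by linarith : 1 - r₂^2 < 1 - r₁^2)
    linarith
  have key : ∀ η > 0, 4 * η ≤ ε → ε - 4 * η ≤ ma * (Real.log (r₂^2) - Real.log (r₁^2)) := by
    intro η hη hηε
    obtain ⟨t, ht, hTt⟩ := hT η hη
    have hev : ∀ᶠ δ in 𝓝[>] (0:ℝ), (ε - 4 * η) * (Real.log (1 - r₁^2) - Real.log (1 - r₂^2)) ≤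
      ma * (Real.log (r₂^2) - Real.log (r₁^2)) *
        (Real.log (1 - (r₁ - 2 * δ)^2) - Real.log (1 - (r₂ + 2 * δ)^2)) := by
      have hd : 0 < min (t) (min (r₁/2) ((1-r₂)/2)) :=
        lt_min ht (lt_min (by linarith) (by linarith))
      filter_upwards [hE, Ioo_mem_nhdsGT hd] with δ hδE hδ
      have hδ0 := hδ.1
      have hδt := hδ.2.trans_le (min_le_left _ _)
      have hδ1 := hδ.2.trans_le ((min_le_right _ _).trans (min_le_left _ _))
      have hδ2 := hδ.2.trans_le ((min_le_right _ _).trans (min_le_right _ _))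
      have hδlt : δ < 1 := by linarith
      have hcomp : Competitor T ε R δ (ENNReal.ofReal ma) (ENNReal.ofReal mb) T :=
        ⟨hmeas, hmem, hsupp, fun _ _ h => h, hlow, hup, le_rfl⟩
      obtain ⟨W, hW, hsym⟩ := exists_symmetric_competitor hε.le hR hT hcomp
      refine capacity_estimate hδ0 (by linarith) h12 (by linarith) hR0 hR hε hηε hW.compBdd
        (fun x hx => eq_max_of_symmetric hsym hW.mem hW.lower hr₁ (h12.trans hr₂) h1 hx)
        (fun x hx hx1 => eq_zero_of_symmetric hsym hW.mem hW.upper (hr₁.trans h12) h2 hx hx1) ?_ ?_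
      · intro x y hx hy hxy
        exact hW.modulus t η hTt x y hx hy (hxy.le.trans hδt.le)
      · have h5 := hW.energy.trans hδE
        rw [← (ofReal_integral_sq_eq_nearEnergy hδ0.le hδlt hR0 hR hW.compBdd).2] at h5
        refine (ENNReal.ofReal_le_ofReal_iff ?_).mp h5
        have := hypDrop_pos hδ0 hδlt
        positivity
    have hlim : Tendsto (fun δ : ℝ => ma * (Real.log (r₂^2) - Real.log (r₁^2)) *
        (Real.log (1 - (r₁ - 2 * δ)^2) - Real.log (1 - (r₂ + 2 * δ)^2))) (𝓝[>] 0)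
        (𝓝 (ma * (Real.log (r₂^2) - Real.log (r₁^2)) * (Real.log (1 - r₁^2) - Real.log (1 - r₂^2)))) := by
      have h3 : 1 - r₁^2 ≠ 0 := by nlinarith
      have h4 : 1 - r₂^2 ≠ 0 := by nlinarith
      have hc : ContinuousAt (fun δ : ℝ => ma * (Real.log (r₂^2) - Real.log (r₁^2)) *
        (Real.log (1 - (r₁ - 2 * δ)^2) - Real.log (1 - (r₂ + 2 * δ)^2))) 0 := by
        refine continuousAt_const.mul (ContinuousAt.sub (ContinuousAt.log (by fun_prop) ?_)
          (ContinuousAt.log (by fun_prop) ?_))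
        · simpa using h3
        · simpa using h4
      have := hc.tendsto.mono_left (nhdsWithin_le_nhds (s := Ioi 0))
      simpa using this
    have := ge_of_tendsto hlim hev
    exact le_of_mul_le_mul_right this hΛ
  refine le_of_forall_pos_le_add fun η hη => ?_
  have := key (min (η/4) (ε/4)) (by positivity) (by linarith [min_le_right (η/4) (ε/4)])
  linarith [min_le_left (η/4) (ε/4)]

end LevelGap

section Density

/-- The weighted density `|f|² (1 - |z|²)`, extended by zero outside the disk. -/
noncomputable def diskDensity (f : ℂ → ℂ) (z : ℂ) : ℝ := if ‖z‖ < 1 then ‖f z‖^2 * (1 - ‖z‖^2) else 0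

variable {f : ℂ → ℂ} {a b δ : ℝ}

lemma diskDensity_of_lt {z : ℂ} (hz : ‖z‖ < 1) : diskDensity f z = ‖f z‖^2 * (1 - ‖z‖^2) := if_pos hz

lemma diskDensity_nonneg (z : ℂ) : 0 ≤ diskDensity f z := by
  unfold diskDensity
  split_ifs with h
  · exact mul_nonneg (by positivity) (by linarith [norm_sq_lt_one h])
  · exact le_rfl

lemma norm_lt_one_of_diskDensity_pos {z : ℂ} (h : 0 < diskDensity f z) : ‖z‖ < 1 := by
  by_contra hc
  simp [diskDensity, hc] at h

lemma log_diskDensity {z : ℂ} (hz : ‖z‖ < 1) (h : f z ≠ 0) :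
    Real.log (diskDensity f z) = 2 * Real.log ‖f z‖ + Real.log (1 - ‖z‖^2) := by
  rw [diskDensity_of_lt hz, Real.log_mul (by positivity) (by linarith [norm_sq_lt_one hz]), Real.log_pow]
  norm_num

lemma exists_radius (hU : Continuous (diskDensity f)) {t : ℝ} (ht : 0 < t) :
    ∃ R, 0 ≤ R ∧ R < 1 ∧ ∀ z, t ≤ diskDensity f z → ‖z‖ ≤ R := by
  by_cases hne : {z | t ≤ diskDensity f z}.Nonempty
  · have hc : IsCompact {z | t ≤ diskDensity f z} := by
      refine (isCompact_closedBall (0:ℂ) 1).of_isClosed_subset (isClosed_le continuous_const hU) fun z hz => ?_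
      exact mem_closedBall_zero_iff.mpr (norm_lt_one_of_diskDensity_pos (ht.trans_le hz)).le
    obtain ⟨z, hz, hmax⟩ := hc.exists_isMaxOn hne continuous_norm.continuousOn
    exact ⟨‖z‖, norm_nonneg _, norm_lt_one_of_diskDensity_pos (ht.trans_le hz), fun y hy => hmax hy⟩
  · exact ⟨0, le_rfl, one_pos, fun z hz => absurd ⟨z, hz⟩ hne⟩

lemma hyp_superlevel_lt_top (hU : Continuous (diskDensity f)) {t : ℝ} (ht : 0 < t) :
    hypMeasure {z | t < diskDensity f z} < ∞ := by
  obtain ⟨R, h0, h1, h⟩ := exists_radius hU ht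
  refine (measure_mono (t := Metric.closedBall 0 R) fun z hz => ?_).trans_lt
    (by rw [hyp_closedBall h0 h1]; exact ENNReal.ofReal_lt_top)
  exact mem_closedBall_zero_iff.mpr (h z (le_of_lt hz))

/-- The positive part of `log U - a`, for the density `U` of `f`. -/
noncomputable def logExcess (f : ℂ → ℂ) (a : ℝ) (z : ℂ) : ℝ :=
  Real.log (max (diskDensity f z) (Real.exp a)) - a

lemma logExcess_nonneg (z : ℂ) : 0 ≤ logExcess f a z := by
  have := Real.log_le_log (Real.exp_pos a) (le_max_right (diskDensity f z) (Real.exp a))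
  rw [Real.log_exp] at this
  unfold logExcess; linarith

lemma continuous_logExcess (hU : Continuous (diskDensity f)) : Continuous (logExcess f a) := by
  unfold logExcess
  refine (Continuous.log (by fun_prop) fun z => ?_).sub continuous_const
  exact (lt_of_lt_of_le (Real.exp_pos a) (le_max_right _ _)).ne'

lemma lt_logExcess_iff {s : ℝ} (hs : 0 ≤ s) (z : ℂ) :
    s < logExcess f a z ↔ Real.exp (a + s) < diskDensity f z := by
  have hpos : 0 < max (diskDensity f z) (Real.exp a) := lt_of_lt_of_le (Real.exp_pos a) (le_max_right _ _)
  have : Real.exp a ≤ Real.exp (a + s) := Real.exp_le_exp.mpr (by linarith)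
  unfold logExcess
  rw [lt_sub_iff_add_lt, Real.lt_log_iff_exp_lt hpos, lt_max_iff, add_comm s a]
  exact ⟨fun h => h.resolve_right (not_lt.mpr this), Or.inl⟩

lemma pos_logExcess_iff (z : ℂ) : 0 < logExcess f a z ↔ Real.exp a < diskDensity f z := by
  simpa using lt_logExcess_iff (f := f) (a := a) le_rfl z

lemma log_sub_le_logExcess {z : ℂ} (h : 0 < diskDensity f z) :
    Real.log (diskDensity f z) - a ≤ logExcess f a z :=
  sub_le_sub_right (Real.log_le_log h (le_max_left _ _)) _

lemma exists_compBdd_logExcess (hU : Continuous (diskDensity f)) (a : ℝ) :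
    ∃ R C, 0 ≤ R ∧ R < 1 ∧ CompBdd R C (logExcess f a) := by
  obtain ⟨R, h0, h1, h⟩ := exists_radius hU (Real.exp_pos a)
  have hs : ∀ z, logExcess f a z ≠ 0 → ‖z‖ ≤ R := fun z hz =>
    h z ((pos_logExcess_iff z).mp (lt_of_le_of_ne (logExcess_nonneg z) hz.symm)).le
  have hc : HasCompactSupport (logExcess f a) :=
    HasCompactSupport.intro (isCompact_closedBall (0:ℂ) R) fun z hz => by
      by_contra hne
      exact hz (mem_closedBall_zero_iff.mpr (hs z hne))
  obtain ⟨C, hC⟩ := hc.exists_bound_of_continuous (continuous_logExcess hU)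
  exact ⟨R, C, h0, h1, (continuous_logExcess hU).measurable, hC, hs⟩

lemma uniform_mob_modulus {g : ℂ → ℝ} {R : ℝ} (hg : Continuous g) (hs : ∀ z, g z ≠ 0 → ‖z‖ ≤ R) {η : ℝ} (hη : 0 < η) :
    ∃ t > 0, ∀ x y : ℂ, ‖x‖ < 1 → ‖y‖ < 1 → ‖mob x y‖ ≤ t → |g x - g y| ≤ η := by
  have hc : HasCompactSupport g :=
    HasCompactSupport.intro (isCompact_closedBall (0:ℂ) R) fun z hz => by
      by_contra hne
      exact hz (mem_closedBall_zero_iff.mpr (hs z hne))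
  have hu := hc.uniformContinuous_of_continuous hg
  obtain ⟨d, hd, h⟩ := Metric.uniformContinuous_iff.mp hu η hη
  refine ⟨d/3, by positivity, fun x y hx hy hxy => ?_⟩
  have h2 := norm_sub_le_two_mul_mob hx hy
  have h3 := h (a := x) (b := y) (by rw [dist_eq_norm]; linarith)
  rw [Real.dist_eq] at h3
  exact h3.le

lemma logExcess_laplace (h0 : 0 ≤ δ) (h1 : δ < 1) (hf : DifferentiableOn ℂ f (Metric.ball 0 1))
    (hU : Continuous (diskDensity f)) {x : ℂ} (hx : Real.exp a < diskDensity f x)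
    (hne : ∀ z ∈ Metric.closedBall (0:ℂ) δ, f (mob x z) ≠ 0) :
    hypMeasure.real (Metric.ball 0 δ) * logExcess f a x - hypAvg δ (logExcess f a) x ≤ hypDrop δ := by
  obtain ⟨R, C, hR0, hR, hw⟩ := exists_compBdd_logExcess hU a
  have hx1 : ‖x‖ < 1 := norm_lt_one_of_diskDensity_pos ((Real.exp_pos a).trans hx)
  have hfx : f x ≠ 0 := by
    have := hne 0 (by simpa using h0)
    rwa [mob_zero_right] at this
  have hwx : logExcess f a x = Real.log (diskDensity f x) - a := by
    rw [logExcess, max_eq_left hx.le]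
  have i1 := integrableOn_log_norm_mob h0 h1 hf hx1 hne
  have i2 := integrableOn_log_one_sub h0 h1 hx1
  have i3 : IntegrableOn (fun _ : ℂ => a) (Metric.ball 0 δ) hypMeasure :=
    integrableOn_const (hyp_ball_lt_top h0 h1).ne
  have e1 := hypAvg_log_norm h0 h1 hf hx1 hne
  have e2 := hypAvg_log_one_sub h0 h1 hx1
  have iw : IntegrableOn (fun ζ => logExcess f a (mob x ζ)) (Metric.ball 0 δ) hypMeasure :=
    IntegrableOn.of_bound (hyp_ball_lt_top h0 h1)
      (hw.meas.comp (measurable_mob x)).aestronglyMeasurable C (ae_of_all _ fun z => hw.bdd _)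
  have hle : ∫ ζ in Metric.ball 0 δ, (2 * Real.log ‖f (mob x ζ)‖ + Real.log (1 - ‖mob x ζ‖^2) - a) ∂hypMeasure ≤
      hypAvg δ (logExcess f a) x := by
    refine setIntegral_mono_on (((i1.const_mul 2).add i2).sub i3) iw measurableSet_ball fun ζ hζ => ?_
    have hζ' := mem_ball_zero_iff.mp hζ
    have hm := norm_mob_lt_one hx1 (hζ'.trans h1)
    have hn := hne ζ (Metric.ball_subset_closedBall hζ)
    rw [← log_diskDensity hm hn]
    refine log_sub_le_logExcess ?_
    rw [diskDensity_of_lt hm]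
    exact mul_pos (by positivity) (by linarith [norm_sq_lt_one hm])
  have e3 : ∫ ζ in Metric.ball 0 δ, (2 * Real.log ‖f (mob x ζ)‖ + Real.log (1 - ‖mob x ζ‖^2) - a) ∂hypMeasure =
      2 * hypAvg δ (fun z => Real.log ‖f z‖) x + hypAvg δ (fun z => Real.log (1 - ‖z‖^2)) x -
        hypMeasure.real (Metric.ball 0 δ) * a := by
    rw [integral_sub (by exact (i1.const_mul 2).add i2) i3, integral_add (by exact i1.const_mul 2) i2,
      integral_const_mul]
    simp [hypAvg, Measure.real]
  rw [e3, e1, e2] at hle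
  rw [hwx, log_diskDensity hx1 hfx]
  linarith

/-- The truncation of `logExcess f a` at height `ε`. -/
noncomputable def truncExcess (f : ℂ → ℂ) (a ε : ℝ) (z : ℂ) : ℝ := min (logExcess f a z) ε

variable {ε : ℝ}

lemma truncExcess_mem (hε : 0 ≤ ε) (z : ℂ) : truncExcess f a ε z ∈ Icc 0 ε :=
  ⟨le_min (logExcess_nonneg z) hε, min_le_right _ _⟩

lemma eventually_ne_zero (hU : Continuous (diskDensity f)) (a : ℝ) :
    ∀ᶠ δ in 𝓝[>] (0:ℝ), ∀ x, Real.exp a < diskDensity f x →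
      ∀ z ∈ Metric.closedBall (0:ℂ) δ, f (mob x z) ≠ 0 := by
  have hc : HasCompactSupport (diskDensity f) :=
    HasCompactSupport.intro (isCompact_closedBall (0:ℂ) 1) fun z hz => by
      rw [mem_closedBall_zero_iff] at hz
      simp [diskDensity, not_lt.mpr (not_le.mp hz).le]
  obtain ⟨d, hd, h⟩ := Metric.uniformContinuous_iff.mp (hc.uniformContinuous_of_continuous hU) _ (Real.exp_pos a)
  filter_upwards [Ioo_mem_nhdsGT (show 0 < min (d/3) 1 by positivity)] with δ hδ x hx z hz hzero
  have hz' : ‖z‖ ≤ δ := mem_closedBall_zero_iff.mp hz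
  have hz1 : ‖z‖ < 1 := hz'.trans_lt (hδ.2.trans_le (min_le_right _ _))
  have hx1 : ‖x‖ < 1 := norm_lt_one_of_diskDensity_pos ((Real.exp_pos a).trans hx)
  have h2 := norm_sub_le_two_mul_mob hx1 (norm_mob_lt_one hx1 hz1)
  rw [mob_mob hx1 hz1] at h2
  have h3 := h (a := x) (b := mob x z) (by
    rw [dist_eq_norm]; linarith [hδ.2.trans_le (min_le_left (d/3) 1)])
  have h4 : diskDensity f (mob x z) = 0 := by
    rw [diskDensity_of_lt (norm_mob_lt_one hx1 hz1), hzero]; simp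
  rw [h4, Real.dist_eq, sub_zero, abs_of_nonneg (diskDensity_nonneg x)] at h3
  linarith

lemma nearEnergy_truncExcess_le (hε : 0 < ε) (hf : DifferentiableOn ℂ f (Metric.ball 0 1))
    (hU : Continuous (diskDensity f)) : ∀ᶠ δ in 𝓝[>] (0:ℝ), nearEnergy δ (truncExcess f a ε) ≤
      ENNReal.ofReal (2 * (hypDrop δ * ε * hypMeasure.real {z | Real.exp a < diskDensity f z})) := by
  filter_upwards [eventually_ne_zero hU a, Ioo_mem_nhdsGT one_pos] with δ hne hδ
  obtain ⟨R, C, hR0, hR, hw⟩ := exists_compBdd_logExcess hU a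
  have h0 := hδ.1
  have h1 := hδ.2
  have hc := hypDrop_pos h0 h1
  have hT : CompBdd R ε (truncExcess f a ε) := by
    refine ⟨hw.meas.min measurable_const, fun z => ?_, fun z hz => hw.supp z fun h => hz ?_⟩
    · rw [abs_of_nonneg (truncExcess_mem hε.le z).1]; exact (truncExcess_mem hε.le z).2
    · rw [truncExcess, h]; exact min_eq_left hε.le
  obtain ⟨i, e⟩ := ofReal_integral_sq_eq_nearEnergy h0.le h1 hR0 hR hT
  rw [← e]
  refine ENNReal.ofReal_le_ofReal ?_
  have iTw := integrable_near_mul_sub h0.le h1 hR0 hR hT hw.meas hw.bdd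
  have hstep : ∫ p, (truncExcess f a ε p.1 - truncExcess f a ε p.2)^2 ∂(nearMeasure δ) ≤
      ∫ p, (truncExcess f a ε p.1 - truncExcess f a ε p.2) * (logExcess f a p.1 - logExcess f a p.2) ∂(nearMeasure δ) := by
    refine integral_mono i iTw fun p => ?_
    simp only [truncExcess]
    rcases le_total (logExcess f a p.1) ε with h | h <;> rcases le_total (logExcess f a p.2) ε with h' | h' <;>
      simp only [h, h', min_eq_left, min_eq_right] <;> nlinarith
  refine hstep.trans ?_
  rw [near_bilin_left h0.le h1 hR0 hR hT hw.meas hw.bdd]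
  refine mul_le_mul_of_nonneg_left ?_ zero_le_two
  have hset : MeasurableSet {z | Real.exp a < diskDensity f z} := measurableSet_lt measurable_const hU.measurable
  have hfin : hypMeasure {z | Real.exp a < diskDensity f z} ≠ ∞ := (hyp_superlevel_lt_top hU (Real.exp_pos a)).ne
  have hb : hypDrop δ * ε * hypMeasure.real {z | Real.exp a < diskDensity f z} =
      ∫ x, {z | Real.exp a < diskDensity f z}.indicator (fun _ => hypDrop δ * ε) x ∂hypMeasure := by
    rw [integral_indicator_const _ hset, smul_eq_mul, mul_comm]
  rw [hb]
  refine integral_mono ?_ ((integrable_indicator_iff hset).mpr (integrableOn_const hfin)) fun x => ?_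
  · refine hT.integrable_mul hR0 hR ((hw.meas.const_mul _).sub (measurable_hypAvg hw.meas))
      (C' := hypMeasure.real (Metric.ball 0 δ) * C + C * hypMeasure.real (Metric.ball 0 δ)) fun x => ?_
    refine (abs_sub _ _).trans (add_le_add ?_ (abs_hypAvg_le h0.le h1 hw.bdd x))
    rw [abs_mul, abs_of_nonneg measureReal_nonneg]
    exact mul_le_mul_of_nonneg_left (hw.bdd x) measureReal_nonneg
  · have hTx := truncExcess_mem (f := f) (a := a) hε.le x
    by_cases hx : Real.exp a < diskDensity f x
    · rw [indicator_of_mem (by exact hx)]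
      have := logExcess_laplace h0.le h1 hf hU hx (hne x hx)
      nlinarith [hTx.1, hTx.2]
    · rw [indicator_of_notMem (by exact hx)]
      have : truncExcess f a ε x = 0 := by
        have h := (pos_logExcess_iff (f := f) (a := a) x).not.mpr hx
        rw [truncExcess, le_antisymm (not_lt.mp h) (logExcess_nonneg x)]
        exact min_eq_left hε.le
      simp [this]

theorem log_gap_le {r₁ r₂ : ℝ} (hf : DifferentiableOn ℂ f (Metric.ball 0 1))
    (hU : Continuous (diskDensity f)) (hab : a < b) (hr₁ : 0 < r₁) (h12 : r₁ < r₂) (hr₂ : r₂ < 1)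
    (h1 : r₁^2 / (1 - r₁^2) ≤ hypMeasure.real {z | Real.exp b < diskDensity f z})
    (h2 : hypMeasure.real {z | Real.exp a < diskDensity f z} ≤ r₂^2 / (1 - r₂^2)) :
    b - a ≤ hypMeasure.real {z | Real.exp a < diskDensity f z} * (Real.log (r₂^2) - Real.log (r₁^2)) := by
  have hε : 0 < b - a := sub_pos.mpr hab
  obtain ⟨R, C, hR0, hR, hw⟩ := exists_compBdd_logExcess hU a
  have hsupp : ∀ z, truncExcess f a (b - a) z ≠ 0 → ‖z‖ ≤ R := fun z hz => hw.supp z fun h => hz (by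
    rw [truncExcess, h]; exact min_eq_left hε.le)
  have hcont : Continuous (truncExcess f a (b - a)) := (continuous_logExcess hU).min continuous_const
  refine level_gap_le hε hR0 hR hcont.measurable (truncExcess_mem hε.le) hsupp
    (fun η hη => uniform_mob_modulus hcont hsupp hη) ?_ ?_ (nearEnergy_truncExcess_le hε hf hU) hr₁ h12 hr₂ h1 h2
  · intro s hs
    rw [ofReal_measureReal (hyp_superlevel_lt_top hU (Real.exp_pos b)).ne]
    refine measure_mono fun z hz => ?_
    have : b - a < logExcess f a z := by
      rw [lt_logExcess_iff hε.le]; simpa using hz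
    exact lt_min (hs.trans this) hs
  · intro s hs
    rw [ofReal_measureReal (hyp_superlevel_lt_top hU (Real.exp_pos a)).ne]
    refine measure_mono fun z hz => ?_
    exact (pos_logExcess_iff z).mp (hs.trans (lt_of_lt_of_le hz (min_le_left _ _)))

end Density

section Distribution

lemma sub_le_of_mul_one_add_sub_le {G l : ℝ → ℝ} {A B : ℝ} (hAB : A ≤ B)
    (h : ∀ a b, A ≤ a → a ≤ b → b ≤ B → (b - a) * (1 + (l b - l a)) ≤ G a - G b) : B - A ≤ G A - G B := by
  have key : ∀ N : ℕ, (B - A) + (B - A) * (l B - l A) * (((N + 1 : ℕ) : ℝ))⁻¹ ≤ G A - G B := by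
    intro N
    have hN : (0:ℝ) < ((N + 1 : ℕ) : ℝ) := by positivity
    generalize hn : N + 1 = n at hN
    obtain ⟨x, hx⟩ : ∃ x : ℕ → ℝ, ∀ i, x i = A + (B - A) * (i / n) := ⟨_, fun i => rfl⟩
    have x0 : x 0 = A := by rw [hx]; simp
    have xn : x n = B := by rw [hx, div_self hN.ne']; ring
    have hs : ∀ i ∈ Finset.range n, (B - A) / n * (1 + (l (x (i+1)) - l (x i))) ≤ G (x i) - G (x (i+1)) := by
      intro i hi
      have hi' : ((i + 1 : ℕ) : ℝ) ≤ n := by exact_mod_cast Finset.mem_range.mp hi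
      have e : x (i+1) - x i = (B - A) / n := by
        rw [hx, hx]; push_cast; field_simp; ring
      have h0 : 0 ≤ (B - A) / n := div_nonneg (by linarith) hN.le
      have h1 : A ≤ x i := by
        rw [hx]; have := mul_nonneg (sub_nonneg.mpr hAB) (div_nonneg (Nat.cast_nonneg i) hN.le); linarith
      have h2 : x (i+1) ≤ B := by
        rw [hx]
        have : ((i + 1 : ℕ) : ℝ) / n ≤ 1 := (div_le_one hN).mpr hi'
        nlinarith
      have := h (x i) (x (i+1)) h1 (by linarith) h2
      rwa [e] at this
    have hsum := Finset.sum_le_sum hs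
    rw [Finset.sum_range_sub' (fun i => G (x i)), ← Finset.mul_sum, Finset.sum_add_distrib,
      Finset.sum_range_sub (fun i => l (x i)), x0, xn] at hsum
    simp only [Finset.sum_const, Finset.card_range, nsmul_eq_mul, mul_one] at hsum
    refine le_trans (le_of_eq ?_) hsum
    field_simp
  have hlim : Tendsto (fun N : ℕ => (B - A) + (B - A) * (l B - l A) * (((N + 1 : ℕ) : ℝ))⁻¹) atTop
      (𝓝 ((B - A) + (B - A) * (l B - l A) * 0)) :=
    ((tendsto_inv_atTop_zero.comp (tendsto_natCast_atTop_atTop.comp (tendsto_add_atTop_nat 1))).const_mul _).const_add _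
  have := le_of_tendsto' hlim key
  linarith

variable {f : ℂ → ℂ} {a b : ℝ}

lemma log_gap_le_log (hf : DifferentiableOn ℂ f (Metric.ball 0 1))
    (hU : Continuous (diskDensity f)) (hab : a < b)
    (hpos : 0 < hypMeasure.real {z | Real.exp b < diskDensity f z}) :
    (b - a) * (1 + (Real.log (hypMeasure.real {z | Real.exp b < diskDensity f z}) -
      Real.log (hypMeasure.real {z | Real.exp a < diskDensity f z}))) ≤
    Real.log (1 + hypMeasure.real {z | Real.exp a < diskDensity f z}) -
      Real.log (1 + hypMeasure.real {z | Real.exp b < diskDensity f z}) := by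
  have hle : hypMeasure.real {z | Real.exp b < diskDensity f z} ≤ hypMeasure.real {z | Real.exp a < diskDensity f z} :=
    measureReal_mono (fun z hz => (Real.exp_lt_exp.mpr hab).trans hz) (hyp_superlevel_lt_top hU (Real.exp_pos a)).ne
  have hgap := fun r₁ r₂ => log_gap_le (r₁ := r₁) (r₂ := r₂) hf hU hab
  generalize hypMeasure.real {z | Real.exp b < diskDensity f z} = y at *
  generalize hypMeasure.real {z | Real.exp a < diskDensity f z} = x at *
  have hx : 0 < x := hpos.trans_le hle
  have hx1 : x / (1 + x) < 1 := (div_lt_one (by linarith)).mpr (by linarith)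
  have hy1 : y / (1 + y) < 1 := (div_lt_one (by linarith)).mpr (by linarith)
  have hy0 : 0 < y / (1 + y) := by positivity
  have hyx : y / (1 + y) ≤ x / (1 + x) := by
    rw [div_le_div_iff₀ (by linarith) (by linarith)]; nlinarith
  have h1 : ∀ᶠ ρ in 𝓝[>] (x / (1 + x)), b - a ≤ x * (Real.log ρ - Real.log (y / (1 + y))) := by
    filter_upwards [Ioo_mem_nhdsGT hx1] with ρ hρ
    have hρ0 : 0 < ρ := hy0.trans_le (hyx.trans hρ.1.le)
    have := hgap (Real.sqrt (y / (1 + y))) (Real.sqrt ρ) (Real.sqrt_pos.mpr hy0)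
      (Real.sqrt_lt_sqrt hy0.le (hyx.trans_lt hρ.1)) (by rw [Real.sqrt_lt' one_pos]; linarith [hρ.2])
    rw [Real.sq_sqrt hy0.le, Real.sq_sqrt hρ0.le] at this
    refine this (le_of_eq ?_) ?_
    · have : 1 + y ≠ 0 := by linarith
      field_simp
      ring
    · have h3 := hρ.1
      rw [div_lt_iff₀ (by linarith)] at h3
      rw [le_div_iff₀ (by linarith [hρ.2])]
      linarith
  have h2 : b - a ≤ x * (Real.log (x / (1 + x)) - Real.log (y / (1 + y))) := by
    have hc : ContinuousAt (fun ρ => x * (Real.log ρ - Real.log (y / (1 + y)))) (x / (1 + x)) :=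
      continuousAt_const.mul ((Real.continuousAt_log (by positivity)).sub continuousAt_const)
    exact ge_of_tendsto (hc.tendsto.mono_left nhdsWithin_le_nhds) h1
  -- convexity: `y (L x - L y) ≤ log (1 + x) - log (1 + y)` with `L m = log (m / (1 + m))`
  have h3 : y * (Real.log (x / (1 + x)) - Real.log (y / (1 + y))) ≤ Real.log (1 + x) - Real.log (1 + y) := by
    have hq : Real.log (x / (1 + x)) - Real.log (y / (1 + y)) =
        (Real.log x - Real.log y) - (Real.log (1 + x) - Real.log (1 + y)) := by
      rw [Real.log_div hx.ne' (by linarith), Real.log_div hpos.ne' (by linarith)]; ring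
    rw [hq]
    have hconc := strictConcaveOn_log_Ioi.concaveOn.2 (mem_Ioi.mpr one_pos) (mem_Ioi.mpr (div_pos hx hpos))
      (by positivity : 0 ≤ 1 / (1 + y)) (by positivity : 0 ≤ y / (1 + y)) (by field_simp)
    have hy1' : 1 + y ≠ 0 := by linarith
    have he : 1 / (1 + y) * 1 + y / (1 + y) * (x / y) = (1 + x) / (1 + y) := by field_simp
    simp only [smul_eq_mul, Real.log_one, mul_zero, zero_add] at hconc
    rw [he, Real.log_div (by linarith) hy1', Real.log_div hx.ne' hpos.ne', div_mul_eq_mul_div,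
      div_le_iff₀ (by linarith)] at hconc
    linarith
  have h4 : 1 + (Real.log y - Real.log x) ≤ y / x := by
    have := Real.log_le_sub_one_of_pos (div_pos hpos hx)
    rw [Real.log_div hpos.ne' hx.ne'] at this
    linarith
  calc (b - a) * (1 + (Real.log y - Real.log x)) ≤ (b - a) * (y / x) :=
        mul_le_mul_of_nonneg_left h4 (by linarith)
    _ ≤ x * (Real.log (x / (1 + x)) - Real.log (y / (1 + y))) * (y / x) :=
        mul_le_mul_of_nonneg_right h2 (by positivity)
    _ = y * (Real.log (x / (1 + x)) - Real.log (y / (1 + y))) := by field_simp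
    _ ≤ _ := h3

theorem mul_one_add_superlevel_le (hf : DifferentiableOn ℂ f (Metric.ball 0 1))
    (hU : Continuous (diskDensity f)) {s t : ℝ} (ht : 0 < t) (hts : t ≤ s)
    (hpos : 0 < hypMeasure.real {z | s < diskDensity f z}) :
    s * (1 + hypMeasure.real {z | s < diskDensity f z}) ≤ t * (1 + hypMeasure.real {z | t < diskDensity f z}) := by
  have hs := ht.trans_le hts
  have h := sub_le_of_mul_one_add_sub_le (A := Real.log t) (B := Real.log s)
    (G := fun a => Real.log (1 + hypMeasure.real {z | Real.exp a < diskDensity f z}))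
    (l := fun a => Real.log (hypMeasure.real {z | Real.exp a < diskDensity f z})) (Real.log_le_log ht hts) ?_
  · simp only [Real.exp_log ht, Real.exp_log hs] at h
    have h1 : 0 < 1 + hypMeasure.real {z | s < diskDensity f z} := by positivity
    have h2 : 0 < 1 + hypMeasure.real {z | t < diskDensity f z} := by positivity
    rw [← Real.log_le_log_iff (mul_pos hs h1) (mul_pos ht h2), Real.log_mul hs.ne' h1.ne', Real.log_mul ht.ne' h2.ne']
    linarith
  · intro a b _ hab hb
    rcases hab.eq_or_lt with rfl | hab
    · simp
    refine log_gap_le_log hf hU hab (hpos.trans_le ?_)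
    refine measureReal_mono (fun z hz => ?_) (hyp_superlevel_lt_top hU (Real.exp_pos b)).ne
    refine lt_of_le_of_lt (b := s) ?_ hz
    rw [← Real.exp_log hs]
    exact Real.exp_le_exp.mpr hb

end Distribution

section Coefficients

/-- The quadratic mean of `f` over the circle of radius `r`. -/
noncomputable def circleMeanSq (f : ℂ → ℂ) (r : ℝ) : ℝ :=
  (2*Real.pi)⁻¹ * ∫ φ in Ioc (-Real.pi) Real.pi, ‖f ((r : ℂ) * Complex.exp (Complex.I * (φ:ℂ)))‖^2

variable {f : ℂ → ℂ} {a : ℕ → ℂ}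

lemma exists_coefficients (hf : DifferentiableOn ℂ f (Metric.ball 0 1)) :
    ∃ a : ℕ → ℂ, ∀ z : ℂ, ‖z‖ < 1 → HasSum (fun n => a n * z^n) (f z) := by
  refine ⟨fun n => ((n.factorial : ℂ))⁻¹ * iteratedDeriv n f 0, fun z hz => ?_⟩
  have := Complex.hasSum_taylorSeries_on_ball (c := 0) (r := 1) hf (by simpa using hz : z ∈ Metric.ball (0:ℂ) 1)
  refine this.congr_fun ?_
  intro n
  simp only [sub_zero, smul_eq_mul]
  ring

lemma integral_exp_int (k : ℤ) : ∫ φ in Ioc (-Real.pi) Real.pi, Complex.exp (Complex.I * (k * (φ:ℂ))) =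
    if k = 0 then (2 * Real.pi : ℂ) else 0 := by
  rw [← intervalIntegral.integral_of_le (by linarith [Real.pi_pos])]
  split_ifs with h
  · subst h
    simp
    ring
  · have hc : Complex.I * (k:ℂ) ≠ 0 := mul_ne_zero Complex.I_ne_zero (by exact_mod_cast h)
    have := integral_exp_mul_complex (a := -Real.pi) (b := Real.pi) hc
    simp only [mul_assoc] at this
    rw [this]
    have : Complex.exp (Complex.I * (k * ((Real.pi : ℝ):ℂ))) = Complex.exp (Complex.I * (k * ((-Real.pi : ℝ) : ℂ))) := by
      rw [Complex.exp_eq_exp_iff_exists_int]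
      exact ⟨k, by push_cast; ring⟩
    rw [this]; simp

lemma hasSum_circleMeanSq (h : ∀ z : ℂ, ‖z‖ < 1 → HasSum (fun n => a n * z^n) (f z)) {r : ℝ} (h0 : 0 ≤ r)
    (h1 : r < 1) : HasSum (fun n => ‖a n‖^2 * (r^2)^n) (circleMeanSq f r) := by
  have hr : ‖(r:ℂ)‖ < 1 := by simpa [abs_of_nonneg h0] using h1
  have hs : Summable fun n => ‖a n * (r:ℂ)^n‖ := summable_norm_iff.mpr (h r hr).summable
  have hexp : ∀ φ : ℝ, ‖Complex.exp (Complex.I * (φ:ℂ))‖ = 1 := fun φ => by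
    rw [mul_comm]; exact Complex.norm_exp_ofReal_mul_I φ
  have hz : ∀ φ : ℝ, ‖(r:ℂ) * Complex.exp (Complex.I * (φ:ℂ))‖ < 1 := fun φ => by rw [norm_mul, hexp, mul_one]; exact hr
  obtain ⟨F, hF⟩ : ∃ F : ℕ × ℕ → ℝ → ℂ, ∀ p φ, F p φ = (a p.1 * ((r:ℂ) * Complex.exp (Complex.I * (φ:ℂ)))^p.1) *
      conj (a p.2 * ((r:ℂ) * Complex.exp (Complex.I * (φ:ℂ)))^p.2) := ⟨_, fun _ _ => rfl⟩
  have hnorm : ∀ p φ, ‖F p φ‖ = ‖a p.1 * (r:ℂ)^p.1‖ * ‖a p.2 * (r:ℂ)^p.2‖ := by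
    intro p φ
    rw [hF, norm_mul, Complex.norm_conj]
    simp only [norm_mul, norm_pow, hexp, mul_one]
  have hcont : ∀ p, Continuous (F p) := fun p => by
    have : F p = fun φ => _ := funext (hF p)
    rw [this]; fun_prop
  have hsp : Summable fun p : ℕ × ℕ => ‖a p.1 * (r:ℂ)^p.1‖ * ‖a p.2 * (r:ℂ)^p.2‖ :=
    hs.mul_of_nonneg hs (fun _ => norm_nonneg _) (fun _ => norm_nonneg _)
  have hsum : ∀ φ : ℝ, HasSum (fun p => F p φ) ((‖f ((r:ℂ) * Complex.exp (Complex.I * (φ:ℂ)))‖^2 : ℝ) : ℂ) := by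
    intro φ
    have e1 := h _ (hz φ)
    have e2 := Complex.hasSum_conj'.mpr e1 
    have e3 := HasSum.mul e1 e2 ?_
    · rw [Complex.mul_conj'] at e3
      push_cast
      exact e3.congr_fun fun p => hF p φ
    · refine Summable.of_norm (hsp.congr fun p => ?_)
      rw [← hnorm p φ, hF]
  have hintg := hasSum_integral_of_summable_integral_norm (μ := volume.restrict (Ioc (-Real.pi) Real.pi)) (F := F)
    (fun p => (hcont p).integrableOn_Ioc) ?_
  · have hval : ∀ p, ∫ φ in Ioc (-Real.pi) Real.pi, F p φ =
        if p.1 = p.2 then (2 * Real.pi : ℂ) * ((‖a p.1‖^2 * (r^2)^p.1 : ℝ) : ℂ) else 0 := by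
      intro p
      have : ∀ φ : ℝ, F p φ = (a p.1 * conj (a p.2) * (r:ℂ)^(p.1 + p.2)) *
          Complex.exp (Complex.I * (((p.1 - p.2 : ℤ) : ℂ) * (φ:ℂ))) := by
        intro φ
        rw [hF]
        have e : Complex.exp (Complex.I * (((p.1 - p.2 : ℤ) : ℂ) * (φ:ℂ))) =
            Complex.exp (Complex.I * φ)^p.1 * conj (Complex.exp (Complex.I * φ))^p.2 := by
          rw [← Complex.exp_conj, ← Complex.exp_nat_mul, ← Complex.exp_nat_mul, ← Complex.exp_add]
          congr 1
          simp
          ring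
        rw [e]
        simp only [map_mul, map_pow, Complex.conj_ofReal]
        ring
      simp_rw [this]
      rw [integral_const_mul, integral_exp_int]
      rcases p with ⟨m, n⟩
      by_cases hmn : m = n
      · subst hmn
        simp [Complex.mul_conj']
        ring
      · have : (m:ℤ) - n ≠ 0 := by omega
        simp [hmn, this]
    have hinj : Function.Injective (fun n : ℕ => (n, n)) := fun m n h => (Prod.mk.inj h).1
    have hd := (hinj.hasSum_iff ?_).mpr hintg
    · have e : (∫ φ in Ioc (-Real.pi) Real.pi, ∑' p, F p φ) =
          ((∫ φ in Ioc (-Real.pi) Real.pi, ‖f ((r:ℂ) * Complex.exp (Complex.I * (φ:ℂ)))‖^2 : ℝ) : ℂ) := by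
        rw [← integral_complex_ofReal]
        exact integral_congr_ae (ae_of_all _ fun φ => (hsum φ).tsum_eq)
      rw [e] at hd
      have hd2 := hd.mul_left ((2 * Real.pi : ℂ))⁻¹
      have hpi : (2 * Real.pi : ℂ) ≠ 0 := by exact_mod_cast (by positivity : (2 * Real.pi) ≠ 0)
      rw [← Complex.hasSum_ofReal]
      have e2 : ((circleMeanSq f r : ℝ) : ℂ) = (2 * Real.pi : ℂ)⁻¹ *
          ((∫ φ in Ioc (-Real.pi) Real.pi, ‖f ((r:ℂ) * Complex.exp (Complex.I * (φ:ℂ)))‖^2 : ℝ) : ℂ) := by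
        rw [circleMeanSq]; push_cast; rfl
      rw [e2]
      refine hd2.congr_fun fun n => ?_
      rw [Function.comp_apply, hval, if_pos rfl, inv_mul_cancel_left₀ hpi]
    · intro p hp
      rw [hval, if_neg]
      intro he
      exact hp ⟨p.1, Prod.ext rfl he⟩
  · simp_rw [hnorm]
    simp only [integral_const]
    exact hsp.mul_left _

end Coefficients

section Hardy

variable {f : ℂ → ℂ} {a : ℕ → ℂ} {S : ℝ}

lemma hasSum_geometric_norm_sq {z : ℂ} (hz : ‖z‖ < 1) : HasSum (fun n : ℕ => ‖conj z^n‖^2) (1 - ‖z‖^2)⁻¹ := by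
  have h1 := norm_sq_lt_one hz
  refine (hasSum_geometric_of_lt_one (by positivity) h1).congr_fun fun n => ?_
  rw [norm_pow, Complex.norm_conj]; ring

lemma hasSum_sq_sub_kernel {z F : ℂ} (hz : ‖z‖ < 1) (hF : HasSum (fun n => a n * z^n) F)
    (hS : HasSum (fun n => ‖a n‖^2) S) :
    HasSum (fun n => ‖a n - F * ((1 - ‖z‖^2 : ℝ) : ℂ) * conj z^n‖^2) (S - ‖F‖^2 * (1 - ‖z‖^2)) := by
  have h1 : 1 - ‖z‖^2 ≠ 0 := by linarith [norm_sq_lt_one hz]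
  have e1 := (Complex.hasSum_re (hF.mul_left (conj (F * ((1 - ‖z‖^2 : ℝ) : ℂ))))).mul_left 2
  have e2 := (hasSum_geometric_norm_sq hz).mul_left (‖F * ((1 - ‖z‖^2 : ℝ) : ℂ)‖^2)
  have e3 := (hS.sub e1).add e2
  have e4 : (conj (F * ((1 - ‖z‖^2 : ℝ) : ℂ)) * F).re = ‖F‖^2 * (1 - ‖z‖^2) := by
    rw [map_mul, Complex.conj_ofReal, mul_right_comm, Complex.conj_mul', ← Complex.ofReal_pow, ← Complex.ofReal_mul,
      Complex.ofReal_re]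
  have e5 : S - 2 * (conj (F * ((1 - ‖z‖^2 : ℝ) : ℂ)) * F).re + ‖F * ((1 - ‖z‖^2 : ℝ) : ℂ)‖^2 * (1 - ‖z‖^2)⁻¹ =
      S - ‖F‖^2 * (1 - ‖z‖^2) := by
    rw [e4, norm_mul, Complex.norm_real, Real.norm_eq_abs, mul_pow, sq_abs]
    field_simp
    ring
  rw [e5] at e3
  refine e3.congr_fun fun n => ?_
  rw [← Complex.normSq_eq_norm_sq, Complex.normSq_sub]
  simp only [Complex.normSq_eq_norm_sq, norm_mul, norm_pow, map_mul, map_pow, Complex.conj_conj, Complex.conj_ofReal]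
  have : (a n * (conj F * ((1 - ‖z‖^2 : ℝ) : ℂ) * z^n)).re =
      (conj F * ((1 - ‖z‖^2 : ℝ) : ℂ) * (a n * z^n)).re := by congr 1; ring
  rw [this]
  ring

lemma norm_sq_mul_le {z F : ℂ} (hz : ‖z‖ < 1) (hF : HasSum (fun n => a n * z^n) F)
    (hS : HasSum (fun n => ‖a n‖^2) S) : ‖F‖^2 * (1 - ‖z‖^2) ≤ S := by
  have := (hasSum_sq_sub_kernel hz hF hS).nonneg fun n => by positivity
  linarith

lemma exists_diskDensity_le (h : ∀ z : ℂ, ‖z‖ < 1 → HasSum (fun n => a n * z^n) (f z))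
    (hS : HasSum (fun n => ‖a n‖^2) S) {ε : ℝ} (hε : 0 < ε) :
    ∃ C, 0 ≤ C ∧ ∀ z : ℂ, ‖z‖ < 1 → diskDensity f z ≤ C * (1 - ‖z‖^2) + ε := by
  obtain ⟨N, hN⟩ : ∃ N, S - ∑ n ∈ Finset.range N, ‖a n‖^2 < ε / 2 := by
    have := (hS.tendsto_sum_nat.const_sub S)
    rw [sub_self] at this
    exact (this.eventually (gt_mem_nhds (half_pos hε))).exists
  obtain ⟨c, hc⟩ : ∃ c : ℕ → ℂ, ∀ n, c n = if n ∈ Finset.range N then 0 else a n := ⟨_, fun _ => rfl⟩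
  obtain ⟨p, hp⟩ : ∃ p : ℕ → ℂ, ∀ n, p n = if n ∈ Finset.range N then a n else 0 := ⟨_, fun _ => rfl⟩
  refine ⟨2 * (∑ n ∈ Finset.range N, ‖a n‖)^2, by positivity, fun z hz => ?_⟩
  have hP : HasSum (fun n => p n * z^n) (∑ n ∈ Finset.range N, p n * z^n) :=
    hasSum_sum_of_ne_finset_zero fun n hn => by rw [hp, if_neg hn, zero_mul]
  have hC : HasSum (fun n => c n * z^n) (f z - ∑ n ∈ Finset.range N, p n * z^n) := by
    refine ((h z hz).sub hP).congr_fun fun n => ?_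
    rw [hc, hp]; split_ifs <;> ring
  have hpS : HasSum (fun n => ‖p n‖^2) (∑ n ∈ Finset.range N, ‖p n‖^2) :=
    hasSum_sum_of_ne_finset_zero fun n hn => by rw [hp, if_neg hn]; simp
  have hcS : HasSum (fun n => ‖c n‖^2) (S - ∑ n ∈ Finset.range N, ‖p n‖^2) := by
    refine (hS.sub hpS).congr_fun fun n => ?_
    rw [hc, hp]; split_ifs <;> simp
  have e : ∑ n ∈ Finset.range N, ‖p n‖^2 = ∑ n ∈ Finset.range N, ‖a n‖^2 :=
    Finset.sum_congr rfl fun n hn => by rw [hp, if_pos hn]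
  have b1 := norm_sq_mul_le hz hC hcS
  rw [e] at b1
  have b2 : ‖∑ n ∈ Finset.range N, p n * z^n‖ ≤ ∑ n ∈ Finset.range N, ‖a n‖ := by
    refine norm_sum_le_of_le _ fun n hn => ?_
    rw [hp, if_pos hn, norm_mul, norm_pow]
    exact mul_le_of_le_one_right (norm_nonneg _) (pow_le_one₀ (norm_nonneg _) hz.le)
  have hz2 : 0 ≤ 1 - ‖z‖^2 := by linarith [norm_sq_lt_one hz]
  rw [diskDensity_of_lt hz]
  have b3 : ‖f z‖ ≤ ‖f z - ∑ n ∈ Finset.range N, p n * z^n‖ + ‖∑ n ∈ Finset.range N, p n * z^n‖ := by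
    simpa using norm_add_le (f z - ∑ n ∈ Finset.range N, p n * z^n) (∑ n ∈ Finset.range N, p n * z^n)
  have hn := norm_nonneg (f z)
  have hn1 := norm_nonneg (f z - ∑ n ∈ Finset.range N, p n * z^n)
  have hn2 := norm_nonneg (∑ n ∈ Finset.range N, p n * z^n)
  generalize ‖f z - ∑ n ∈ Finset.range N, p n * z^n‖ = A at *
  generalize ‖∑ n ∈ Finset.range N, p n * z^n‖ = B at *
  generalize ∑ n ∈ Finset.range N, ‖a n‖ = D at *
  have b4 : ‖f z‖^2 ≤ 2 * A^2 + 2 * D^2 := by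
    nlinarith [sq_nonneg (A - B), mul_self_le_mul_self hn b3, mul_self_le_mul_self hn2 b2]
  nlinarith [mul_le_mul_of_nonneg_right b4 hz2]

theorem continuous_diskDensity (hf : DifferentiableOn ℂ f (Metric.ball 0 1))
    (h : ∀ z : ℂ, ‖z‖ < 1 → HasSum (fun n => a n * z^n) (f z))
    (hS : HasSum (fun n => ‖a n‖^2) S) : Continuous (diskDensity f) := by
  refine continuous_iff_continuousAt.mpr fun z => ?_
  by_cases hz : ‖z‖ < 1
  · have hmem : Metric.ball (0:ℂ) 1 ∈ 𝓝 z := Metric.isOpen_ball.mem_nhds (by simpa using hz)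
    have hc : ContinuousAt (fun z => ‖f z‖^2 * (1 - ‖z‖^2)) z :=
      ((hf.continuousOn.continuousAt hmem).norm.pow 2).mul (by fun_prop)
    refine hc.congr (Filter.eventually_of_mem hmem fun y hy => ?_)
    exact (diskDensity_of_lt (by simpa using hy)).symm
  · have h0 : diskDensity f z = 0 := if_neg hz
    rw [ContinuousAt, h0, Metric.tendsto_nhds]
    intro ε hε
    obtain ⟨C, hC0, hC⟩ := exists_diskDensity_le h hS (half_pos hε)
    have hlim : Tendsto (fun y : ℂ => C * max 0 (1 - ‖y‖^2)) (𝓝 z) (𝓝 0) := by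
      have hcc : Continuous fun y : ℂ => C * max 0 (1 - ‖y‖^2) := by fun_prop
      have := hcc.tendsto z
      rwa [max_eq_left (by nlinarith [not_lt.mp hz]), mul_zero] at this
    filter_upwards [hlim.eventually (gt_mem_nhds (half_pos hε))] with y hy
    rw [Real.dist_eq, sub_zero, abs_of_nonneg (diskDensity_nonneg y)]
    by_cases hy1 : ‖y‖ < 1
    · have h2 := hC y hy1
      rw [max_eq_right (by linarith [norm_sq_lt_one hy1])] at hy
      linarith
    · rw [diskDensity, if_neg hy1]; exact hε

lemma mem_hardyOpt_of_diskDensity_eq_one (h : ∀ z : ℂ, ‖z‖ < 1 → HasSum (fun n => a n * z^n) (f z))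
    (hS : HasSum (fun n => ‖a n‖^2) 1) {w : ℂ} (hw : ‖w‖ < 1) (hU : diskDensity f w = 1) : f ∈ hardyOpt := by
  rw [diskDensity_of_lt hw] at hU
  have hw0 : 0 < 1 - ‖w‖^2 := by linarith [norm_sq_lt_one hw]
  have hs := hasSum_sq_sub_kernel hw (h w hw) hS
  rw [hU, sub_self] at hs
  have ha : ∀ n, a n = f w * ((1 - ‖w‖^2 : ℝ) : ℂ) * conj w^n := fun n => by
    have := (hasSum_zero_iff_of_nonneg fun n => by positivity).mp hs
    have := congrFun this n
    simpa [sub_eq_zero] using this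
  have hnorm : ‖f w * ((1 - ‖w‖^2 : ℝ) : ℂ)‖ = Real.sqrt (1 - ‖w‖^2) := by
    rw [eq_comm, Real.sqrt_eq_iff_mul_self_eq hw0.le (norm_nonneg _), norm_mul, Complex.norm_real, Real.norm_eq_abs,
      abs_of_pos hw0]
    linear_combination -(1 - ‖w‖^2) * hU
  refine ⟨w, Complex.arg (f w * ((1 - ‖w‖^2 : ℝ) : ℂ)), hw, fun z hz => ?_⟩
  have hz' : ‖z‖ < 1 := by simpa using hz
  have e := Complex.norm_mul_exp_arg_mul_I (f w * ((1 - ‖w‖^2 : ℝ) : ℂ))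
  rw [hnorm] at e
  have hlt : ‖conj w * z‖ < 1 := by
    rw [norm_mul, Complex.norm_conj]; nlinarith [norm_nonneg w, norm_nonneg z]
  have hg := (hasSum_geometric_of_norm_lt_one hlt).mul_left (f w * ((1 - ‖w‖^2 : ℝ) : ℂ))
  have := (h z hz').unique (hg.congr_fun fun n => by rw [ha]; ring)
  rw [this, mul_comm Complex.I, mul_comm (Complex.exp _), e]

lemma circleMeanSq_le_one (hb : BddAbove (range fun r : Ioo (0:ℝ) 1 => circleMeanSq f r))
    (hn : hardyNormSq f = 1) {r : ℝ} (h0 : 0 < r) (h1 : r < 1) : circleMeanSq f r ≤ 1 := by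
  rw [← hn]
  exact le_ciSup hb (⟨r, h0, h1⟩ : Ioo (0:ℝ) 1)

lemma hasSum_norm_sq_of_hardyNormSq (h : ∀ z : ℂ, ‖z‖ < 1 → HasSum (fun n => a n * z^n) (f z))
    (hb : BddAbove (range fun r : Ioo (0:ℝ) 1 => circleMeanSq f r)) (hn : hardyNormSq f = 1) :
    HasSum (fun n => ‖a n‖^2) 1 := by
  have hpart : ∀ s : Finset ℕ, ∑ n ∈ s, ‖a n‖^2 ≤ 1 := by
    intro s
    have hlim : Tendsto (fun r : ℝ => ∑ n ∈ s, ‖a n‖^2 * (r^2)^n) (𝓝[<] 1) (𝓝 (∑ n ∈ s, ‖a n‖^2 * ((1:ℝ)^2)^n)) :=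
      (Continuous.tendsto (by fun_prop) 1).mono_left nhdsWithin_le_nhds
    simp only [one_pow, mul_one] at hlim
    refine le_of_tendsto hlim ?_
    filter_upwards [Ioo_mem_nhdsLT one_pos] with r hr
    exact (sum_le_hasSum s (fun n _ => by positivity) (hasSum_circleMeanSq h hr.1.le hr.2)).trans
      (circleMeanSq_le_one hb hn hr.1 hr.2)
  have hsum : Summable fun n => ‖a n‖^2 := summable_of_sum_le (fun n => by positivity) hpart
  have hle : ∑' n, ‖a n‖^2 ≤ 1 := hsum.tsum_le_of_sum_le hpart
  have hge : 1 ≤ ∑' n, ‖a n‖^2 := by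
    rw [← hn]
    have : Nonempty (Ioo (0:ℝ) 1) := ⟨⟨1/2, by norm_num⟩⟩
    refine ciSup_le fun r => ?_
    refine (hasSum_le (fun n => ?_) (hasSum_circleMeanSq h r.2.1.le r.2.2) hsum.hasSum)
    exact mul_le_of_le_one_right (by positivity) (pow_le_one₀ (by positivity) (pow_le_one₀ r.2.1.le r.2.2.le))
  rw [← le_antisymm hle hge]
  exact hsum.hasSum

/-- The normalized reproducing kernel at `w`, up to a unimodular constant. -/
lemma exists_kernel_form (hf : f ∈ hardyOpt) : ∃ w c : ℂ, ‖w‖ < 1 ∧ ‖c‖^2 = 1 - ‖w‖^2 ∧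
    ∀ z : ℂ, ‖z‖ < 1 → f z = c * (1 - conj w * z)⁻¹ := by
  obtain ⟨w, θ, hw, h⟩ := hf
  refine ⟨w, Complex.exp (Complex.I * (θ:ℂ)) * ((Real.sqrt (1 - ‖w‖^2) : ℝ) : ℂ), hw, ?_,
    fun z hz => h z (by simpa using hz)⟩
  rw [norm_mul, mul_comm Complex.I, Complex.norm_exp_ofReal_mul_I, Complex.norm_real, Real.norm_eq_abs, one_mul, sq_abs,
    Real.sq_sqrt (by linarith [norm_sq_lt_one hw])]

variable {w c : ℂ}

lemma differentiableOn_kernel (hw : ‖w‖ < 1) (h : ∀ z : ℂ, ‖z‖ < 1 → f z = c * (1 - conj w * z)⁻¹) :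
    DifferentiableOn ℂ f (Metric.ball 0 1) := by
  have : DifferentiableOn ℂ (fun z => c * (1 - conj w * z)⁻¹) (Metric.ball 0 1) := by
    refine (DifferentiableOn.inv (by fun_prop) fun z hz => ?_).const_mul c
    exact one_sub_conj_mul_ne_zero hw (by simpa using hz)
  exact this.congr fun z hz => h z (by simpa using hz)

lemma circleMeanSq_kernel (hw : ‖w‖ < 1) (hc : ‖c‖^2 = 1 - ‖w‖^2)
    (h : ∀ z : ℂ, ‖z‖ < 1 → f z = c * (1 - conj w * z)⁻¹) {r : ℝ} (h0 : 0 ≤ r) (h1 : r < 1) :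
    circleMeanSq f r = (1 - ‖w‖^2) * (1 - ‖w‖^2 * r^2)⁻¹ := by
  have hs : ∀ z : ℂ, ‖z‖ < 1 → HasSum (fun n => (c * conj w^n) * z^n) (f z) := by
    intro z hz
    have hlt : ‖conj w * z‖ < 1 := by
      rw [norm_mul, Complex.norm_conj]; nlinarith [norm_nonneg w, norm_nonneg z]
    rw [h z hz]
    exact ((hasSum_geometric_of_norm_lt_one hlt).mul_left c).congr_fun fun n => by ring
  have hlt : ‖w‖^2 * r^2 < 1 := by
    have h2 := norm_sq_lt_one hw
    have h3 : r^2 < 1 := by nlinarith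
    nlinarith [sq_nonneg ‖w‖, sq_nonneg r]
  refine (hasSum_circleMeanSq hs h0 h1).unique
    (((hasSum_geometric_of_lt_one (by positivity) hlt).mul_left (1 - ‖w‖^2)).congr_fun fun n => ?_)
  rw [norm_mul, norm_pow, Complex.norm_conj, mul_pow, hc]
  ring

lemma circleMeanSq_kernel_le_one (hw : ‖w‖ < 1) (hc : ‖c‖^2 = 1 - ‖w‖^2)
    (h : ∀ z : ℂ, ‖z‖ < 1 → f z = c * (1 - conj w * z)⁻¹) {r : ℝ} (h0 : 0 ≤ r) (h1 : r < 1) :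
    circleMeanSq f r ≤ 1 := by
  rw [circleMeanSq_kernel hw hc h h0 h1]
  have h2 := norm_sq_lt_one hw
  have h3 : r^2 < 1 := by nlinarith
  have h4 : ‖w‖^2 * r^2 ≤ ‖w‖^2 := mul_le_of_le_one_right (by positivity) h3.le
  rw [← div_eq_mul_inv, div_le_one (by linarith)]
  linarith

lemma hardyNormSq_kernel (hw : ‖w‖ < 1) (hc : ‖c‖^2 = 1 - ‖w‖^2)
    (h : ∀ z : ℂ, ‖z‖ < 1 → f z = c * (1 - conj w * z)⁻¹) :
    BddAbove (range fun r : Ioo (0:ℝ) 1 => circleMeanSq f r) ∧ hardyNormSq f = 1 := by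
  have hb : BddAbove (range fun r : Ioo (0:ℝ) 1 => circleMeanSq f r) :=
    ⟨1, by rintro _ ⟨r, rfl⟩; exact circleMeanSq_kernel_le_one hw hc h r.2.1.le r.2.2⟩
  have : Nonempty (Ioo (0:ℝ) 1) := ⟨⟨1/2, by norm_num⟩⟩
  refine ⟨hb, le_antisymm (ciSup_le fun r => circleMeanSq_kernel_le_one hw hc h r.2.1.le r.2.2) ?_⟩
  have h2 := norm_sq_lt_one hw
  have hlim : Tendsto (fun r : ℝ => (1 - ‖w‖^2) * (1 - ‖w‖^2 * r^2)⁻¹) (𝓝[<] 1) (𝓝 1) := by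
    have hcont : ContinuousAt (fun r : ℝ => (1 - ‖w‖^2) * (1 - ‖w‖^2 * r^2)⁻¹) 1 :=
      continuousAt_const.mul (ContinuousAt.inv₀ (by fun_prop) (by linarith))
    have := hcont.tendsto.mono_left (nhdsWithin_le_nhds (s := Iio 1))
    simpa [mul_inv_cancel₀ (by linarith : 1 - ‖w‖^2 ≠ 0)] using this
  refine le_of_tendsto hlim ?_
  filter_upwards [Ioo_mem_nhdsLT one_pos] with r hr
  rw [← circleMeanSq_kernel hw hc h hr.1.le hr.2]
  exact le_ciSup hb (⟨r, hr⟩ : Ioo (0:ℝ) 1)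

lemma diskDensity_kernel (hw : ‖w‖ < 1) (hc : ‖c‖^2 = 1 - ‖w‖^2)
    (h : ∀ z : ℂ, ‖z‖ < 1 → f z = c * (1 - conj w * z)⁻¹) {z : ℂ} (hz : ‖z‖ < 1) :
    diskDensity f z = 1 - ‖mob w z‖^2 := by
  rw [diskDensity_of_lt hz, one_sub_norm_sq_mob hw hz, h z hz, norm_mul, norm_inv, mul_pow, hc]
  field_simp

end Hardy

section Dilation

lemma lintegral_radial_superlevel_le {t K : ℝ} (ht : 0 < t) (hK : 0 < K) {P : ℝ → Prop}
    (hP : ∀ τ ∈ Ioo (0:ℝ) 1, P τ → t < K * (1 - τ)) :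
    ∫⁻ τ in Ioo (0:ℝ) 1, ENNReal.ofReal ((1 - τ)^2)⁻¹ * {τ | P τ}.indicator 1 τ ≤ ENNReal.ofReal (K / t) := by
  have hlt : ∀ τ ∈ Ioo (0:ℝ) 1, P τ → τ < 1 - t / K := by
    intro τ h1 h2
    have := (div_lt_iff₀' hK).mpr (hP τ h1 h2)
    linarith
  by_cases ha : 1 - t / K ≤ 0
  · have : ∫⁻ τ in Ioo (0:ℝ) 1, ENNReal.ofReal ((1 - τ)^2)⁻¹ * {τ | P τ}.indicator 1 τ = ∫⁻ τ in Ioo (0:ℝ) 1, 0 := by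
      refine setLIntegral_congr_fun measurableSet_Ioo fun τ h1 => ?_
      rw [indicator_of_notMem, mul_zero]
      intro h2
      linarith [hlt τ h1 h2, h1.1]
    rw [this, lintegral_zero]
    exact zero_le
  push Not at ha
  have htK : 0 < t / K := by positivity
  calc _ ≤ ∫⁻ τ in Ioo (0:ℝ) 1, (Ioo (0:ℝ) (1 - t / K)).indicator (fun τ => ENNReal.ofReal ((1 - τ)^2)⁻¹) τ := by
        refine setLIntegral_mono' measurableSet_Ioo fun τ h1 => ?_
        by_cases h2 : P τ
        · rw [indicator_of_mem (by exact h2), indicator_of_mem (by exact ⟨h1.1, hlt τ h1 h2⟩), Pi.one_apply, mul_one]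
        · rw [indicator_of_notMem (by exact h2), mul_zero]
          exact zero_le
    _ ≤ ∫⁻ τ, (Ioo (0:ℝ) (1 - t / K)).indicator (fun τ => ENNReal.ofReal ((1 - τ)^2)⁻¹) τ := setLIntegral_le_lintegral _ _
    _ = ENNReal.ofReal ((1 - t / K) / (1 - (1 - t / K))) := by
        rw [lintegral_indicator measurableSet_Ioo, lintegral_inv_one_sub_sq ha.le (by linarith)]
    _ ≤ _ := by
        refine ENNReal.ofReal_le_ofReal ?_
        have : (1 - t / K) / (1 - (1 - t / K)) = K / t - 1 := by
          rw [sub_sub_cancel, sub_div, div_self htK.ne', one_div_div]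
        rw [this]; linarith

variable {g : ℂ → ℂ}

/-- The asymptotics of the hyperbolic measure of the superlevel sets at small levels. -/
lemma exists_hyp_superlevel_le (hg : ContinuousOn g (Metric.closedBall 0 1)) (hU : Continuous (diskDensity g))
    {ε : ℝ} (hε : 0 < ε) : ∃ C : ℝ, 0 ≤ C ∧ ∀ t : ℝ, 0 < t →
      hypMeasure {z | t < diskDensity g z} ≤ ENNReal.ofReal (C + (circleMeanSq g 1 + ε) / t) := by
  have hun : UniformContinuousOn (fun z => ‖g z‖^2) (Metric.closedBall 0 1) :=
    (isCompact_closedBall 0 1).uniformContinuousOn_of_continuous (hg.norm.pow 2)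
  obtain ⟨δ, hδ, hd⟩ := Metric.uniformContinuousOn_iff.mp hun ε hε
  obtain ⟨r, hr0, hr1, hrδ⟩ : ∃ r : ℝ, 0 ≤ r ∧ r < 1 ∧ 1 - r < δ := by
    refine ⟨max 0 (1 - δ / 2), le_max_left _ _, max_lt one_pos (by linarith), ?_⟩
    linarith [le_max_right 0 (1 - δ / 2)]
  have hexp : ∀ φ : ℝ, ‖Complex.exp (Complex.I * (φ:ℂ))‖ = 1 := fun φ => by
    rw [mul_comm]; exact Complex.norm_exp_ofReal_mul_I φ
  have hr2 : 0 < 1 - r^2 := by nlinarith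
  have hm0 : 0 ≤ circleMeanSq g 1 :=
    mul_nonneg (by positivity) (integral_nonneg fun φ => by positivity)
  refine ⟨r^2 / (1 - r^2), by positivity, fun t ht => ?_⟩
  have hA : MeasurableSet {z | t < diskDensity g z} := (isOpen_lt continuous_const hU).measurableSet
  obtain ⟨E, hE⟩ : ∃ E, E = {z | t < diskDensity g z} \ Metric.closedBall 0 r := ⟨_, rfl⟩
  have hEm : MeasurableSet E := hE ▸ hA.diff measurableSet_closedBall
  have h1 : hypMeasure {z | t < diskDensity g z} ≤ hypMeasure (Metric.closedBall 0 r) + hypMeasure E := by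
    refine (measure_mono fun z hz => ?_).trans (measure_union_le _ _)
    by_cases h : z ∈ Metric.closedBall (0:ℂ) r
    · exact Or.inl h
    · exact Or.inr (hE ▸ ⟨hz, h⟩)
  refine h1.trans ?_
  rw [hyp_closedBall hr0 hr1, ENNReal.ofReal_add (by positivity) (by positivity)]
  refine add_le_add le_rfl ?_
  rw [← lintegral_indicator_one hEm, lintegral_hyp_polar _ (by exact measurable_one.indicator hEm)]
  have hcont : Continuous fun φ : ℝ => ‖g (Complex.exp (Complex.I * (φ:ℂ)))‖^2 := by
    refine (hg.comp_continuous (f := fun φ : ℝ => Complex.exp (Complex.I * (φ:ℂ))) (by fun_prop) fun φ => ?_).norm.pow 2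
    rw [mem_closedBall_zero_iff, hexp]
  have hintg : IntegrableOn (fun φ : ℝ => (‖g (Complex.exp (Complex.I * (φ:ℂ)))‖^2 + ε) / t) (Ioo (-Real.pi) Real.pi) :=
    (((hcont.add continuous_const).div_const t).integrableOn_Icc (a := -Real.pi) (b := Real.pi)).mono_set Ioo_subset_Icc_self
  calc _ ≤ ENNReal.ofReal (2 * Real.pi)⁻¹ * ∫⁻ θ in Ioo (-Real.pi) Real.pi,
        ENNReal.ofReal ((‖g (Complex.exp (Complex.I * (θ:ℂ)))‖^2 + ε) / t) := by
        refine mul_le_mul_right (lintegral_mono fun θ => ?_) _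
        refine le_trans (le_of_eq ?_) (lintegral_radial_superlevel_le (P := fun τ => (Real.sqrt τ * Complex.exp (Complex.I * θ) : ℂ) ∈ E)
          ht (by positivity) fun τ hτ hP => ?_)
        · rfl
        · rw [hE] at hP
          have hn : ‖(Real.sqrt τ * Complex.exp (Complex.I * θ) : ℂ)‖ = Real.sqrt τ := by
            rw [norm_mul, hexp, mul_one, Complex.norm_real, Real.norm_eq_abs, abs_of_nonneg (Real.sqrt_nonneg _)]
          have hs1 : Real.sqrt τ < 1 := by
            rw [Real.sqrt_lt' one_pos]; simpa using hτ.2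
          have h2 : t < diskDensity g (Real.sqrt τ * Complex.exp (Complex.I * θ)) := hP.1
          rw [diskDensity_of_lt (by rw [hn]; exact hs1), hn, Real.sq_sqrt hτ.1.le] at h2
          have h3 : r < Real.sqrt τ := by
            have := hP.2
            rw [mem_closedBall_zero_iff, hn] at this
            exact not_le.mp this
          have h4 := hd (Real.sqrt τ * Complex.exp (Complex.I * θ)) (by rw [mem_closedBall_zero_iff, hn]; exact hs1.le)
            (Complex.exp (Complex.I * θ)) (by rw [mem_closedBall_zero_iff, hexp]) (by
              rw [dist_eq_norm, ← sub_one_mul, norm_mul, hexp, mul_one, ← Complex.ofReal_one, ← Complex.ofReal_sub,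
                Complex.norm_real, Real.norm_eq_abs, abs_sub_comm, abs_of_nonneg (by linarith)]
              linarith)
          rw [Real.dist_eq] at h4
          have h5 := (abs_lt.mp h4).2
          have h6 : 0 < 1 - τ := by linarith [hτ.2]
          refine h2.trans_le (mul_le_mul_of_nonneg_right (by linarith) h6.le)
    _ = _ := by
        rw [← ofReal_integral_eq_lintegral_ofReal hintg (Eventually.of_forall fun φ => by positivity), ← ENNReal.ofReal_mul (by positivity)]
        congr 1
        rw [integral_div, integral_add (by exact (hcont.integrableOn_Icc).mono_set Ioo_subset_Icc_self) (by simp), circleMeanSq,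
          integral_Ioc_eq_integral_Ioo]
        simp only [Complex.ofReal_one, one_mul]
        rw [setIntegral_const]
        simp only [measureReal_def, Real.volume_Ioo, smul_eq_mul]
        rw [ENNReal.toReal_ofReal (by linarith [Real.pi_pos])]
        have := Real.pi_ne_zero
        field_simp
        ring

lemma mul_one_add_superlevel_le_circleMeanSq (hgd : DifferentiableOn ℂ g (Metric.ball 0 1))
    (hg : ContinuousOn g (Metric.closedBall 0 1)) (hU : Continuous (diskDensity g)) {s : ℝ} (hs : 0 < s)
    (hpos : 0 < hypMeasure.real {z | s < diskDensity g z}) :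
    s * (1 + hypMeasure.real {z | s < diskDensity g z}) ≤ circleMeanSq g 1 := by
  refine le_of_forall_pos_le_add fun ε hε => ?_
  obtain ⟨C, hC0, hC⟩ := exists_hyp_superlevel_le hg hU hε
  have hm0 : 0 ≤ circleMeanSq g 1 :=
    mul_nonneg (by positivity) (integral_nonneg fun φ => by positivity)
  have hlim : Tendsto (fun t : ℝ => t * (1 + C) + (circleMeanSq g 1 + ε)) (𝓝[>] 0) (𝓝 (circleMeanSq g 1 + ε)) := by
    have : Continuous fun t : ℝ => t * (1 + C) + (circleMeanSq g 1 + ε) := by fun_prop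
    have := (this.tendsto 0).mono_left (nhdsWithin_le_nhds (s := Ioi 0))
    simpa using this
  refine ge_of_tendsto hlim ?_
  filter_upwards [Ioo_mem_nhdsGT hs] with t ht
  refine (mul_one_add_superlevel_le hgd hU ht.1 ht.2.le hpos).trans ?_
  have h1 : hypMeasure.real {z | t < diskDensity g z} ≤ C + (circleMeanSq g 1 + ε) / t :=
    ENNReal.toReal_le_of_le_ofReal (by have := ht.1; positivity) (hC t ht.1)
  have h2 := mul_le_mul_of_nonneg_left h1 ht.1.le
  rw [mul_add, mul_div_cancel₀ _ ht.1.ne'] at h2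
  linarith

variable {f : ℂ → ℂ} {a : ℕ → ℂ}

/-- The sharp bound for the hyperbolic measure of the superlevel sets. -/
theorem hyp_superlevel_le (hf : DifferentiableOn ℂ f (Metric.ball 0 1))
    (hb : ∀ r : ℝ, 0 < r → r < 1 → circleMeanSq f r ≤ 1) {s : ℝ} (hs : 0 < s) :
    hypMeasure {z | s < diskDensity f z} ≤ ENNReal.ofReal (1 / s - 1) := by
  obtain ⟨a, h⟩ := exists_coefficients hf
  have key : ∀ ρ : ℝ, 0 < ρ → ρ < 1 → hypMeasure {z | s < diskDensity (fun z => f (ρ * z)) z} ≤ ENNReal.ofReal (1 / s - 1) := by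
    intro ρ hρ h1
    have h0 := hρ.le
    have hmul : ∀ z : ℂ, ‖z‖ ≤ 1 → ‖(ρ * z : ℂ)‖ < 1 := fun z hz => by
      rw [norm_mul, Complex.norm_real, Real.norm_eq_abs, abs_of_nonneg h0]
      nlinarith [norm_nonneg z]
    have hgd : DifferentiableOn ℂ (fun z => f (ρ * z)) (Metric.ball 0 1) :=
      hf.comp (by fun_prop) fun z hz => mem_ball_zero_iff.mpr (hmul z (mem_ball_zero_iff.mp hz).le)
    have hg : ContinuousOn (fun z => f (ρ * z)) (Metric.closedBall 0 1) :=
      hf.continuousOn.comp (by fun_prop) fun z hz => mem_ball_zero_iff.mpr (hmul z (mem_closedBall_zero_iff.mp hz))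
    have hU : Continuous (diskDensity fun z => f (ρ * z)) := by
      refine continuous_diskDensity hgd (a := fun n => a n * ρ^n) (S := circleMeanSq f ρ) (fun z hz => ?_) ?_
      · refine (h (ρ * z) (hmul z hz.le)).congr_fun fun n => ?_
        rw [mul_pow, mul_assoc]
      · refine (hasSum_circleMeanSq h h0 h1).congr_fun fun n => ?_
        rw [norm_mul, mul_pow, norm_pow, Complex.norm_real, Real.norm_eq_abs, abs_of_nonneg h0]
        ring
    have hmean : circleMeanSq (fun z => f (ρ * z)) 1 = circleMeanSq f ρ := by simp [circleMeanSq]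
    rcases (measureReal_nonneg (μ := hypMeasure) (s := {z | s < diskDensity (fun z => f (ρ * z)) z})).eq_or_lt with h2 | h2
    · rw [(measureReal_eq_zero_iff (hyp_superlevel_lt_top hU hs).ne).mp h2.symm]
      exact zero_le
    · have h3 := mul_one_add_superlevel_le_circleMeanSq hgd hg hU hs h2
      rw [hmean] at h3
      rw [← ofReal_measureReal (hyp_superlevel_lt_top hU hs).ne]
      refine ENNReal.ofReal_le_ofReal ?_
      have := (le_div_iff₀' hs).mpr (h3.trans (hb ρ hρ h1))
      linarith
  obtain ⟨ρ, -, hρ, hlim⟩ := exists_seq_strictMono_tendsto' (zero_lt_one (α := ℝ))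
  have hsub : {z | s < diskDensity f z} ⊆ ⋃ N : ℕ, ⋂ n ≥ N, {z | s < diskDensity (fun z => f (ρ n * z)) z} := by
    intro z hz
    have hz1 := norm_lt_one_of_diskDensity_pos (hs.trans hz)
    have hc : ContinuousAt f z := hf.continuousOn.continuousAt (Metric.isOpen_ball.mem_nhds (by simpa using hz1))
    have ht : Tendsto (fun n => (ρ n : ℂ) * z) atTop (𝓝 z) := by
      have := ((Complex.continuous_ofReal.tendsto 1).comp hlim).mul_const z
      simpa using this
    have ht2 : Tendsto (fun n => diskDensity (fun z => f (ρ n * z)) z) atTop (𝓝 (diskDensity f z)) := by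
      simp only [diskDensity_of_lt hz1]
      exact (((hc.tendsto.comp ht).norm).pow 2).mul_const _
    obtain ⟨N, hN⟩ := eventually_atTop.mp (ht2.eventually (lt_mem_nhds hz))
    exact mem_iUnion.mpr ⟨N, mem_iInter₂.mpr hN⟩
  refine (measure_mono hsub).trans ?_
  rw [Monotone.measure_iUnion]
  · exact iSup_le fun N => (measure_mono (iInter₂_subset N le_rfl)).trans (key _ (hρ N).1 (hρ N).2)
  · exact fun m n hmn => biInter_subset_biInter_left fun k hk => le_trans hmn hk
end Dilation

section Comparison

lemma measure_isUpperSet_le {κ ν : Measure ℝ} (h0 : κ (Iic 0) = 0) (hfin : ∀ σ > 0, ν (Ioi σ) < ∞)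
    (h : ∀ σ > 0, κ (Ioi σ) ≤ ν (Ioi σ)) {A : Set ℝ} (hA : IsUpperSet A) : κ A ≤ ν A := by
  have hpos : κ (Ioi 0) ≤ ν (Ioi 0) := by
    have : (Ioi (0:ℝ)) = ⋃ n : ℕ, Ioi (1 / ((n:ℝ) + 1)) := by
      ext x
      simp only [mem_Ioi, mem_iUnion]
      exact ⟨fun hx => exists_nat_one_div_lt hx, fun ⟨n, hn⟩ => lt_trans (by positivity) hn⟩
    have hm : Monotone fun n : ℕ => Ioi (1 / ((n:ℝ) + 1)) := fun m n hmn =>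
      Ioi_subset_Ioi (one_div_le_one_div_of_le (by positivity) (by gcongr))
    rw [this, hm.measure_iUnion, hm.measure_iUnion]
    exact iSup_mono fun n => h _ (by positivity)
  by_cases hz : ∃ x ∈ A, x ≤ 0
  · obtain ⟨x, hx, hx0⟩ := hz
    calc κ A ≤ κ (Iic 0 ∪ Ioi 0) := measure_mono fun y _ => le_or_gt y 0
      _ ≤ κ (Iic 0) + κ (Ioi 0) := measure_union_le _ _
      _ ≤ ν (Ioi 0) := by rw [h0, zero_add]; exact hpos
      _ ≤ ν A := measure_mono fun y hy => hA (hx0.trans (le_of_lt hy)) hx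
  push Not at hz
  rcases A.eq_empty_or_nonempty with rfl | hne
  · simp
  have hbdd : BddBelow A := ⟨0, fun x hx => (hz x hx).le⟩
  have h1 : Ioi (sInf A) ⊆ A := fun y hy => by
    obtain ⟨x, hx, hxy⟩ := exists_lt_of_csInf_lt hne hy
    exact hA hxy.le hx
  have hinf : 0 ≤ sInf A := le_csInf hne fun x hx => (hz x hx).le
  by_cases hmem : sInf A ∈ A
  · have hAe : A = Ici (sInf A) := by
      ext y
      exact ⟨fun hy => csInf_le hbdd hy, fun hy => hA hy hmem⟩
    obtain ⟨m, hm⟩ : ∃ m, m = sInf A := ⟨_, rfl⟩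
    rw [← hm] at hAe hmem
    have hm0 := hz m hmem
    obtain ⟨u, hu, hu2, hu3⟩ := exists_seq_strictMono_tendsto' hm0
    have hI : Ici m = ⋂ n, Ioi (u n) := by
      ext y
      simp only [mem_Ici, mem_iInter, mem_Ioi]
      exact ⟨fun hy n => (hu2 n).2.trans_le hy, fun hy => le_of_tendsto' hu3 fun n => (hy n).le⟩
    have hanti : Antitone fun n => Ioi (u n) := fun i j hij => Ioi_subset_Ioi (hu.monotone hij)
    have hν : ν (Ici m) = ⨅ n, ν (Ioi (u n)) := by
      rw [hI]
      exact hanti.measure_iInter (fun n => measurableSet_Ioi.nullMeasurableSet) ⟨0, (hfin _ (hu2 0).1).ne⟩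
    rw [hAe, hν]
    exact le_iInf fun n => (measure_mono (Ici_subset_Ioi.mpr (hu2 n).2)).trans (h _ (hu2 n).1)
  · have hAe : A = Ioi (sInf A) := by
      refine Subset.antisymm (fun y hy => ?_) h1
      exact lt_of_le_of_ne (csInf_le hbdd hy) fun he => hmem (by rwa [he])
    rw [hAe]
    rcases hinf.eq_or_lt with h2 | h2
    · rw [← h2]; exact hpos
    · exact h _ h2

/-- Comparison of the integrals of a monotone function against two measures ordered on upper half lines. -/
lemma lintegral_monotone_le {κ ν : Measure ℝ} (h0 : κ (Iic 0) = 0) (hfin : ∀ σ > 0, ν (Ioi σ) < ∞)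
    (h : ∀ σ > 0, κ (Ioi σ) ≤ ν (Ioi σ)) {φ : ℝ → ℝ} (hφ : Monotone φ) :
    ∫⁻ s, ENNReal.ofReal (φ s) ∂κ ≤ ∫⁻ s, ENNReal.ofReal (φ s) ∂ν := by
  have hm : Monotone fun s => max (φ s) 0 := fun a b hab => max_le_max (hφ hab) le_rfl
  have e : ∀ μ : Measure ℝ, ∫⁻ s, ENNReal.ofReal (φ s) ∂μ = ∫⁻ t in Ioi (0:ℝ), μ {s | t < max (φ s) 0} := fun μ => by
    rw [← lintegral_eq_lintegral_meas_lt μ (f := fun s => max (φ s) 0) (Eventually.of_forall fun s => le_max_right _ _)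
      hm.measurable.aemeasurable]
    simp
  rw [e, e]
  exact lintegral_mono fun t => measure_isUpperSet_le h0 hfin h fun a b hab ha => lt_of_lt_of_le ha (hm hab)

lemma not_integrable_of_neg {μ : Measure ℝ} {φ : ℝ → ℝ} (hφ : Monotone φ) {s : ℝ} (hs : φ s < 0)
    (hμ : μ (Iic s) = ∞) : ¬ Integrable φ μ := by
  intro hi
  have h1 : Iic s ⊆ {x | -φ s ≤ ‖φ x‖} := fun x hx => by
    have := hφ (mem_Iic.mp hx)
    show -φ s ≤ ‖φ x‖
    rw [Real.norm_eq_abs, abs_of_nonpos (by linarith)]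
    linarith
  have h2 := hi.measure_norm_ge_lt_top (ε := -φ s) (by linarith)
  exact absurd (measure_mono h1) (by rw [hμ]; exact not_le.mpr h2)

/-- The distribution `s⁻² ds` on the unit interval. -/
noncomputable def unitLevelMeasure : Measure ℝ :=
  (volume.restrict (Ioo (0:ℝ) 1)).withDensity fun s => ENNReal.ofReal (s^2)⁻¹

lemma measurable_inv_sq : Measurable fun s : ℝ => ENNReal.ofReal (s^2)⁻¹ := by fun_prop

lemma lintegral_inv_sq_Ioc {σ τ : ℝ} (h0 : 0 < σ) (h : σ ≤ τ) :
    ∫⁻ s in Ioc σ τ, ENNReal.ofReal (s^2)⁻¹ = ENNReal.ofReal (1 / σ - 1 / τ) := by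
  have hd : ∀ t ∈ uIcc σ τ, HasDerivAt (fun t : ℝ => -t⁻¹) ((t^2)⁻¹) t := by
    intro t ht
    rw [uIcc_of_le h] at ht
    have := (hasDerivAt_inv (h0.trans_le ht.1).ne').neg
    rwa [neg_neg] at this
  have hintg : IntervalIntegrable (fun t : ℝ => (t^2)⁻¹) volume σ τ := by
    refine ContinuousOn.intervalIntegrable fun t ht => ?_
    rw [uIcc_of_le h] at ht
    have := (h0.trans_le ht.1).ne'
    exact (ContinuousAt.inv₀ (by fun_prop) (by positivity)).continuousWithinAt
  rw [← ofReal_integral_eq_lintegral_ofReal ((intervalIntegrable_iff_integrableOn_Ioc_of_le h).mp hintg)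
    (Eventually.of_forall fun t => by positivity), ← intervalIntegral.integral_of_le h,
    intervalIntegral.integral_eq_sub_of_hasDerivAt hd hintg]
  congr 1
  simp only [one_div]; ring

lemma unitLevelMeasure_Ioc {σ τ : ℝ} (h0 : 0 < σ) (h : σ ≤ τ) (h1 : τ < 1) :
    unitLevelMeasure (Ioc σ τ) = ENNReal.ofReal (1 / σ - 1 / τ) := by
  have hsub : Ioc σ τ ⊆ Ioo 0 1 := fun x hx => ⟨h0.trans hx.1, hx.2.trans_lt h1⟩
  rw [unitLevelMeasure, withDensity_apply _ measurableSet_Ioc, Measure.restrict_restrict measurableSet_Ioc,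
    inter_eq_left.mpr hsub, lintegral_inv_sq_Ioc h0 h]

lemma unitLevelMeasure_Ioi {σ : ℝ} (h0 : 0 < σ) :
    unitLevelMeasure (Ioi σ) = ENNReal.ofReal (1 / σ - 1) := by
  rw [unitLevelMeasure, withDensity_apply _ measurableSet_Ioi, Measure.restrict_restrict measurableSet_Ioi]
  rcases le_or_gt σ 1 with h1 | h1
  · have : Ioi σ ∩ Ioo 0 1 = Ioo σ 1 := by
      ext x
      exact ⟨fun h => ⟨h.1, h.2.2⟩, fun h => ⟨h.1, h0.trans h.1, h.2⟩⟩
    rw [this, Measure.restrict_congr_set Ioo_ae_eq_Ioc, lintegral_inv_sq_Ioc h0 h1, one_div_one]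
  · have : Ioi σ ∩ Ioo 0 1 = ∅ := by
      ext x
      simp only [mem_inter_iff, mem_Ioi, mem_Ioo, mem_empty_iff_false, iff_false]
      intro h; linarith [h.1, h.2.2]
    rw [this, Measure.restrict_empty, lintegral_zero_measure, ENNReal.ofReal_of_nonpos]
    rw [sub_nonpos, div_le_one h0]
    exact h1.le

lemma unitLevelMeasure_Iic_zero : unitLevelMeasure (Iic 0) = 0 := by
  rw [unitLevelMeasure, withDensity_apply _ measurableSet_Iic, Measure.restrict_restrict measurableSet_Iic]
  have : Iic (0:ℝ) ∩ Ioo 0 1 = ∅ := by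
    ext x
    simp only [mem_inter_iff, mem_Iic, mem_Ioo, mem_empty_iff_false, iff_false]
    intro h; linarith [h.1, h.2.1]
  rw [this, Measure.restrict_empty, lintegral_zero_measure]

lemma measure_Ioi_zero_eq_top {μ : Measure ℝ} {s c : ℝ} (hs : 0 < s) (hc : 0 < c)
    (h : ∀ σ : ℝ, 0 < σ → σ ≤ s → ENNReal.ofReal (c / σ - 1) ≤ μ (Ioi σ)) : μ (Ioi 0) = ∞ := by
  refine ENNReal.eq_top_of_forall_nnreal_le fun r => ?_
  have hσ : 0 < min s (c / (r + 1)) := lt_min hs (by positivity)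
  refine le_trans ?_ ((h _ hσ (min_le_left _ _)).trans (measure_mono (Ioi_subset_Ioi hσ.le)))
  rw [← ENNReal.ofReal_coe_nnreal]
  refine ENNReal.ofReal_le_ofReal ?_
  rw [le_sub_iff_add_le, le_div_iff₀' hσ, ← le_div_iff₀ (by positivity)]
  exact min_le_right _ _

lemma measure_Iic_eq_top {μ : Measure ℝ} {s c : ℝ} (hs : 0 < s) (hc : 0 < c)
    (h : ∀ σ : ℝ, 0 < σ → σ ≤ s → ENNReal.ofReal (c / σ - 1) ≤ μ (Ioi σ)) (hfin : ∀ σ > 0, μ (Ioi σ) < ∞) {σ : ℝ}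
    (hσ : 0 < σ) : μ (Iic σ) = ∞ := by
  by_contra hne
  have h1 : μ (Ioi 0) ≤ μ (Iic σ) + μ (Ioi σ) :=
    (measure_mono fun y _ => le_or_gt y σ).trans (measure_union_le _ _)
  rw [measure_Ioi_zero_eq_top hs hc h, top_le_iff] at h1
  exact ENNReal.add_ne_top.mpr ⟨hne, (hfin σ hσ).ne⟩ h1

variable {κ : Measure ℝ} {Φ : ℝ → ℝ}

/-- The comparison of Bochner integrals, including the cases in which one of them diverges. -/
theorem integral_le_integral_unitLevelMeasure (hΦ : Monotone Φ) (hΦ1 : ∀ s, Φ s ≤ Φ 1) (h0 : κ (Iic 0) = 0)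
    (hle : ∀ σ > 0, κ (Ioi σ) ≤ ENNReal.ofReal (1 / σ - 1)) {s : ℝ} (hs : 0 < s) (hs1 : s < 1)
    (hge : ∀ σ : ℝ, 0 < σ → σ ≤ s → ENNReal.ofReal (s / σ - 1) ≤ κ (Ioi σ)) :
    ∫ x, Φ x ∂κ ≤ ∫ x, Φ x ∂unitLevelMeasure := by
  have hfinκ : ∀ σ > 0, κ (Ioi σ) < ∞ := fun σ h => (hle σ h).trans_lt ENNReal.ofReal_lt_top
  have hfinν : ∀ σ > 0, unitLevelMeasure (Ioi σ) < ∞ := fun σ h => by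
    rw [unitLevelMeasure_Ioi h]; exact ENNReal.ofReal_lt_top
  by_cases hneg : ∃ x, 0 < x ∧ Φ x < 0
  · obtain ⟨x, hx, hneg⟩ := hneg
    rw [integral_undef (not_integrable_of_neg hΦ hneg (measure_Iic_eq_top hs hs hge hfinκ hx)),
      integral_undef (not_integrable_of_neg hΦ hneg (measure_Iic_eq_top one_pos one_pos
        (fun σ h _ => (unitLevelMeasure_Ioi h).ge) hfinν hx))]
  push Not at hneg
  have hnnν : 0 ≤ᵐ[unitLevelMeasure] Φ := by
    filter_upwards [measure_eq_zero_iff_ae_notMem.mp unitLevelMeasure_Iic_zero] with x hx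
    exact hneg x (not_le.mp hx)
  have hnnκ : 0 ≤ᵐ[κ] Φ := by
    filter_upwards [measure_eq_zero_iff_ae_notMem.mp h0] with x hx
    exact hneg x (not_le.mp hx)
  have hlin : ∫⁻ x, ENNReal.ofReal (Φ x) ∂κ ≤ ∫⁻ x, ENNReal.ofReal (Φ x) ∂unitLevelMeasure :=
    lintegral_monotone_le h0 hfinν (fun σ h => by rw [unitLevelMeasure_Ioi h]; exact hle σ h) hΦ
  have hsm : ∀ μ : Measure ℝ, AEStronglyMeasurable Φ μ := fun μ => hΦ.measurable.aestronglyMeasurable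
  rw [integral_eq_lintegral_of_nonneg_ae hnnκ (hsm _), integral_eq_lintegral_of_nonneg_ae hnnν (hsm _)]
  by_cases htop : ∫⁻ x, ENNReal.ofReal (Φ x) ∂unitLevelMeasure = ∞
  · have h1 : ∫⁻ x in Ioi s, ENNReal.ofReal (Φ x) ∂unitLevelMeasure < ∞ := by
      calc _ ≤ ∫⁻ x in Ioi s, ENNReal.ofReal (Φ 1) ∂unitLevelMeasure :=
            lintegral_mono fun x => ENNReal.ofReal_le_ofReal (hΦ1 x)
        _ = ENNReal.ofReal (Φ 1) * unitLevelMeasure (Ioi s) := by rw [setLIntegral_const]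
        _ < ∞ := ENNReal.mul_lt_top ENNReal.ofReal_lt_top (hfinν s hs)
    have h2 : ∫⁻ x in Iic s, ENNReal.ofReal (Φ x) ∂unitLevelMeasure = ∞ := by
      by_contra hne
      have := lintegral_add_compl (μ := unitLevelMeasure) (fun x => ENNReal.ofReal (Φ x)) (measurableSet_Iic (a := s))
      rw [compl_Iic, htop] at this
      exact ENNReal.add_ne_top.mpr ⟨hne, h1.ne⟩ this
    have h3 : ∫⁻ x, ENNReal.ofReal (Φ x) ∂(ENNReal.ofReal s • unitLevelMeasure.restrict (Iic s)) ≤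
        ∫⁻ x, ENNReal.ofReal (Φ x) ∂κ := by
      refine lintegral_monotone_le ?_ hfinκ (fun σ hσ => ?_) hΦ
      · rw [Measure.smul_apply, smul_eq_mul, mul_eq_zero]
        exact Or.inr (le_antisymm ((Measure.restrict_apply_le _ _).trans unitLevelMeasure_Iic_zero.le) zero_le)
      · rw [Measure.smul_apply, smul_eq_mul, Measure.restrict_apply measurableSet_Ioi, Ioi_inter_Iic]
        rcases le_or_gt σ s with h | h
        · rw [unitLevelMeasure_Ioc hσ h hs1, ← ENNReal.ofReal_mul hs.le]
          refine le_trans (le_of_eq ?_) (hge σ hσ h)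
          congr 1
          field_simp
        · rw [Ioc_eq_empty (not_lt.mpr h.le), measure_empty, mul_zero]
          exact zero_le
    rw [lintegral_smul_measure, h2, smul_eq_mul, ENNReal.mul_top (by simpa using hs), top_le_iff] at h3
    rw [htop, h3]
  · exact ENNReal.toReal_mono htop hlin

end Comparison

section LevelMeasure

variable {κ : Measure ℝ} {Φ : ℝ → ℝ}

theorem integral_lt_integral_unitLevelMeasure (hΦ : Monotone Φ) (hΦ1 : ∀ s, Φ s ≤ Φ 1) (h0 : κ (Iic 0) = 0)
    (hle : ∀ σ > 0, κ (Ioi σ) ≤ ENNReal.ofReal (1 / σ - 1)) {s : ℝ} (hs : 0 < s) (hs1 : s < 1)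
    (hge : ∀ σ : ℝ, 0 < σ → σ ≤ s → ENNReal.ofReal (s / σ - 1) ≤ κ (Ioi σ))
    (hintg : Integrable Φ unitLevelMeasure) {τ t : ℝ} (hκ : κ (Ioi τ) = 0) (ht0 : 0 < t) (ht1 : t < 1)
    (hτt : Φ τ < Φ t) : ∫ x, Φ x ∂κ < ∫ x, Φ x ∂unitLevelMeasure := by
  have hfinν : ∀ σ > 0, unitLevelMeasure (Ioi σ) < ∞ := fun σ h => by
    rw [unitLevelMeasure_Ioi h]; exact ENNReal.ofReal_lt_top
  have hneg : ∀ x, 0 < x → 0 ≤ Φ x := by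
    intro x hx
    by_contra! hneg
    exact not_integrable_of_neg hΦ hneg (measure_Iic_eq_top one_pos one_pos
        (fun σ h _ => (unitLevelMeasure_Ioi h).ge) hfinν hx) hintg
  obtain ⟨Ψ, hΨ⟩ : ∃ Ψ : ℝ → ℝ, ∀ x, Ψ x = min (Φ x) (Φ τ) := ⟨_, fun _ => rfl⟩
  have hΨm : Monotone Ψ := fun a b hab => by rw [hΨ, hΨ]; exact min_le_min (hΦ hab) le_rfl
  have hΨ1 : ∀ s, Ψ s ≤ Ψ 1 := fun s => by rw [hΨ, hΨ]; exact min_le_min (hΦ1 s) le_rfl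
  have hle1 : ∀ x, Ψ x ≤ Φ x := fun x => by rw [hΨ]; exact min_le_left _ _
  have e1 : ∫ x, Φ x ∂κ = ∫ x, Ψ x ∂κ := by
    refine integral_congr_ae ?_
    filter_upwards [measure_eq_zero_iff_ae_notMem.mp hκ] with x hx
    rw [hΨ, min_eq_left (hΦ (not_lt.mp hx))]
  have hΨi : Integrable Ψ unitLevelMeasure := by
    rcases le_or_gt 0 (Φ τ) with h | h
    · refine hintg.mono hΨm.measurable.aestronglyMeasurable ?_
      filter_upwards [measure_eq_zero_iff_ae_notMem.mp unitLevelMeasure_Iic_zero] with x hx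
      have := hneg x (not_le.mp hx)
      rw [Real.norm_eq_abs, Real.norm_eq_abs, abs_of_nonneg this, abs_of_nonneg (by rw [hΨ]; exact le_min this h)]
      exact hle1 x
    · exfalso
      have hτ : τ ≤ 0 := by
        by_contra! h3
        linarith [hneg τ h3]
      have h3 : κ (Ioi s) = 0 := measure_mono_null (Ioi_subset_Ioi (hτ.trans hs.le)) hκ
      have h4 := hge (s / 2) (by positivity) (by linarith)
      rw [measure_mono_null (Ioi_subset_Ioi (hτ.trans (by positivity))) hκ, nonpos_iff_eq_zero, ENNReal.ofReal_eq_zero] at h4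
      have : s / (s / 2) = 2 := by field_simp
      linarith
  rw [e1]
  refine (integral_le_integral_unitLevelMeasure hΨm hΨ1 h0 hle hs hs1 hge).trans_lt ?_
  refine lt_of_le_of_ne (integral_mono hΨi hintg hle1) fun he => ?_
  have hae := (integral_eq_iff_of_ae_le hΨi hintg (Eventually.of_forall hle1)).mp he
  have h5 : unitLevelMeasure (Ioi t) = 0 := by
    refine measure_mono_null (fun x hx => ?_) (ae_iff.mp hae)
    have h6 := hΦ (le_of_lt (mem_Ioi.mp hx))
    have h7 : Ψ x ≤ Φ τ := by rw [hΨ]; exact min_le_right _ _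
    exact ne_of_lt (by linarith)
  rw [unitLevelMeasure_Ioi ht0, ENNReal.ofReal_eq_zero] at h5
  have := (one_lt_div ht0).mpr ht1
  linarith

variable {f : ℂ → ℂ}

lemma hyp_zeros (hf : DifferentiableOn ℂ f (Metric.ball 0 1)) (hne : ∃ z : ℂ, ‖z‖ < 1 ∧ f z ≠ 0) :
    hypMeasure {z | diskDensity f z ≤ 0} = 0 := by
  obtain ⟨z₀, hz₀, hfz⟩ := hne
  have h1 := (hf.analyticOnNhd Metric.isOpen_ball).preimage_zero_mem_codiscreteWithin hfz (by simpa using hz₀)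
    ((convex_ball (0:ℂ) 1).isConnected (by simp))
  have h2 : ∀ᵐ z ∂(volume.restrict (Metric.ball (0:ℂ) 1)), f z ≠ 0 := ae_restrict_le_codiscreteWithin measurableSet_ball h1
  have h3 : ∀ᵐ z ∂hypMeasure, f z ≠ 0 := (withDensity_absolutelyContinuous _ _).ae_le h2
  refine measure_eq_zero_iff_ae_notMem.mpr ?_
  filter_upwards [h3, ae_hyp_lt_one] with z hz hz1
  have h4 := norm_sq_lt_one hz1
  rw [not_le, diskDensity_of_lt hz1]
  exact mul_pos (pow_pos (norm_pos_iff.mpr hz) 2) (by linarith)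

lemma exists_superlevel_ge (hf : DifferentiableOn ℂ f (Metric.ball 0 1)) (hU : Continuous (diskDensity f))
    (hz : hypMeasure {z | diskDensity f z ≤ 0} = 0) : ∃ s : ℝ, 0 < s ∧ s < 1 ∧
      ∀ σ : ℝ, 0 < σ → σ ≤ s → ENNReal.ofReal (s / σ - 1) ≤ hypMeasure {z | σ < diskDensity f z} := by
  obtain ⟨n, hn⟩ : ∃ n : ℕ, hypMeasure {z | 1 / ((n:ℝ) + 2) < diskDensity f z} ≠ 0 := by
    by_contra! hall
    have hsub : Metric.ball (0:ℂ) (1/2) ⊆ {z | diskDensity f z ≤ 0} ∪ ⋃ n : ℕ, {z | 1 / ((n:ℝ) + 2) < diskDensity f z} := by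
      intro z _
      rcases le_or_gt (diskDensity f z) 0 with h | h
      · exact Or.inl h
      · obtain ⟨n, hn⟩ := exists_nat_one_div_lt h
        refine Or.inr (mem_iUnion.mpr ⟨n, lt_of_le_of_lt ?_ hn⟩)
        exact one_div_le_one_div_of_le (by positivity) (by linarith)
    have h0 := measure_mono_null hsub (measure_union_null hz (measure_iUnion_null hall))
    rw [hyp_ball (by norm_num) (by norm_num), ENNReal.ofReal_eq_zero] at h0
    norm_num at h0
  have hs : 0 < 1 / ((n:ℝ) + 2) := by positivity
  obtain ⟨s, hse⟩ : ∃ s, s = 1 / ((n:ℝ) + 2) := ⟨_, rfl⟩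
  rw [← hse] at hn hs
  refine ⟨s, hs, ?_, fun σ h0 h1 => ?_⟩
  · rw [hse]
    exact (div_lt_one (by positivity)).mpr (by linarith [(Nat.cast_nonneg n : (0:ℝ) ≤ n)])
  · have hpos : 0 < hypMeasure.real {z | s < diskDensity f z} :=
      ENNReal.toReal_pos hn (hyp_superlevel_lt_top hU hs).ne
    have h2 := mul_one_add_superlevel_le hf hU h0 h1 hpos
    rw [← ofReal_measureReal (hyp_superlevel_lt_top hU h0).ne]
    refine ENNReal.ofReal_le_ofReal ?_
    rw [sub_le_iff_le_add', div_le_iff₀' h0]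
    nlinarith

/-- The extension of a function on the unit interval by its boundary values. -/
noncomputable def clampExtend (Φ : ℝ → ℝ) (s : ℝ) : ℝ := Φ (max 0 (min s 1))

lemma clampExtend_of_mem {s : ℝ} (hs : s ∈ Icc (0:ℝ) 1) : clampExtend Φ s = Φ s := by
  rw [clampExtend, min_eq_left hs.2, max_eq_right hs.1]

lemma monotone_clampExtend (hΦ : MonotoneOn Φ (Icc 0 1)) : Monotone (clampExtend Φ) := fun _ _ hab =>
  hΦ ⟨le_max_left _ _, max_le zero_le_one (min_le_right _ _)⟩ ⟨le_max_left _ _, max_le zero_le_one (min_le_right _ _)⟩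
    (max_le_max le_rfl (min_le_min hab le_rfl))

lemma clampExtend_le_one (hΦ : MonotoneOn Φ (Icc 0 1)) (s : ℝ) : clampExtend Φ s ≤ clampExtend Φ 1 := by
  rw [clampExtend_of_mem (s := 1) (by simp)]
  exact hΦ ⟨le_max_left _ _, max_le zero_le_one (min_le_right _ _)⟩ (by simp) (max_le zero_le_one (min_le_right _ _))

lemma integral_unitLevelMeasure (Φ : ℝ → ℝ) :
    ∫ s, clampExtend Φ s ∂unitLevelMeasure = ∫ s in Ioo (0:ℝ) 1, Φ s * (s^2)⁻¹ := by
  rw [unitLevelMeasure, integral_withDensity_eq_integral_toReal_smul measurable_inv_sq (by simp)]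
  refine setIntegral_congr_fun measurableSet_Ioo fun s hs => ?_
  rw [clampExtend_of_mem (Ioo_subset_Icc_self hs), ENNReal.toReal_ofReal (by positivity), smul_eq_mul, mul_comm]

lemma integrable_unitLevelMeasure (h : IntegrableOn (fun s => Φ s * (s^2)⁻¹) (Ioo (0:ℝ) 1)) :
    Integrable (clampExtend Φ) unitLevelMeasure := by
  rw [unitLevelMeasure, integrable_withDensity_iff_integrable_smul' measurable_inv_sq (by simp)]
  refine h.congr_fun (fun s hs => ?_) measurableSet_Ioo
  simp only []
  rw [clampExtend_of_mem (Ioo_subset_Icc_self hs), ENNReal.toReal_ofReal (by positivity), smul_eq_mul, mul_comm]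

lemma integral_map_diskDensity (hΦ : MonotoneOn Φ (Icc 0 1)) (hU : Continuous (diskDensity f))
    (hU1 : ∀ z, diskDensity f z ≤ 1) : ∫ s, clampExtend Φ s ∂(hypMeasure.map (diskDensity f)) =
      ∫ z in Metric.ball (0:ℂ) 1, Φ ((uHardy f z)^2) * (Real.pi⁻¹ * ((1 - ‖z‖^2)^2)⁻¹) := by
  rw [integral_map hU.aemeasurable (monotone_clampExtend hΦ).measurable.aestronglyMeasurable, hypMeasure,
    integral_withDensity_eq_integral_toReal_smul measurable_hypDensity (by simp)]
  refine setIntegral_congr_fun measurableSet_ball fun z hz => ?_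
  have hz1 : ‖z‖ < 1 := mem_ball_zero_iff.mp hz
  have h2 : (uHardy f z)^2 = diskDensity f z := by
    rw [uHardy, mul_pow, Real.sq_sqrt (by linarith [norm_sq_lt_one hz1]), diskDensity_of_lt hz1]
  rw [clampExtend_of_mem ⟨diskDensity_nonneg z, hU1 z⟩, ENNReal.toReal_ofReal (by positivity), smul_eq_mul, mul_comm, h2]

lemma map_diskDensity_kernel {w : ℂ} (hw : ‖w‖ < 1) (h : ∀ z, ‖z‖ < 1 → diskDensity f z = 1 - ‖mob w z‖^2) :
    hypMeasure.map (diskDensity f) = unitLevelMeasure := by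
  have h1 : diskDensity f =ᵐ[hypMeasure] (fun z => 1 - ‖z‖^2) ∘ mob w := by
    filter_upwards [ae_hyp_lt_one] with z hz
    exact h z hz
  have hm : Measurable fun z : ℂ => 1 - ‖z‖^2 := by fun_prop
  rw [Measure.map_congr h1, ← Measure.map_map hm (measurable_mob w), (measurePreserving_mob hw).map_eq]
  refine Measure.ext_of_lintegral _ fun φ hφ => ?_
  rw [lintegral_map hφ hm, lintegral_hyp_radial (fun t => φ (1 - t)) (by fun_prop), unitLevelMeasure,
    lintegral_withDensity_eq_lintegral_mul _ measurable_inv_sq hφ, ← lintegral_indicator measurableSet_Ioo,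
    ← lintegral_indicator measurableSet_Ioo, ← lintegral_sub_left_eq_self _ 1]
  refine lintegral_congr fun t => ?_
  by_cases ht : t ∈ Ioo (0:ℝ) 1
  · rw [indicator_of_mem (by exact ⟨by linarith [ht.2], by linarith [ht.1]⟩), indicator_of_mem ht, sub_sub_cancel, Pi.mul_apply]
  · rw [indicator_of_notMem ht, indicator_of_notMem]
    exact fun h => ht ⟨by linarith [h.2], by linarith [h.1]⟩

end LevelMeasure

section Extremal

variable {f : ℂ → ℂ} {Φ : ℝ → ℝ}

lemma exists_ne_zero_of_hardyNormSq (hn : hardyNormSq f = 1) : ∃ z : ℂ, ‖z‖ < 1 ∧ f z ≠ 0 := by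
  by_contra! h
  have h0 : ∀ r : Ioo (0:ℝ) 1, (2*Real.pi)⁻¹ * ∫ φ in Ioc (-Real.pi) Real.pi,
      ‖f (((r : ℝ) : ℂ) * Complex.exp (Complex.I * (φ:ℂ)))‖^2 = 0 := by
    intro r
    have : ∀ φ : ℝ, f (((r : ℝ) : ℂ) * Complex.exp (Complex.I * (φ:ℂ))) = 0 := fun φ => h _ (by
      rw [norm_mul, mul_comm Complex.I, Complex.norm_exp_ofReal_mul_I, mul_one, Complex.norm_real, Real.norm_eq_abs,
        abs_of_pos r.2.1]
      exact r.2.2)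
    simp [this]
  rw [hardyNormSq] at hn
  simp only [h0] at hn
  have : Nonempty (Ioo (0:ℝ) 1) := ⟨⟨1/2, by norm_num, by norm_num⟩⟩
  rw [ciSup_const] at hn
  exact zero_ne_one hn

/-- The properties of the distribution of the density of a normalized function used in the comparison. -/
lemma levelMeasure_properties (hf : DifferentiableOn ℂ f (Metric.ball 0 1))
    (hb : BddAbove (range fun r : Ioo (0:ℝ) 1 => circleMeanSq f r)) (hn : hardyNormSq f = 1) :
    Continuous (diskDensity f) ∧ (∀ z, diskDensity f z ≤ 1) ∧ (hypMeasure.map (diskDensity f)) (Iic 0) = 0 ∧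
    (∀ σ > 0, (hypMeasure.map (diskDensity f)) (Ioi σ) ≤ ENNReal.ofReal (1 / σ - 1)) ∧
    ∃ s : ℝ, 0 < s ∧ s < 1 ∧ ∀ σ : ℝ, 0 < σ → σ ≤ s →
      ENNReal.ofReal (s / σ - 1) ≤ (hypMeasure.map (diskDensity f)) (Ioi σ) := by
  obtain ⟨a, h⟩ := exists_coefficients hf
  have hS := hasSum_norm_sq_of_hardyNormSq h hb hn
  have hU := continuous_diskDensity hf h hS
  have hz := hyp_zeros hf (exists_ne_zero_of_hardyNormSq hn)
  have hIoi : ∀ σ, (hypMeasure.map (diskDensity f)) (Ioi σ) = hypMeasure {z | σ < diskDensity f z} := fun σ =>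
    Measure.map_apply hU.measurable measurableSet_Ioi
  refine ⟨hU, fun z => ?_, ?_, fun σ hσ => ?_, ?_⟩
  · by_cases hz1 : ‖z‖ < 1
    · rw [diskDensity_of_lt hz1]
      exact norm_sq_mul_le hz1 (h z hz1) hS
    · rw [diskDensity, if_neg hz1]
      exact zero_le_one
  · rw [Measure.map_apply hU.measurable measurableSet_Iic]
    exact hz
  · rw [hIoi]
    exact hyp_superlevel_le hf (fun r h0 h1 => circleMeanSq_le_one hb hn h0 h1) hσ
  · simp only [hIoi]
    exact exists_superlevel_ge hf hU hz

lemma exists_diskDensity_le_lt_one (hf : DifferentiableOn ℂ f (Metric.ball 0 1))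
    (hb : BddAbove (range fun r : Ioo (0:ℝ) 1 => circleMeanSq f r)) (hn : hardyNormSq f = 1) (hM : f ∉ hardyOpt) :
    ∃ τ, 0 ≤ τ ∧ τ < 1 ∧ ∀ z, diskDensity f z ≤ τ := by
  obtain ⟨hU, hU1, -⟩ := levelMeasure_properties hf hb hn
  obtain ⟨a, h⟩ := exists_coefficients hf
  have hS := hasSum_norm_sq_of_hardyNormSq h hb hn
  obtain ⟨w, -, hmax⟩ := (isCompact_closedBall (0:ℂ) 1).exists_isMaxOn ⟨0, by simp⟩ hU.continuousOn
  refine ⟨diskDensity f w, diskDensity_nonneg w, lt_of_le_of_ne (hU1 w) fun he => hM ?_, fun z => ?_⟩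
  · exact mem_hardyOpt_of_diskDensity_eq_one h hS (norm_lt_one_of_diskDensity_pos (by rw [he]; exact one_pos)) he
  · by_cases hz : ‖z‖ < 1
    · exact hmax (mem_closedBall_zero_iff.mpr hz.le)
    · rw [diskDensity, if_neg hz]
      exact diskDensity_nonneg w

end Extremal

end

/-- **Proposition 2.4 (Kulikov's inequality in the Hardy space).** For nondecreasing
`Φ : [0,1] → ℝ`, the supremum of `∫_𝔻 Φ(u_f(z)²) dm(z)`, with
`dm(z) = π⁻¹(1−|z|²)⁻² dA(z)`, over `f ∈ H²(𝔻)` with `‖f‖_{H²} = 1` equals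
`∫₀¹ Φ(s) s⁻² ds`; it is attained on `M`, and, if `Φ` is strictly increasing near `1` and
the supremum is finite, only on `M`. -/
theorem sharp_hardy (Φ : ℝ → ℝ) (hΦ : MonotoneOn Φ (Set.Icc 0 1)) :
    (∀ f : ℂ → ℂ, DifferentiableOn ℂ f (Metric.ball (0:ℂ) 1) →
      BddAbove (Set.range fun r : Set.Ioo (0:ℝ) 1 =>
        (2*Real.pi)⁻¹ * ∫ φ in Set.Ioc (-Real.pi) Real.pi,
          ‖f (((r : ℝ) : ℂ) * Complex.exp (Complex.I * (φ:ℂ)))‖^2) →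
      hardyNormSq f = 1 →
      (∫ z in Metric.ball (0:ℂ) 1,
          Φ ((uHardy f z)^2) * (Real.pi⁻¹ * ((1 - ‖z‖^2)^2)⁻¹)) ≤
        ∫ s in Set.Ioo (0:ℝ) 1, Φ s * (s^2)⁻¹) ∧
    (∀ f ∈ hardyOpt, DifferentiableOn ℂ f (Metric.ball (0:ℂ) 1) ∧
      BddAbove (Set.range fun r : Set.Ioo (0:ℝ) 1 =>
        (2*Real.pi)⁻¹ * ∫ φ in Set.Ioc (-Real.pi) Real.pi,
          ‖f (((r : ℝ) : ℂ) * Complex.exp (Complex.I * (φ:ℂ)))‖^2) ∧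
      hardyNormSq f = 1 ∧
      (∫ z in Metric.ball (0:ℂ) 1,
          Φ ((uHardy f z)^2) * (Real.pi⁻¹ * ((1 - ‖z‖^2)^2)⁻¹)) =
        ∫ s in Set.Ioo (0:ℝ) 1, Φ s * (s^2)⁻¹) ∧
    ((∀ s ∈ Set.Ico (0:ℝ) 1, ∃ t ∈ Set.Ioo s 1, Φ s < Φ t) →
      IntegrableOn (fun s => Φ s * (s^2)⁻¹) (Set.Ioo (0:ℝ) 1) →
      ∀ f : ℂ → ℂ, DifferentiableOn ℂ f (Metric.ball (0:ℂ) 1) →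
        BddAbove (Set.range fun r : Set.Ioo (0:ℝ) 1 =>
          (2*Real.pi)⁻¹ * ∫ φ in Set.Ioc (-Real.pi) Real.pi,
            ‖f (((r : ℝ) : ℂ) * Complex.exp (Complex.I * (φ:ℂ)))‖^2) →
        hardyNormSq f = 1 →
        (∫ z in Metric.ball (0:ℂ) 1,
            Φ ((uHardy f z)^2) * (Real.pi⁻¹ * ((1 - ‖z‖^2)^2)⁻¹)) =
          (∫ s in Set.Ioo (0:ℝ) 1, Φ s * (s^2)⁻¹) →
        f ∈ hardyOpt) := by
  refine ⟨fun f hf hb hn => ?_, fun f hf => ?_, fun hinc hintg f hf hb hn he => ?_⟩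
  · obtain ⟨hU, hU1, h0, hle, s, hs, hs1, hge⟩ := levelMeasure_properties hf hb hn
    rw [← integral_map_diskDensity hΦ hU hU1, ← integral_unitLevelMeasure]
    exact integral_le_integral_unitLevelMeasure (monotone_clampExtend hΦ) (clampExtend_le_one hΦ) h0 hle hs hs1 hge
  · obtain ⟨w, c, hw, hc, h⟩ := exists_kernel_form hf
    have hd := differentiableOn_kernel hw h
    obtain ⟨hb, hn⟩ := hardyNormSq_kernel hw hc h
    obtain ⟨hU, hU1, -⟩ := levelMeasure_properties hd hb hn
    refine ⟨hd, hb, hn, ?_⟩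
    rw [← integral_map_diskDensity hΦ hU hU1, ← integral_unitLevelMeasure,
      map_diskDensity_kernel hw fun z hz => diskDensity_kernel hw hc h hz]
  · by_contra hM
    obtain ⟨hU, hU1, h0, hle, s, hs, hs1, hge⟩ := levelMeasure_properties hf hb hn
    obtain ⟨τ, hτ0, hτ1, hτ⟩ := exists_diskDensity_le_lt_one hf hb hn hM
    obtain ⟨t, ht, hlt⟩ := hinc τ ⟨hτ0, hτ1⟩
    have ht0 : 0 < t := hτ0.trans_lt ht.1
    have hκ : (hypMeasure.map (diskDensity f)) (Set.Ioi τ) = 0 := by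
      rw [Measure.map_apply hU.measurable measurableSet_Ioi]
      have : diskDensity f ⁻¹' Set.Ioi τ = ∅ := Set.eq_empty_of_forall_notMem fun z hz => not_lt.mpr (hτ z) hz
      rw [this, measure_empty]
    have := integral_lt_integral_unitLevelMeasure (monotone_clampExtend hΦ) (clampExtend_le_one hΦ) h0 hle hs hs1 hge
      (integrable_unitLevelMeasure hintg) hκ ht0 ht.2
      (by rwa [clampExtend_of_mem ⟨hτ0, hτ1.le⟩, clampExtend_of_mem ⟨ht0.le, ht.2.le⟩])
    rw [integral_map_diskDensity hΦ hU hU1, integral_unitLevelMeasure] at this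
    exact this.ne he
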